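/- arXiv:1912.06043 — 4 statements merged into one kernel-verified Lean document; each statement's English description precedes it below -/
import Mathlib

section
/- Let F be a finite field with q ≥ 89 elements, q prime. Then every generalized k-arc in P²(F) satisfies k ≤ ⌊44q/45 + 8/9⌋ + 3. -/
/-- The projective plane over `F`: points are 1-dimensional subspaces of `F³`. -/
abbrev P2 (F : Type*) [Field F] := Projectivization F (Fin 3 → F)

/-- A conic in `P²(F)`: the vanishing set of a nonzero homogeneous quadratic form
in three variables (possibly reducible). -/
def IsConic {F : Type*} [Field F] (C : Set (P2 F)) : Prop :=
  ∃ Q : MvPolynomial (Fin 3) F, Q ≠ 0 ∧ Q.IsHomogeneous 2 ∧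
    C = {p : P2 F | MvPolynomial.eval p.rep Q = 0}

/-- A line in `P²(F)`: the vanishing set of a nonzero linear form in three variables. -/
def IsLine {F : Type*} [Field F] (L : Set (P2 F)) : Prop :=
  ∃ φ : MvPolynomial (Fin 3) F, φ ≠ 0 ∧ φ.IsHomogeneous 1 ∧
    L = {p : P2 F | MvPolynomial.eval p.rep φ = 0}

/-- A generalized arc: no conic contains 6 of its points. -/
def IsGenArc {F : Type*} [Field F] (K : Set (P2 F)) : Prop :=
  ∀ C : Set (P2 F), IsConic C → (K ∩ C).ncard ≤ 5

/-- An arc: no line contains 3 of its points. -/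
def IsArc {F : Type*} [Field F] (K : Set (P2 F)) : Prop :=
  ∀ L : Set (P2 F), IsLine L → (K ∩ L).ncard ≤ 2

open MvPolynomial in
theorem two_mul_finrank_restrictTotalDegree (F : Type*) [Field F] (r : ℕ) :
    2 * Module.finrank F (restrictTotalDegree (Fin 2) F r) = (r + 1) * (r + 2) := by
  have h1 : Module.finrank F (restrictTotalDegree (Fin 2) F r) =
      Nat.card {n : Fin 2 →₀ ℕ | (n.sum fun _ e => e) ≤ r} :=
    Module.finrank_eq_nat_card_basis (basisRestrictSupport F _)
  let e : (Fin 2 →₀ ℕ) ≃ ℕ × ℕ := Finsupp.equivFunOnFinite.trans (finTwoArrowEquiv ℕ)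
  have h2 : e '' {n : Fin 2 →₀ ℕ | (n.sum fun _ e => e) ≤ r} =
      (((Finset.range (r + 1)).sup Finset.HasAntidiagonal.antidiagonal : Finset (ℕ × ℕ)) : Set (ℕ × ℕ)) := by
    ext ⟨a, b⟩
    rw [Equiv.image_eq_preimage_symm]
    have : ((e.symm (a, b)).sum fun _ e => e) = a + b := by
      rw [Finsupp.sum_fintype _ _ (by simp)]
      simp [e]
    simp [this, Finset.mem_sup]
  rw [h1, Nat.card_coe_set_eq, ← Set.ncard_image_of_injective _ e.injective, h2,
    Set.ncard_coe_finset, Finset.sup_eq_biUnion, Finset.card_biUnion]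
  · simp only [Finset.Nat.card_antidiagonal]
    clear h1 h2
    induction r with
    | zero => simp
    | succ n ih => rw [Finset.sum_range_succ, mul_add, ih]; ring
  · intro x _ y _ hxy
    rw [Function.onFun, Finset.disjoint_left]
    rintro ⟨a, b⟩ h1 h2
    simp at h1 h2
    omega

open MvPolynomial in
theorem finrank_map_mulLeft_restrictTotalDegree {F : Type*} [Field F]
    {A : MvPolynomial (Fin 2) F} (hA : A ≠ 0) (s : ℕ) :
    2 * Module.finrank F ((restrictTotalDegree (Fin 2) F s).map (LinearMap.mulLeft F A)) =
      (s + 1) * (s + 2) := by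
  rw [← (Submodule.equivMapOfInjective (LinearMap.mulLeft F A)
      (mul_right_injective₀ hA) _).finrank_eq, two_mul_finrank_restrictTotalDegree]

open MvPolynomial in
theorem finrank_le_mul_totalDegree {F E : Type*} [Field F] [AddCommGroup E] [Module F E]
    [FiniteDimensional F E] {A B : MvPolynomial (Fin 2) F} (hA : A ≠ 0) (hB : B ≠ 0)
    (hAB : IsRelPrime A B) (Λ : MvPolynomial (Fin 2) F →ₗ[F] E)
    (hΛ : Function.Surjective Λ) (hΛA : ∀ f, Λ (A * f) = 0) (hΛB : ∀ f, Λ (B * f) = 0) :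
    Module.finrank F E ≤ A.totalDegree * B.totalDegree := by
  obtain ⟨r₀, hr₀⟩ : ∃ r₀, ∀ r, r₀ ≤ r →
      (restrictTotalDegree (Fin 2) F r).map Λ = ⊤ := by
    obtain ⟨S, hS⟩ := (Module.Finite.fg_top : (⊤ : Submodule F E).FG)
    choose g hg using hΛ
    refine ⟨S.sup fun x => (g x).totalDegree, fun r hr => ?_⟩
    rw [eq_top_iff, ← hS, Submodule.span_le]
    intro x hx
    refine ⟨g x, ?_, hg x⟩
    rw [SetLike.mem_coe, mem_restrictTotalDegree]
    exact (Finset.le_sup (f := fun x => (g x).totalDegree) hx).trans hr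
  set a := A.totalDegree with ha
  set b := B.totalDegree with hb
  obtain ⟨s, hs⟩ : ∃ s, r₀ ≤ s + a + b := ⟨r₀, by omega⟩
  set P := restrictTotalDegree (Fin 2) F (s + a + b) with hP
  set S₁ := (restrictTotalDegree (Fin 2) F (s + b)).map (LinearMap.mulLeft F A) with hS₁
  set S₂ := (restrictTotalDegree (Fin 2) F (s + a)).map (LinearMap.mulLeft F B) with hS₂
  have hinf : S₁ ⊓ S₂ ≤ (restrictTotalDegree (Fin 2) F s).map (LinearMap.mulLeft F (A * B)) := by
    rintro _ ⟨⟨f, hf, rfl⟩, ⟨g, hg, hfg⟩⟩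
    simp only [LinearMap.mulLeft_apply] at hfg ⊢
    have hBf : B ∣ f := hAB.symm.dvd_of_dvd_mul_left (hfg ▸ Dvd.intro _ rfl)
    obtain ⟨h, rfl⟩ := hBf
    refine ⟨h, ?_, by simp⟩
    by_cases hh : h = 0
    · simp [hh]
    rw [SetLike.mem_coe, mem_restrictTotalDegree] at hf ⊢
    rw [totalDegree_mul_of_isDomain hB hh] at hf
    omega
  have hle : S₁ ⊔ S₂ ≤ P := by
    refine sup_le ?_ ?_
    · rintro _ ⟨f, hf, rfl⟩
      rw [SetLike.mem_coe, mem_restrictTotalDegree] at hf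
      rw [hP, mem_restrictTotalDegree, LinearMap.mulLeft_apply]
      exact (totalDegree_mul _ _).trans (by omega)
    · rintro _ ⟨f, hf, rfl⟩
      rw [SetLike.mem_coe, mem_restrictTotalDegree] at hf
      rw [hP, mem_restrictTotalDegree, LinearMap.mulLeft_apply]
      exact (totalDegree_mul _ _).trans (by omega)
  have : FiniteDimensional F P := inferInstanceAs (Module.Finite F (restrictTotalDegree (Fin 2) F _))
  have : FiniteDimensional F S₁ := inferInstance
  have : FiniteDimensional F S₂ := inferInstance
  have hker : ((S₁ ⊔ S₂).comap P.subtype) ≤ LinearMap.ker (Λ.domRestrict P) := by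
    have : S₁ ⊔ S₂ ≤ LinearMap.ker Λ := by
      refine sup_le ?_ ?_
      · rintro _ ⟨f, _, rfl⟩; exact hΛA f
      · rintro _ ⟨f, _, rfl⟩; exact hΛB f
    exact fun x hx => this hx
  have h1 := LinearMap.finrank_range_add_finrank_ker (Λ.domRestrict P)
  have h2 : LinearMap.range (Λ.domRestrict P) = ⊤ := by
    rw [LinearMap.range_domRestrict]; exact hr₀ _ hs
  rw [h2, finrank_top] at h1
  have h3 := Submodule.finrank_mono hker
  rw [(Submodule.comapSubtypeEquivOfLe hle).finrank_eq] at h3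
  have h4 := Submodule.finrank_sup_add_finrank_inf_eq S₁ S₂
  have : FiniteDimensional F ((restrictTotalDegree (Fin 2) F s).map (LinearMap.mulLeft F (A * B))) :=
    inferInstance
  have h5 := Submodule.finrank_mono hinf
  have e1 := two_mul_finrank_restrictTotalDegree F (s + a + b)
  have e2 := finrank_map_mulLeft_restrictTotalDegree hA (s + b)
  have e3 := finrank_map_mulLeft_restrictTotalDegree hB (s + a)
  have e4 := finrank_map_mulLeft_restrictTotalDegree (mul_ne_zero hA hB) s
  rw [← hP] at e1
  rw [← hS₁] at e2
  rw [← hS₂] at e3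
  zify at *
  nlinarith

open MvPolynomial in
/-- Bezout-type bound: a finite family of pairwise coprime ideals, each of codimension at least `c`
and containing both `A` and `B`. -/
theorem mul_card_le_of_pairwise_isCoprime {F ι : Type*} [Field F] [Fintype ι]
    {A B : MvPolynomial (Fin 2) F} (hA : A ≠ 0) (hB : B ≠ 0)
    (hAB : IsRelPrime A B) (I : ι → Ideal (MvPolynomial (Fin 2) F))
    (hI : Pairwise fun i j => IsCoprime (I i) (I j))
    (hIA : ∀ i, A ∈ I i) (hIB : ∀ i, B ∈ I i) (c : ℕ)
    (V : ι → Type*) [∀ i, AddCommGroup (V i)] [∀ i, Module F (V i)]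
    [∀ i, FiniteDimensional F (V i)]
    (θ : ∀ i, MvPolynomial (Fin 2) F →ₗ[F] V i) (hθ : ∀ i, Function.Surjective (θ i))
    (hθI : ∀ i f, f ∈ I i → θ i f = 0) (hc : ∀ i, c ≤ Module.finrank F (V i)) :
    c * Fintype.card ι ≤ A.totalDegree * B.totalDegree := by
  have := finrank_le_mul_totalDegree hA hB hAB (LinearMap.pi θ) ?_ ?_ ?_
  · rw [Module.finrank_pi_fintype] at this
    refine le_trans ?_ this
    rw [mul_comm, ← smul_eq_mul, ← Finset.card_univ]
    exact Finset.card_nsmul_le_sum _ _ _ fun i _ => hc i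
  · intro v
    choose g hg using fun i => hθ i (v i)
    obtain ⟨f, hf⟩ := Ideal.pi_quotient_surjective hI (fun i => Ideal.Quotient.mk _ (g i))
    refine ⟨f, funext fun i => ?_⟩
    have h := hf i
    rw [Ideal.Quotient.eq] at h
    have h' := hθI i _ h
    rw [map_sub, sub_eq_zero] at h'
    rw [LinearMap.pi_apply, h', hg]
  · intro f; ext i; exact hθI i _ ((I i).mul_mem_right _ (hIA i))
  · intro f; ext i; exact hθI i _ ((I i).mul_mem_right _ (hIB i))

section Jets

open PowerSeries Nat

variable {F R : Type*} [Field F] [CommRing R] [Algebra F R]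

/-- Divided-power Taylor series of `f` along the derivation `D` at the point `ε`. -/
noncomputable def taylorJet (D : Derivation F R R) (ε : R →ₐ[F] F) (f : R) : F⟦X⟧ :=
  PowerSeries.mk fun n => ε (D^[n] f) * (n ! : F)⁻¹

variable (D : Derivation F R R) (ε : R →ₐ[F] F)

theorem coeff_taylorJet (n : ℕ) (f : R) :
    coeff n (taylorJet D ε f) = ε (D^[n] f) * (n ! : F)⁻¹ := coeff_mk _ _

theorem iterate_derivation_smul (n : ℕ) (c : F) (f : R) : D^[n] (c • f) = c • D^[n] f := by
  induction n with
  | zero => rfl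
  | succ n ih => rw [Function.iterate_succ_apply', ih, Derivation.map_smul, Function.iterate_succ_apply']

theorem taylorJet_add (f g : R) : taylorJet D ε (f + g) = taylorJet D ε f + taylorJet D ε g := by
  ext n
  rw [map_add, coeff_taylorJet, coeff_taylorJet, coeff_taylorJet, iterate_map_add, map_add, add_mul]

theorem taylorJet_smul (c : F) (f : R) : taylorJet D ε (c • f) = c • taylorJet D ε f := by
  ext n
  rw [coeff_smul, coeff_taylorJet, coeff_taylorJet, iterate_derivation_smul D, map_smul, smul_eq_mul,
    smul_eq_mul, mul_assoc]

theorem taylorJet_one : taylorJet D ε 1 = 1 := by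
  ext n
  rw [coeff_taylorJet, coeff_one]
  cases n with
  | zero => simp
  | succ n => rw [Function.iterate_succ_apply, D.map_one_eq_zero, iterate_map_zero]; simp

theorem constantCoeff_taylorJet (f : R) : constantCoeff (taylorJet D ε f) = ε f := by
  rw [← coeff_zero_eq_constantCoeff_apply, coeff_taylorJet]; simp

variable {p : ℕ} [hp : Fact p.Prime] [CharP F p]

omit [hp : Fact p.Prime] in
theorem natCast_ne_zero_of_lt_char {n : ℕ} (h0 : n ≠ 0) (hn : n < p) : (n : F) ≠ 0 := by
  rw [Ne, CharP.cast_eq_zero_iff F p]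
  exact fun h => absurd (Nat.le_of_dvd (Nat.pos_of_ne_zero h0) h) (by omega)

theorem factorial_ne_zero_of_lt_char {n : ℕ} (hn : n < p) : (n ! : F) ≠ 0 := by
  rw [Ne, CharP.cast_eq_zero_iff F p, hp.out.dvd_factorial]
  omega

theorem succ_mul_coeff_taylorJet {n : ℕ} (hn : n + 1 < p) (f : R) :
    coeff (n + 1) (taylorJet D ε f) * (n + 1 : F) = coeff n (taylorJet D ε (D f)) := by
  rw [coeff_taylorJet, coeff_taylorJet, Function.iterate_succ_apply, Nat.factorial_succ]
  have h1 := natCast_ne_zero_of_lt_char (F := F) (p := p) (Nat.succ_ne_zero n) hn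
  have h2 := factorial_ne_zero_of_lt_char (F := F) (p := p) (n := n) (by omega)
  push_cast at h1 ⊢
  field_simp

theorem coeff_taylorJet_mul {n : ℕ} (hn : n < p) (f g : R) :
    coeff n (taylorJet D ε (f * g)) = coeff n (taylorJet D ε f * taylorJet D ε g) := by
  induction n generalizing f g with
  | zero => simp [constantCoeff_taylorJet]
  | succ n ih =>
    have h1 := natCast_ne_zero_of_lt_char (F := F) (p := p) (Nat.succ_ne_zero n) hn
    push_cast at h1
    apply mul_right_cancel₀ h1
    rw [succ_mul_coeff_taylorJet D ε hn, D.leibniz, taylorJet_add, map_add, smul_eq_mul,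
      smul_eq_mul, ih (by omega), ih (by omega), ← coeff_derivative, Derivation.leibniz, map_add,
      smul_eq_mul, smul_eq_mul, coeff_mul, coeff_mul, coeff_mul, coeff_mul]
    congr 1 <;>
    · refine Finset.sum_congr rfl fun x hx => ?_
      rw [Finset.HasAntidiagonal.mem_antidiagonal] at hx
      rw [coeff_derivative, succ_mul_coeff_taylorJet D ε (p := p) (by omega)]

/-- Taylor expansion modulo `X ^ p`, as a ring homomorphism. -/
noncomputable def taylorHom (p : ℕ) [Fact p.Prime] [CharP F p] :
    R →+* F⟦X⟧ ⧸ Ideal.span {(X ^ p : F⟦X⟧)} where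
  toFun f := Ideal.Quotient.mk _ (taylorJet D ε f)
  map_one' := by rw [taylorJet_one, map_one]
  map_zero' := by
    have : taylorJet D ε 0 = 0 := by simpa using taylorJet_smul D ε 0 0
    rw [this, map_zero]
  map_add' f g := by rw [taylorJet_add, map_add]
  map_mul' f g := by
    rw [← map_mul, Ideal.Quotient.eq, Ideal.mem_span_singleton, X_pow_dvd_iff]
    intro n hn
    rw [map_sub, coeff_taylorJet_mul D ε hn, sub_self]

/-- Functions vanishing to order at least `k` along `D` at `ε`. -/
def jetIdeal {k : ℕ} (hk : k ≤ p) : Ideal R where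
  carrier := {f | ∀ j < k, coeff j (taylorJet D ε f) = 0}
  zero_mem' := by
    intro j _
    have : taylorJet D ε 0 = 0 := by simpa using taylorJet_smul D ε 0 0
    rw [this, map_zero]
  add_mem' {f g} hf hg j hj := by rw [taylorJet_add, map_add, hf j hj, hg j hj, add_zero]
  smul_mem' g f hf j hj := by
    rw [smul_eq_mul, coeff_taylorJet_mul D ε (p := p) (by omega), coeff_mul]
    refine Finset.sum_eq_zero fun x hx => ?_
    rw [Finset.HasAntidiagonal.mem_antidiagonal] at hx
    rw [hf x.2 (by omega), mul_zero]

theorem mem_jetIdeal {k : ℕ} (hk : k ≤ p) (f : R) :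
    f ∈ jetIdeal D ε hk ↔ ∀ j < k, coeff j (taylorJet D ε f) = 0 := Iff.rfl

theorem coeff_taylorJet_pow {l : R} (hl : ε l = 0) (n : ℕ) (hn : n < p) :
    (∀ j < n, coeff j (taylorJet D ε (l ^ n)) = 0) ∧
      coeff n (taylorJet D ε (l ^ n)) = ε (D l) ^ n := by
  induction n with
  | zero => simp [taylorJet_one]
  | succ n ih =>
    obtain ⟨h1, h2⟩ := ih (by omega)
    have hc0 : coeff 0 (taylorJet D ε l) = 0 := by
      rw [coeff_zero_eq_constantCoeff_apply, constantCoeff_taylorJet, hl]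
    have hc1 : coeff 1 (taylorJet D ε l) = ε (D l) := by
      rw [coeff_taylorJet]; simp
    constructor
    · intro j hj
      rw [pow_succ, coeff_taylorJet_mul D ε (p := p) (by omega), coeff_mul]
      refine Finset.sum_eq_zero fun x hx => ?_
      rw [Finset.HasAntidiagonal.mem_antidiagonal] at hx
      rcases Nat.eq_zero_or_pos x.2 with h | h
      · rw [h, hc0, mul_zero]
      · rw [h1 _ (by omega), zero_mul]
    · rw [pow_succ, coeff_taylorJet_mul D ε (p := p) (by omega), coeff_mul,
        Finset.sum_eq_single (n, 1), h2, hc1, pow_succ]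
      · rintro ⟨a, b⟩ hx hne
        rw [Finset.HasAntidiagonal.mem_antidiagonal] at hx
        simp only at hx ⊢
        rcases Nat.eq_zero_or_pos b with h | h
        · rw [h, hc0, mul_zero]
        · have : b ≠ 1 := by
            rintro rfl
            exact hne (by rw [Prod.mk.injEq]; omega)
          rw [h1 _ (by omega), zero_mul]
      · simp

theorem pow_mem_jetIdeal {k : ℕ} (hk : k ≤ p) {l : R} (hl : ε l = 0) : l ^ k ∈ jetIdeal D ε hk := by
  rcases hk.lt_or_eq with h | h
  · exact fun j hj => (coeff_taylorJet_pow D ε hl k h).1 j hj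
  · intro j hj
    have hk0 : k = (k - 1) + 1 := by omega
    have hc0 : coeff 0 (taylorJet D ε l) = 0 := by
      rw [coeff_zero_eq_constantCoeff_apply, constantCoeff_taylorJet, hl]
    rw [hk0, pow_succ, coeff_taylorJet_mul D ε (p := p) (by omega), coeff_mul]
    refine Finset.sum_eq_zero fun x hx => ?_
    rw [Finset.HasAntidiagonal.mem_antidiagonal] at hx
    rcases Nat.eq_zero_or_pos x.2 with h | h
    · rw [h, hc0, mul_zero]
    · rw [(coeff_taylorJet_pow D ε hl (k - 1) (by omega)).1 _ (by omega), zero_mul]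

/-- The jet coefficients of order below `k`. -/
noncomputable def jetMap (k : ℕ) : R →ₗ[F] (Fin k → F) where
  toFun f j := coeff (j : ℕ) (taylorJet D ε f)
  map_add' f g := by ext j; simp [taylorJet_add]
  map_smul' c f := by ext j; simp [taylorJet_smul]

include hp in
theorem jetMap_surjective {k : ℕ} (hk : k ≤ p) {l : R} (hl : ε l = 0) (hDl : ε (D l) ≠ 0) :
    Function.Surjective (jetMap D ε k) := by
  have key : ∀ n ≤ k, ∀ v : ℕ → F, ∃ f : R, ∀ j < n, coeff j (taylorJet D ε f) = v j := by
    intro n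
    induction n with
    | zero => intro _ v; exact ⟨0, by simp⟩
    | succ n ih =>
      intro hn v
      obtain ⟨f, hf⟩ := ih (by omega) v
      obtain ⟨h1, h2⟩ := coeff_taylorJet_pow D ε (p := p) hl n (by omega)
      refine ⟨f + ((v n - coeff n (taylorJet D ε f)) * (ε (D l) ^ n)⁻¹) • l ^ n, fun j hj => ?_⟩
      rw [taylorJet_add, taylorJet_smul, map_add, coeff_smul]
      rcases Nat.lt_succ_iff_lt_or_eq.1 hj with h | rfl
      · rw [h1 j h, hf j h, smul_zero, add_zero]
      · rw [h2, smul_eq_mul, mul_assoc, inv_mul_cancel₀ (pow_ne_zero _ hDl)]; ring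
  intro v
  obtain ⟨f, hf⟩ := key k le_rfl (fun j => if h : j < k then v ⟨j, h⟩ else 0)
  refine ⟨f, funext fun j => ?_⟩
  change coeff (j : ℕ) (taylorJet D ε f) = v j
  rw [hf j j.2, dif_pos j.2]

end Jets

open PowerSeries in
/-- The leading term of a determinant whose `(i, j)` entry has order at least `e j - i`. -/
theorem exists_det_eq_X_pow_mul {F : Type*} [Field F] {n : ℕ}
    (L : Matrix (Fin n) (Fin n) F⟦X⟧) (e : Fin n → ℕ) (c : Fin n → F)
    (hc : ∀ j, c j ≠ 0) (he : Function.Injective fun j => (e j : F))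
    (h0 : ∀ (i j : Fin n) (m : ℕ), m + (i : ℕ) < e j → coeff m (L i j) = 0)
    (h1 : ∀ i j : Fin n, (i : ℕ) ≤ e j → coeff (e j - i) (L i j) = c j * ((e j).descFactorial i : F)) :
    ∃ U : F⟦X⟧, constantCoeff U ≠ 0 ∧
      X ^ (∑ i : Fin n, (i : ℕ)) * L.det = X ^ (∑ j, e j) * U := by
  let N : Matrix (Fin n) (Fin n) F⟦X⟧ := fun i j =>
    PowerSeries.mk fun m => coeff (m + e j) (X ^ (i : ℕ) * L i j)
  have hN : ∀ i j : Fin n, X ^ (i : ℕ) * L i j = X ^ e j * N i j := by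
    intro i j
    ext m
    rw [coeff_X_pow_mul' _ (e j) m]
    split_ifs with h
    · simp only [N, coeff_mk]
      rw [Nat.sub_add_cancel h]
    · rw [coeff_X_pow_mul']
      split_ifs with h'
      · exact h0 _ _ _ (by omega)
      · rfl
  refine ⟨N.det, ?_, ?_⟩
  · have hmap : N.map constantCoeff =
        Matrix.of fun i j => c j * (Matrix.of fun (i j : Fin n) =>
          ((descPochhammer F i).eval (e j : F))) i j := by
      ext i j
      rw [Matrix.map_apply, ← coeff_zero_eq_constantCoeff_apply]
      simp only [N, coeff_mk, zero_add, Matrix.of_apply]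
      rw [coeff_X_pow_mul', descPochhammer_eval_eq_descFactorial]
      split_ifs with h
      · exact h1 i j h
      · rw [Nat.descFactorial_of_lt (by omega)]; simp
    have hdet : constantCoeff N.det = (N.map constantCoeff).det := by
      rw [RingHom.map_det]; rfl
    rw [hdet, hmap, Matrix.det_mul_row]
    refine mul_ne_zero (Finset.prod_ne_zero_iff.2 fun j _ => hc j) ?_
    rw [← Matrix.det_transpose]
    have := Matrix.det_eval_matrixOfPolynomials_eq_det_vandermonde (fun j => (e j : F))
      (fun i : Fin n => descPochhammer F i) (fun i => descPochhammer_natDegree F i)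
      (fun i => monic_descPochhammer F i)
    have h2 := Matrix.det_vandermonde_ne_zero_iff.2 he
    rw [this] at h2
    exact h2
  · have h2 := Matrix.det_mul_column (fun i : Fin n => (X : F⟦X⟧) ^ (i : ℕ)) L
    have h3 := Matrix.det_mul_row (fun j : Fin n => (X : F⟦X⟧) ^ e j) N
    rw [Finset.prod_pow_eq_pow_sum] at h2 h3
    rw [← h2, ← h3]
    congr 1
    ext1 i j
    exact hN i j

/-- A basis adapted to a separating sequence of functionals. -/
theorem exists_strictMono_adapted {F : Type*} [Field F] (N : ℕ) :
    ∀ (n : ℕ) (V : Type*) [AddCommGroup V] [Module F V] [FiniteDimensional F V]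
      (_ : Module.finrank F V = n) (l : ℕ → V →ₗ[F] F)
      (_ : ∀ v, (∀ j < N, l j v = 0) → v = 0),
    ∃ (b : Fin n → V) (e : Fin n → ℕ), LinearIndependent F b ∧ StrictMono e ∧
      (∀ i, e i < N) ∧ (∀ i, ∀ j < e i, l j (b i) = 0) ∧ ∀ i, l (e i) (b i) ≠ 0 := by
  induction N with
  | zero =>
    intro n V _ _ _ hn l hl
    have : Subsingleton V := ⟨fun a b => by rw [hl a (by simp), hl b (by simp)]⟩
    obtain rfl : n = 0 := by rw [← hn]; exact Module.finrank_zero_of_subsingleton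
    exact ⟨Fin.elim0, Fin.elim0, linearIndependent_empty_type, fun i => i.elim0,
      fun i => i.elim0, fun i => i.elim0, fun i => i.elim0⟩
  | succ N ih =>
    intro n V _ _ _ hn l hl
    by_cases h : ∃ v, l 0 v ≠ 0
    · obtain ⟨v, hv⟩ := h
      have hr := LinearMap.finrank_range_add_finrank_ker (l 0)
      have hs : LinearMap.range (l 0) = ⊤ :=
        LinearMap.range_eq_top.2 (LinearMap.surjective (by rintro h; simp [h] at hv))
      rw [hs, finrank_top, Module.finrank_self] at hr
      obtain ⟨n, rfl⟩ : ∃ m, n = m + 1 := ⟨n - 1, by omega⟩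
      obtain ⟨b, e, hb, he, heN, h0, h1⟩ := ih n (LinearMap.ker (l 0)) (by omega)
        (fun j => (l (j + 1)).domRestrict _) (by
          rintro ⟨w, hw⟩ h
          rw [Submodule.mk_eq_zero]
          refine hl w fun j hj => ?_
          cases j with
          | zero => exact hw
          | succ j => exact h j (by omega))
      refine ⟨Fin.cons v fun i => (b i : V), Fin.cons 0 fun i => e i + 1, ?_, ?_, ?_, ?_, ?_⟩
      · rw [linearIndependent_finCons]
        refine ⟨hb.map' (LinearMap.ker (l 0)).subtype (Submodule.ker_subtype _), fun hmem => hv ?_⟩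
        have : Submodule.span F (Set.range fun i => (b i : V)) ≤ LinearMap.ker (l 0) := by
          rw [Submodule.span_le]
          rintro _ ⟨i, rfl⟩
          exact (b i).2
        exact this hmem
      · intro i j hij
        cases j using Fin.cases with
        | zero => exact absurd hij (Fin.not_lt_zero _)
        | succ j =>
          cases i using Fin.cases with
          | zero => simp
          | succ i => simpa using he (Fin.succ_lt_succ_iff.1 hij)
      · intro i
        cases i using Fin.cases with
        | zero => simp
        | succ i => simpa using heN i
      · intro i j hj
        cases i using Fin.cases with
        | zero => simp at hj
        | succ i =>
          rw [Fin.cons_succ] at hj ⊢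
          cases j with
          | zero => exact (b i).2
          | succ j => exact h0 i j (Nat.lt_of_succ_lt_succ hj)
      · intro i
        cases i using Fin.cases with
        | zero => simpa using hv
        | succ i => simpa using h1 i
    · push Not at h
      obtain ⟨b, e, hb, he, heN, h0, h1⟩ := ih n V hn (fun j => l (j + 1)) (by
          intro w hw
          refine hl w fun j hj => ?_
          cases j with
          | zero => exact h w
          | succ j => exact hw j (by omega))
      refine ⟨b, fun i => e i + 1, hb, fun i j hij => Nat.succ_lt_succ (he hij),
        fun i => Nat.succ_lt_succ (heN i), fun i j hj => ?_, h1⟩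
      cases j with
      | zero => exact h _
      | succ j => exact h0 i j (Nat.lt_of_succ_lt_succ hj)

section Curve

open MvPolynomial

variable {F : Type*} [Field F]

theorem mul_card_le_of_points {A B : MvPolynomial (Fin 2) F} (hA : A ≠ 0) (hB : B ≠ 0)
    (hAB : IsRelPrime A B) (S : Finset (Fin 2 → F)) (c k : ℕ)
    (h : ∀ P ∈ S, ∃ (I : Ideal (MvPolynomial (Fin 2) F)) (n : ℕ)
      (θ : MvPolynomial (Fin 2) F →ₗ[F] (Fin n → F)), c ≤ n ∧ Function.Surjective θ ∧
      (∀ f ∈ I, θ f = 0) ∧ A ∈ I ∧ B ∈ I ∧ ∀ i, (X i - C (P i)) ^ k ∈ I) :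
    c * S.card ≤ A.totalDegree * B.totalDegree := by
  choose I n θ hn hθ hθI hIA hIB hk using h
  rw [← Fintype.card_coe]
  refine mul_card_le_of_pairwise_isCoprime hA hB hAB (fun P : S => I P P.2) ?_
    (fun P => hIA P P.2) (fun P => hIB P P.2) c (fun P : S => Fin (n P P.2) → F)
    (fun P => θ P P.2) (fun P => hθ P P.2) (fun P => hθI P P.2) (fun P => by simpa using hn P P.2)
  intro P P' hPP'
  obtain ⟨i, hi⟩ := Function.ne_iff.1 fun h => hPP' (Subtype.ext h)
  have h1 : IsCoprime ((X i : MvPolynomial (Fin 2) F) - C (P.1 i)) (X i - C (P'.1 i)) := by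
    refine ⟨C (P'.1 i - P.1 i)⁻¹, -C (P'.1 i - P.1 i)⁻¹, ?_⟩
    have : (P'.1 i - P.1 i)⁻¹ * (P'.1 i - P.1 i) = 1 :=
      inv_mul_cancel₀ (sub_ne_zero.2 (Ne.symm hi))
    rw [← C_1, ← this, C_mul, C_sub]
    ring
  obtain ⟨u, v, huv⟩ := h1.pow (m := k) (n := k)
  simp only [Ideal.isCoprime_iff_exists]
  exact ⟨_, (I P P.2).mul_mem_left u (hk P P.2 i), _, (I P' P'.2).mul_mem_left v (hk P' P'.2 i), huv⟩

theorem card_common_zeros_le {A B : MvPolynomial (Fin 2) F} (hA : A ≠ 0) (hB : B ≠ 0)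
    (hAB : IsRelPrime A B) (S : Finset (Fin 2 → F)) (h : ∀ P ∈ S, eval P A = 0 ∧ eval P B = 0) :
    S.card ≤ A.totalDegree * B.totalDegree := by
  rw [← one_mul S.card]
  refine mul_card_le_of_points hA hB hAB S 1 1 fun P hP => ?_
  refine ⟨RingHom.ker (eval P), 1, LinearMap.pi fun _ => (aeval P).toLinearMap, le_rfl, ?_, ?_,
    (h P hP).1, (h P hP).2, fun i => ?_⟩
  · intro v
    refine ⟨C (v 0), funext fun i => ?_⟩
    rw [Subsingleton.elim i 0]
    simp
  · intro f hf
    ext i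
    simpa [coe_aeval_eq_eval] using hf
  · simp [RingHom.mem_ker]

theorem isRelPrime_of_totalDegree_lt {H Q : MvPolynomial (Fin 2) F} (hH : Irreducible H)
    (hQ : Q ≠ 0) (hd : Q.totalDegree < H.totalDegree) : IsRelPrime H Q := by
  rw [hH.isRelPrime_iff_not_dvd]
  intro h
  exact absurd (totalDegree_le_of_dvd_of_isDomain h hQ) (by omega)

theorem totalDegree_pderiv_lt {i : Fin 2} {f : MvPolynomial (Fin 2) F} (h : pderiv i f ≠ 0) :
    (pderiv i f).totalDegree < f.totalDegree := by
  have key : ∀ m ∈ (pderiv i f).support, (m.sum fun _ e => e) + 1 ≤ f.totalDegree := by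
    intro m hm
    rw [mem_support_iff, coeff_pderiv] at hm
    have h1 := le_totalDegree (mem_support_iff.2 (left_ne_zero_of_mul hm))
    rwa [Finsupp.sum_add_index' (by simp) (by simp), Finsupp.sum_single_index rfl] at h1
  obtain ⟨m, hm⟩ := support_nonempty.2 h
  refine (Finset.sup_lt_iff (bot_lt_iff_ne_bot.2 ?_)).2 fun m hm => key m hm
  have := key m hm
  rw [bot_eq_zero]
  omega

theorem totalDegree_pderiv_le (i : Fin 2) (f : MvPolynomial (Fin 2) F) :
    (pderiv i f).totalDegree ≤ f.totalDegree := by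
  by_cases h : pderiv i f = 0
  · simp [h]
  · exact (totalDegree_pderiv_lt h).le

/-- The derivation along the curve `H = 0`. -/
noncomputable def tangentDerivation (H : MvPolynomial (Fin 2) F) :
    Derivation F (MvPolynomial (Fin 2) F) (MvPolynomial (Fin 2) F) :=
  pderiv 1 H • pderiv 0 - pderiv 0 H • pderiv 1

theorem tangentDerivation_apply (H f : MvPolynomial (Fin 2) F) :
    tangentDerivation H f = pderiv 1 H * pderiv 0 f - pderiv 0 H * pderiv 1 f := rfl

theorem tangentDerivation_self (H : MvPolynomial (Fin 2) F) : tangentDerivation H H = 0 := by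
  rw [tangentDerivation_apply]; ring

theorem totalDegree_iterate_tangentDerivation_le (H f : MvPolynomial (Fin 2) F) (n : ℕ) :
    ((tangentDerivation H)^[n] f).totalDegree ≤ f.totalDegree + n * H.totalDegree := by
  induction n with
  | zero => simp
  | succ n ih =>
    rw [Function.iterate_succ_apply', tangentDerivation_apply]
    refine (totalDegree_sub _ _).trans (max_le ?_ ?_) <;>
    · refine (totalDegree_mul _ _).trans ?_
      have h0 := totalDegree_pderiv_le 0 H
      have h1 := totalDegree_pderiv_le 1 H
      have h0' := totalDegree_pderiv_le 0 ((tangentDerivation H)^[n] f)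
      have h1' := totalDegree_pderiv_le 1 ((tangentDerivation H)^[n] f)
      rw [add_mul, one_mul]
      omega

/-- A zero of `H` at which some partial derivative does not vanish. -/
def IsSmoothZero (H : MvPolynomial (Fin 2) F) (P : Fin 2 → F) : Prop :=
  eval P H = 0 ∧ ∃ i, eval P (pderiv i H) ≠ 0

variable {H : MvPolynomial (Fin 2) F} {P : Fin 2 → F}

theorem IsSmoothZero.exists_uniformizer (h : IsSmoothZero H P) :
    ∃ l : MvPolynomial (Fin 2) F, aeval P l = 0 ∧ aeval P (tangentDerivation H l) ≠ 0 := by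
  obtain ⟨_, i, hi⟩ := h
  fin_cases i
  · refine ⟨X 1 - C (P 1), by simp, ?_⟩
    simpa [tangentDerivation_apply, coe_aeval_eq_eval, pderiv_X] using hi
  · refine ⟨X 0 - C (P 0), by simp, ?_⟩
    simpa [tangentDerivation_apply, coe_aeval_eq_eval, pderiv_X] using hi

variable {p : ℕ} [Fact p.Prime] [CharP F p]

theorem self_mem_jetIdeal (h : eval P H = 0) {k : ℕ} (hk : k ≤ p) :
    H ∈ jetIdeal (tangentDerivation H) (aeval P) hk := by
  intro j _
  rw [coeff_taylorJet]
  cases j with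
  | zero => simp [h]
  | succ j => rw [Function.iterate_succ_apply, tangentDerivation_self, iterate_map_zero]; simp

/-- The codimension of the jet ideal at a smooth point, packaged for `mul_card_le_of_points`. -/
theorem IsSmoothZero.exists_ideal (h : IsSmoothZero H P) {k : ℕ} (hk : k ≤ p)
    {B : MvPolynomial (Fin 2) F} (hB : B ∈ jetIdeal (tangentDerivation H) (aeval P) hk) :
    ∃ (I : Ideal (MvPolynomial (Fin 2) F)) (n : ℕ)
      (θ : MvPolynomial (Fin 2) F →ₗ[F] (Fin n → F)), k ≤ n ∧ Function.Surjective θ ∧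
      (∀ f ∈ I, θ f = 0) ∧ H ∈ I ∧ B ∈ I ∧ ∀ i, (X i - C (P i)) ^ k ∈ I := by
  obtain ⟨l, hl, hDl⟩ := h.exists_uniformizer
  refine ⟨jetIdeal (tangentDerivation H) (aeval P) hk, k, jetMap (tangentDerivation H) (aeval P) k,
    le_rfl, jetMap_surjective _ _ hk hl hDl, fun f hf => funext fun j => hf j j.2,
    self_mem_jetIdeal h.1 hk, hB, fun i => pow_mem_jetIdeal _ _ hk (by simp)⟩

theorem IsSmoothZero.exists_coeff_ne_zero (hP : IsSmoothZero H P) (hH : Irreducible H)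
    (hd : 3 ≤ H.totalDegree) (hp : 2 * H.totalDegree + 1 ≤ p) {Q : MvPolynomial (Fin 2) F}
    (hQ : Q ≠ 0) (hQ2 : Q.totalDegree ≤ 2) :
    ∃ j < 2 * H.totalDegree + 1,
      PowerSeries.coeff j (taylorJet (tangentDerivation H) (aeval P) Q) ≠ 0 := by
  by_contra! hcon
  have := mul_card_le_of_points hH.ne_zero hQ (isRelPrime_of_totalDegree_lt hH hQ (by omega)) {P}
    (2 * H.totalDegree + 1) (2 * H.totalDegree + 1) (by
      intro P' hP'
      obtain rfl := Finset.mem_singleton.1 hP'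
      exact hP.exists_ideal hp hcon)
  rw [Finset.card_singleton] at this
  nlinarith

end Curve

section Wronskian

open MvPolynomial

variable {F : Type*} [Field F]

/-- The monomials of degree at most two in two variables. -/
noncomputable def quadMonomials (F : Type*) [Field F] : Fin 6 → MvPolynomial (Fin 2) F :=
  ![1, X 0, X 1, X 0 ^ 2, X 0 * X 1, X 1 ^ 2]

theorem totalDegree_linearCombination_quadMonomials_le (v : Fin 6 → F) :
    (Fintype.linearCombination F (quadMonomials F) v).totalDegree ≤ 2 := by
  rw [Fintype.linearCombination_apply]
  refine totalDegree_finsetSum_le fun i _ => (totalDegree_smul_le _ _).trans ?_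
  fin_cases i
  · simp [quadMonomials]
  · simp [quadMonomials]
  · simp [quadMonomials]
  · simp [quadMonomials]
  · exact (totalDegree_mul _ _).trans (by simp)
  · simp [quadMonomials]

theorem linearCombination_quadMonomials_injective (h2 : (2 : F) ≠ 0) :
    Function.Injective (Fintype.linearCombination F (quadMonomials F)) := by
  rw [← LinearMap.ker_eq_bot, LinearMap.ker_eq_bot']
  intro v hv
  rw [Fintype.linearCombination_apply] at hv
  simp only [Fin.sum_univ_six, quadMonomials, Matrix.cons_val] at hv
  have h0 := congrArg (aeval (0 : Fin 2 → F)) hv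
  have h1 := congrArg (fun f => aeval (0 : Fin 2 → F) (pderiv 0 f)) hv
  have h3 := congrArg (fun f => aeval (0 : Fin 2 → F) (pderiv 1 f)) hv
  have h4 := congrArg (fun f => aeval (0 : Fin 2 → F) (pderiv 0 (pderiv 0 f))) hv
  have h5 := congrArg (fun f => aeval (0 : Fin 2 → F) (pderiv 0 (pderiv 1 f))) hv
  have h6 := congrArg (fun f => aeval (0 : Fin 2 → F) (pderiv 1 (pderiv 1 f))) hv
  have hC : constantCoeff (2 : MvPolynomial (Fin 2) F) = 2 := map_ofNat _ 2
  simp [pderiv_X, hC, h2] at h0 h1 h3 h4 h5 h6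
  ext i
  fin_cases i
  · exact h0
  · exact h1
  · exact h3
  · exact h4
  · exact h5
  · exact h6

/-- The Frobenius–Wronskian matrix of six functions. -/
noncomputable def frobWronskian {R : Type*} [CommRing R] [Algebra F R] (D : Derivation F R R)
    (q : ℕ) (f : Fin 6 → R) : Matrix (Fin 6) (Fin 6) R :=
  Matrix.of (Fin.cons (fun j => f j ^ q) fun (i : Fin 5) j => D^[i] (f j))

theorem totalDegree_det_le {n : ℕ} (M : Matrix (Fin n) (Fin n) (MvPolynomial (Fin 2) F))
    (w : Fin n → ℕ) (h : ∀ i j, (M i j).totalDegree ≤ w i) : M.det.totalDegree ≤ ∑ i, w i := by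
  rw [Matrix.det_apply]
  refine totalDegree_finsetSum_le fun σ _ => (totalDegree_smul_le _ _).trans ?_
  refine (totalDegree_finsetProd _ _).trans ?_
  exact (Finset.sum_le_sum fun i _ => h (σ i) i).trans_eq (Equiv.sum_comp σ w)

theorem totalDegree_det_frobWronskian_le (H : MvPolynomial (Fin 2) F) (q : ℕ) :
    (frobWronskian (tangentDerivation H) q (quadMonomials F)).det.totalDegree ≤
      2 * q + 10 + 10 * H.totalDegree := by
  have hφ : ∀ j, (quadMonomials F j).totalDegree ≤ 2 := fun j => by
    have := totalDegree_linearCombination_quadMonomials_le (Pi.single j (1 : F))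
    rwa [Fintype.linearCombination_apply_single, one_smul] at this
  refine (totalDegree_det_le _ (Fin.cons (2 * q) fun i : Fin 5 => 2 + i * H.totalDegree) ?_).trans ?_
  · intro i j
    cases i using Fin.cases with
    | zero =>
      refine (totalDegree_pow _ _).trans ?_
      rw [Fin.cons_zero, mul_comm]
      exact Nat.mul_le_mul_right _ (hφ j)
    | succ i =>
      refine (totalDegree_iterate_tangentDerivation_le H _ _).trans ?_
      rw [Fin.cons_succ]
      exact Nat.add_le_add_right (hφ j) _
  · rw [Fin.sum_cons]
    simp [Fin.sum_univ_five]
    omega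

variable {p : ℕ} [hp : Fact p.Prime] [CharP F p]

omit [CharP F p] in
theorem frobWronskian_linearCombination [Fintype F] (hF : Fintype.card F = p) {R : Type*}
    [CommRing R] [Algebra F R] [CharP R p] (D : Derivation F R R) (φ : Fin 6 → R)
    (b : Matrix (Fin 6) (Fin 6) F) :
    frobWronskian D p (fun j => Fintype.linearCombination F φ (b j)) =
      frobWronskian D p φ * b.transpose.map (algebraMap F R) := by
  ext i j
  rw [Matrix.mul_apply]
  simp only [Matrix.map_apply, Matrix.transpose_apply]
  cases i using Fin.cases with
  | zero =>
    change (Fintype.linearCombination F φ (b j)) ^ p = ∑ k, φ k ^ p * _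
    rw [Fintype.linearCombination_apply, sum_pow_char]
    refine Finset.sum_congr rfl fun k _ => ?_
    rw [Algebra.smul_def, mul_pow, ← map_pow, ← hF, FiniteField.pow_card, mul_comm]
  | succ i =>
    change D^[i] (Fintype.linearCombination F φ (b j)) = ∑ k, D^[i] (φ k) * _
    rw [Fintype.linearCombination_apply]
    have hs : ∀ s : Finset (Fin 6), D^[i] (∑ k ∈ s, b j k • φ k) = ∑ k ∈ s, D^[i] (b j k • φ k) := by
      intro s
      induction s using Finset.induction_on with
      | empty => simp
      | insert a s ha ih => rw [Finset.sum_insert ha, iterate_map_add, ih, Finset.sum_insert ha]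
    rw [hs]
    refine Finset.sum_congr rfl fun k _ => ?_
    rw [iterate_derivation_smul, Algebra.smul_def, mul_comm]

omit [CharP F p] in
theorem det_frobWronskian_linearCombination [Fintype F] (hF : Fintype.card F = p) {R : Type*}
    [CommRing R] [Algebra F R] [CharP R p] (D : Derivation F R R) (φ : Fin 6 → R)
    (b : Matrix (Fin 6) (Fin 6) F) :
    (frobWronskian D p (fun j => Fintype.linearCombination F φ (b j))).det =
      b.det • (frobWronskian D p φ).det := by
  have h : (b.transpose.map (algebraMap F R)).det = algebraMap F R b.det := by
    rw [← RingHom.mapMatrix_apply, ← RingHom.map_det, Matrix.det_transpose]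
  rw [frobWronskian_linearCombination hF, Matrix.det_mul, mul_comm, Algebra.smul_def, h]

theorem taylorHom_apply {R : Type*} [CommRing R] [Algebra F R] (D : Derivation F R R)
    (ε : R →ₐ[F] F) (f : R) : taylorHom D ε p f =
      Ideal.Quotient.mk (Ideal.span {(PowerSeries.X ^ p : PowerSeries F)}) (taylorJet D ε f) := rfl

theorem IsSmoothZero.exists_order_frobWronskian [Fintype F] (hF : Fintype.card F = p)
    {H : MvPolynomial (Fin 2) F} {P : Fin 2 → F} (hP : IsSmoothZero H P) (hH : Irreducible H)
    (hd : 3 ≤ H.totalDegree) (hdp : 10 * H.totalDegree < p) :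
    ∃ M, 5 ≤ M ∧ M < p ∧
      (∀ j < M, PowerSeries.coeff j (taylorJet (tangentDerivation H) (aeval P)
        (frobWronskian (tangentDerivation H) p (quadMonomials F)).det) = 0) ∧
      PowerSeries.coeff M (taylorJet (tangentDerivation H) (aeval P)
        (frobWronskian (tangentDerivation H) p (quadMonomials F)).det) ≠ 0 := by
  set D := tangentDerivation H with hD
  set ε : MvPolynomial (Fin 2) F →ₐ[F] F := aeval P with hε
  set comb := Fintype.linearCombination F (quadMonomials F) with hcomb
  have h2 : (2 : F) ≠ 0 := by
    have := natCast_ne_zero_of_lt_char (F := F) (p := p) (n := 2) (by omega) (by omega)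
    exact_mod_cast this
  let jetL : MvPolynomial (Fin 2) F →ₗ[F] PowerSeries F :=
    { toFun := taylorJet D ε
      map_add' := taylorJet_add D ε
      map_smul' := taylorJet_smul D ε }
  let l : ℕ → (Fin 6 → F) →ₗ[F] F := fun j => PowerSeries.coeff j ∘ₗ jetL ∘ₗ comb
  have hl : ∀ j v, l j v = PowerSeries.coeff j (taylorJet D ε (comb v)) := fun _ _ => rfl
  obtain ⟨b, e, hb, he, heN, hlt, heq⟩ := exists_strictMono_adapted (F := F)
    (2 * H.totalDegree + 1) 6 (Fin 6 → F) (by simp) l (by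
      intro v hv
      by_contra hne
      obtain ⟨j, hj, hj'⟩ := hP.exists_coeff_ne_zero (p := p) hH hd (by omega) (Q := comb v)
        (fun h => hne (linearCombination_quadMonomials_injective h2
          (h.trans (map_zero (Fintype.linearCombination F (quadMonomials F))).symm)))
        (totalDegree_linearCombination_quadMonomials_le v)
      exact hj' (hv j hj))
  have hep : ∀ i, e i < p := fun i => by have := heN i; omega
  have he0 : e 0 = 0 := by
    by_contra h0
    have hpos : ∀ i, 0 < e i := fun i =>
      (Nat.pos_of_ne_zero h0).trans_le (he.monotone (Fin.zero_le i))
    have hspan : ⊤ ≤ LinearMap.ker (l 0) := by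
      rw [← hb.span_eq_top_of_card_eq_finrank (by simp), Submodule.span_le]
      rintro _ ⟨i, rfl⟩
      exact hlt i 0 (hpos i)
    have h1 : l 0 (Pi.single 0 1) = 0 := hspan trivial
    rw [hl, hcomb, Fintype.linearCombination_apply_single, one_smul] at h1
    simp [quadMonomials, taylorJet_one] at h1
  set f : Fin 6 → MvPolynomial (Fin 2) F := fun j => comb (b j) with hf
  have hε0 : ∀ j, ε (f j) = l 0 (b j) := fun j => by
    rw [hl, PowerSeries.coeff_zero_eq_constantCoeff_apply, constantCoeff_taylorJet]
  have hf0 : ε (f 0) ≠ 0 := by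
    have := heq 0
    rwa [he0, ← hε0] at this
  have hfs : ∀ j : Fin 5, ε (f j.succ) = 0 := fun j => by
    rw [hε0]
    refine hlt _ _ ?_
    rw [← he0]
    exact he (Fin.succ_pos j)
  let L : Matrix (Fin 5) (Fin 5) (PowerSeries F) := fun i j => taylorJet D ε (D^[i] (f j.succ))
  have hiter : ∀ (i m : ℕ) (g : MvPolynomial (Fin 2) F),
      ε (D^[m] (D^[i] g)) = ε (D^[m + i] g) := fun i m g => by rw [Function.iterate_add_apply]
  obtain ⟨U, hU, hdet⟩ := exists_det_eq_X_pow_mul L (fun j => e j.succ)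
    (fun j => l (e j.succ) (b j.succ)) (fun j => heq _) (by
      intro i j hij
      have := CharP.natCast_injOn_Iio F p (hep i.succ) (hep j.succ) hij
      exact Fin.succ_injective _ (he.injective this)) (by
      intro i j m hm
      have h1 := hlt j.succ (m + i) hm
      rw [hl, coeff_taylorJet, mul_eq_zero, inv_eq_zero] at h1
      have h3 := h1.resolve_right (factorial_ne_zero_of_lt_char (p := p) (hm.trans (hep _)))
      change PowerSeries.coeff m (taylorJet D ε (D^[i] (f j.succ))) = 0
      rw [coeff_taylorJet, hiter, hf, h3, zero_mul]) (by
      intro i j hij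
      change PowerSeries.coeff _ (taylorJet D ε (D^[i] (f j.succ))) = _
      rw [hl, coeff_taylorJet, coeff_taylorJet, hiter, Nat.sub_add_cancel hij,
        ← Nat.factorial_mul_descFactorial hij]
      have h3 := factorial_ne_zero_of_lt_char (F := F) (p := p) (hep j.succ)
      rw [← Nat.factorial_mul_descFactorial hij] at h3
      push_cast at h3 ⊢
      have h4 := left_ne_zero_of_mul h3
      have h5 := right_ne_zero_of_mul h3
      field_simp
      rfl)
  have hmono : ∀ i : Fin 5, (i : ℕ) + 1 ≤ e i.succ := by
    have h1 : e 0 < e 1 := he (by decide)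
    have h2 : e 1 < e 2 := he (by decide)
    have h3 : e 2 < e 3 := he (by decide)
    have h4 : e 3 < e 4 := he (by decide)
    have h5 : e 4 < e 5 := he (by decide)
    intro i
    fin_cases i
    · change 0 + 1 ≤ e 1; omega
    · change 1 + 1 ≤ e 2; omega
    · change 2 + 1 ≤ e 3; omega
    · change 3 + 1 ≤ e 4; omega
    · change 4 + 1 ≤ e 5; omega
  have hsum : 15 ≤ ∑ j : Fin 5, e j.succ ∧ ∑ j : Fin 5, e j.succ ≤ 10 * H.totalDegree := by
    have h0 := fun i : Fin 5 => heN i.succ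
    constructor
    · exact le_trans (by decide) (Finset.sum_le_sum fun i _ => hmono i)
    · refine (Finset.sum_le_card_nsmul _ _ (2 * H.totalDegree) fun i _ => by
        have := h0 i; omega).trans ?_
      simp; omega
  obtain ⟨M, hM⟩ : ∃ M, ∑ j : Fin 5, e j.succ = 10 + M := ⟨_, (Nat.add_sub_of_le (by omega)).symm⟩
  have hdet' : L.det = PowerSeries.X ^ M * U := by
    rw [hM, pow_add, mul_assoc] at hdet
    have : ∑ i : Fin 5, (i : ℕ) = 10 := by decide
    rw [this] at hdet
    exact mul_left_cancel₀ (pow_ne_zero _ PowerSeries.X_ne_zero) hdet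
  set W := (frobWronskian D p (quadMonomials F)).det with hW
  let N : Matrix (Fin 6) (Fin 6) (PowerSeries F) := Matrix.of
    (Fin.cons (fun j => PowerSeries.C (ε (f j))) fun (i : Fin 5) j => taylorJet D ε (D^[i] (f j)))
  have hN : N.det = PowerSeries.C (ε (f 0)) * L.det := by
    rw [Matrix.det_succ_row_zero, Fin.sum_univ_succ, Finset.sum_eq_zero, add_zero]
    · simp only [Fin.val_zero, pow_zero, one_mul]
      congr 2
    · intro j _
      have : N 0 j.succ = 0 := by
        change PowerSeries.C (ε (f j.succ)) = 0
        rw [hfs, map_zero]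
      rw [this]; ring
  have hmap : (taylorHom D ε p).mapMatrix (frobWronskian D p f) =
      (Ideal.Quotient.mk (Ideal.span {(PowerSeries.X ^ p : PowerSeries F)})).mapMatrix N := by
    ext i j
    rw [RingHom.mapMatrix_apply, RingHom.mapMatrix_apply, Matrix.map_apply, Matrix.map_apply]
    cases i using Fin.cases with
    | zero =>
      change taylorHom D ε p (f j ^ p) = Ideal.Quotient.mk _ (PowerSeries.C (ε (f j)))
      rw [map_pow, taylorHom_apply, ← map_pow, Ideal.Quotient.eq, Ideal.mem_span_singleton]
      have : PowerSeries.C (ε (f j)) = PowerSeries.C (ε (f j)) ^ p := by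
        rw [← map_pow, ← hF, FiniteField.pow_card]
      have := charP_of_injective_algebraMap (PowerSeries.C_injective (R := F)) p
      rw [‹PowerSeries.C (ε (f j)) = _›, ← sub_pow_char]
      refine pow_dvd_pow_of_dvd ?_ p
      rw [PowerSeries.X_dvd_iff, map_sub, constantCoeff_taylorJet]
      simp
    | succ i => rfl
  have hWf : (frobWronskian D p f).det = (Matrix.of b).det • W :=
    det_frobWronskian_linearCombination hF D (quadMonomials F) (Matrix.of b)
  have hcoeff : ∀ n < p, (Matrix.of b).det * PowerSeries.coeff n (taylorJet D ε W) =
      ε (f 0) * PowerSeries.coeff n (PowerSeries.X ^ M * U) := by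
    intro n hn
    have h1 := congrArg Matrix.det hmap
    rw [← RingHom.map_det, ← RingHom.map_det, hWf] at h1
    rw [taylorHom_apply, Ideal.Quotient.eq, Ideal.mem_span_singleton, PowerSeries.X_pow_dvd_iff] at h1
    have h2 := h1 n hn
    rw [map_sub, sub_eq_zero, hN, hdet', PowerSeries.coeff_C_mul, taylorJet_smul] at h2
    exact h2
  have hbdet : (Matrix.of b).det ≠ 0 := by
    rw [← isUnit_iff_ne_zero, ← Matrix.isUnit_iff_isUnit_det]
    exact Matrix.linearIndependent_rows_iff_isUnit.1 hb
  have hMp : M < p := by omega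
  refine ⟨M, by omega, hMp, fun j hj => ?_, fun h => ?_⟩
  · have := hcoeff j (hj.trans hMp)
    rw [PowerSeries.coeff_X_pow_mul', if_neg (by omega), mul_zero] at this
    exact (mul_eq_zero.1 this).resolve_left hbdet
  · have := hcoeff M hMp
    rw [h, mul_zero, PowerSeries.coeff_X_pow_mul', if_pos le_rfl, Nat.sub_self,
      PowerSeries.coeff_zero_eq_constantCoeff_apply] at this
    exact mul_ne_zero hf0 hU this.symm

end Wronskian

section PointCount

open MvPolynomial

variable {F : Type*} [Field F]

/-- Value and partial derivatives of order at most two at `P`. -/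
noncomputable def twoJet (P : Fin 2 → F) : MvPolynomial (Fin 2) F →ₗ[F] (Fin 6 → F) where
  toFun f := ![aeval P f, aeval P (pderiv 0 f), aeval P (pderiv 1 f), aeval P (pderiv 0 (pderiv 0 f)),
    aeval P (pderiv 0 (pderiv 1 f)), aeval P (pderiv 1 (pderiv 1 f))]
  map_add' f g := by ext i; fin_cases i <;> simp
  map_smul' c f := by ext i; fin_cases i <;> simp

theorem twoJet_apply (P : Fin 2 → F) (f : MvPolynomial (Fin 2) F) :
    twoJet P f = ![aeval P f, aeval P (pderiv 0 f), aeval P (pderiv 1 f),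
      aeval P (pderiv 0 (pderiv 0 f)), aeval P (pderiv 0 (pderiv 1 f)),
      aeval P (pderiv 1 (pderiv 1 f))] := rfl

theorem twoJet_mul_of_singular {P : Fin 2 → F} {f : MvPolynomial (Fin 2) F} (h : aeval P f = 0)
    (h0 : aeval P (pderiv 0 f) = 0) (h1 : aeval P (pderiv 1 f) = 0) (g : MvPolynomial (Fin 2) F) :
    twoJet P (g * f) = aeval P g • twoJet P f := by
  simp only [aeval_eq_eval] at h h0 h1
  ext i
  fin_cases i <;> simp [twoJet_apply, h, h0, h1]

theorem twoJet_mul_eq_zero {P : Fin 2 → F} {a b c : MvPolynomial (Fin 2) F} (ha : aeval P a = 0)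
    (hb : aeval P b = 0) (hc : aeval P c = 0) (g : MvPolynomial (Fin 2) F) :
    twoJet P (g * (a * b * c)) = 0 := by
  have h : twoJet P (a * b * c) = 0 := by
    simp only [aeval_eq_eval] at ha hb hc
    ext i
    fin_cases i <;> simp [twoJet_apply, ha, hb, hc]
  rw [twoJet_mul_of_singular (congrFun h 0) (congrFun h 1) (congrFun h 2), h, smul_zero]

theorem twoJet_surjective (h2 : (2 : F) ≠ 0) (P : Fin 2 → F) :
    Function.Surjective (twoJet P) := by
  intro v
  refine ⟨C (v 0) + C (v 1) * (X 0 - C (P 0)) + C (v 2) * (X 1 - C (P 1))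
    + C (v 3 / 2) * ((X 0 - C (P 0)) * (X 0 - C (P 0)))
    + C (v 4) * ((X 0 - C (P 0)) * (X 1 - C (P 1)))
    + C (v 5 / 2) * ((X 1 - C (P 1)) * (X 1 - C (P 1))), ?_⟩
  ext i
  fin_cases i <;> simp [twoJet_apply, pderiv_X] <;> field_simp <;> ring

/-- The ideal of a singular point: two-jets proportional to that of `H`. -/
def singularIdeal {H : MvPolynomial (Fin 2) F} {P : Fin 2 → F} (h : aeval P H = 0)
    (h0 : aeval P (pderiv 0 H) = 0) (h1 : aeval P (pderiv 1 H) = 0) :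
    Ideal (MvPolynomial (Fin 2) F) where
  carrier := {f | ∃ c : F, twoJet P f = c • twoJet P H}
  zero_mem' := ⟨0, by simp⟩
  add_mem' := by
    rintro f g ⟨a, ha⟩ ⟨b, hb⟩
    exact ⟨a + b, by rw [map_add, ha, hb, add_smul]⟩
  smul_mem' := by
    rintro g f ⟨a, ha⟩
    refine ⟨aeval P g * a, ?_⟩
    have e0 := congrFun ha 0
    have e1 := congrFun ha 1
    have e2 := congrFun ha 2
    simp only [twoJet_apply, Pi.smul_apply, Matrix.cons_val, h, h0, h1, smul_zero] at e0 e1 e2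
    rw [smul_eq_mul, twoJet_mul_of_singular e0 e1 e2, ha, smul_smul]

theorem exists_ideal_of_singular (h2 : (2 : F) ≠ 0) {H B : MvPolynomial (Fin 2) F} {P : Fin 2 → F}
    (h : aeval P H = 0) (h0 : aeval P (pderiv 0 H) = 0) (h1 : aeval P (pderiv 1 H) = 0)
    (hB : twoJet P B = 0) :
    ∃ (I : Ideal (MvPolynomial (Fin 2) F)) (n : ℕ)
      (θ : MvPolynomial (Fin 2) F →ₗ[F] (Fin n → F)), 5 ≤ n ∧ Function.Surjective θ ∧
      (∀ f ∈ I, θ f = 0) ∧ H ∈ I ∧ B ∈ I ∧ ∀ i, (X i - C (P i)) ^ 5 ∈ I := by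
  let S := Submodule.span F {twoJet P H}
  refine ⟨singularIdeal h h0 h1, Module.finrank F ((Fin 6 → F) ⧸ S),
    (Module.finBasis F ((Fin 6 → F) ⧸ S)).equivFun.toLinearMap ∘ₗ S.mkQ ∘ₗ twoJet P, ?_, ?_, ?_,
    ⟨1, by simp⟩, ⟨0, by simp [hB]⟩, fun i => ⟨0, ?_⟩⟩
  · have e1 := S.finrank_quotient_add_finrank
    have e2 : Module.finrank F S ≤ 1 := by
      simpa using finrank_span_le_card (R := F) {twoJet P H}
    rw [Module.finrank_fin_fun] at e1
    omega
  · rw [LinearMap.coe_comp, LinearMap.coe_comp]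
    exact (LinearEquiv.surjective _).comp (S.mkQ_surjective.comp (twoJet_surjective h2 P))
  · rintro f ⟨c, hc⟩
    rw [LinearMap.comp_apply, LinearMap.comp_apply, hc]
    have : S.mkQ (c • twoJet P H) = 0 := by
      rw [Submodule.mkQ_apply, Submodule.Quotient.mk_eq_zero]
      exact S.smul_mem c (Submodule.mem_span_singleton_self _)
    rw [this, map_zero]
  · have h3 : aeval P (X i - C (P i) : MvPolynomial (Fin 2) F) = 0 := by simp
    have h5 : (X i - C (P i) : MvPolynomial (Fin 2) F) ^ 5 = (X i - C (P i)) ^ 2 *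
        ((X i - C (P i)) * (X i - C (P i)) * (X i - C (P i))) := by ring
    rw [h5, twoJet_mul_eq_zero h3 h3 h3, zero_smul]

theorem twoJet_det_frobWronskian {H : MvPolynomial (Fin 2) F} {P : Fin 2 → F}
    (h0 : aeval P (pderiv 0 H) = 0) (h1 : aeval P (pderiv 1 H) = 0) (q : ℕ)
    (f : Fin 6 → MvPolynomial (Fin 2) F) :
    twoJet P (frobWronskian (tangentDerivation H) q f).det = 0 := by
  have hD : ∀ g, aeval P (tangentDerivation H g) = 0 := fun g => by
    rw [tangentDerivation_apply, map_sub, map_mul, map_mul, h0, h1, zero_mul, zero_mul, sub_zero]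
  have hrow : ∀ (i : Fin 4) j, aeval P (frobWronskian (tangentDerivation H) q f i.succ.succ j) = 0 := by
    intro i j
    change aeval P ((tangentDerivation H)^[i + 1] (f j)) = 0
    rw [Function.iterate_succ_apply', hD]
  rw [← Matrix.det_transpose, Matrix.det_apply, map_sum]
  refine Finset.sum_eq_zero fun σ _ => ?_
  rw [Units.smul_def, map_zsmul, Fin.prod_univ_six]
  simp only [Matrix.transpose_apply]
  have h := fun g => twoJet_mul_eq_zero (hrow 0 (σ 2)) (hrow 1 (σ 3)) (hrow 2 (σ 4)) g
  rw [show ∀ a b c d e f : MvPolynomial (Fin 2) F, a * b * c * d * e * f =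
    (a * b * f) * (c * d * e) from fun a b c d e f => by ring]
  exact (congrArg _ (h _)).trans (smul_zero _)

/-- A nonconstant polynomial of degree below the characteristic has a nonzero derivative. -/
theorem exists_pderiv_ne_zero {p : ℕ} [CharP F p] {H : MvPolynomial (Fin 2) F}
    (hd : 0 < H.totalDegree) (hp : H.totalDegree < p) : ∃ i, pderiv i H ≠ 0 := by
  obtain ⟨m, hm, hm0⟩ : ∃ m ∈ H.support, m ≠ 0 := by
    by_contra! hcon
    have : H.totalDegree ≤ 0 := by
      refine Finset.sup_le fun m hm => ?_
      rw [hcon m hm]; simp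
    omega
  obtain ⟨i, hi⟩ := Finsupp.ne_iff.1 hm0
  refine ⟨i, fun h => ?_⟩
  have h1 := congrArg (coeff (m - Finsupp.single i 1)) h
  have hle : Finsupp.single i 1 ≤ m := by
    rw [Finsupp.single_le_iff]; exact Nat.one_le_iff_ne_zero.2 hi
  rw [coeff_pderiv, tsub_add_cancel_of_le hle, coeff_zero, Finsupp.tsub_apply,
    Finsupp.single_eq_same] at h1
  have h2 : m i ≤ H.totalDegree := (by
    rw [Finsupp.sum_fintype _ _ (by simp)]
    exact Finset.single_le_sum (f := fun i => m i) (by simp) (Finset.mem_univ i) :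
      m i ≤ m.sum fun _ e => e).trans (le_totalDegree hm)
  have h3 := natCast_ne_zero_of_lt_char (F := F) (p := p) (n := m i) hi (by omega)
  have h4 : ((m i - 1 : ℕ) : F) + 1 = m i := by
    have : m i - 1 + 1 = m i := Nat.sub_add_cancel (Nat.one_le_iff_ne_zero.2 hi)
    exact_mod_cast congrArg (Nat.cast (R := F)) this
  rw [h4] at h1
  exact mul_ne_zero (mem_support_iff.1 hm) h3 h1

/-- Stöhr–Voloch type bound for the number of rational points of a plane curve over a prime
field. -/
theorem five_mul_card_zeros_le [Fintype F] {p : ℕ} [hp : Fact p.Prime] [CharP F p]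
    (hF : Fintype.card F = p) {H : MvPolynomial (Fin 2) F} (hH : Irreducible H)
    (hd : 3 ≤ H.totalDegree) (hdp : 10 * H.totalDegree < p) (S : Finset (Fin 2 → F))
    (hS : ∀ P ∈ S, eval P H = 0) (hcard : H.totalDegree ^ 2 < S.card) :
    5 * S.card ≤ H.totalDegree * (2 * p + 10 + 10 * H.totalDegree) := by
  have h2 : (2 : F) ≠ 0 := by
    have := natCast_ne_zero_of_lt_char (F := F) (p := p) (n := 2) (by omega) (by omega)
    exact_mod_cast this
  set W := (frobWronskian (tangentDerivation H) p (quadMonomials F)).det with hW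
  obtain ⟨P₀, hP₀S, hP₀⟩ : ∃ P ∈ S, IsSmoothZero H P := by
    by_contra! hcon
    obtain ⟨i, hi⟩ := exists_pderiv_ne_zero (F := F) (p := p) (H := H) (by omega) (by omega)
    have hlt := totalDegree_pderiv_lt hi
    have := card_common_zeros_le hH.ne_zero hi (isRelPrime_of_totalDegree_lt hH hi hlt) S
      fun P hP => ⟨hS P hP, by
        by_contra hne
        exact hcon P hP ⟨hS P hP, i, hne⟩⟩
    nlinarith
  obtain ⟨M, _, hMp, _, hM⟩ := hP₀.exists_order_frobWronskian hF hH hd hdp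
  have hHW : ¬ H ∣ W := by
    rintro ⟨g, hg⟩
    refine hM ((?_ : W ∈ jetIdeal (tangentDerivation H) (aeval P₀) (le_refl p)) M hMp)
    rw [hg]
    exact Ideal.mul_mem_right _ _ (self_mem_jetIdeal hP₀.1 _)
  have hW0 : W ≠ 0 := fun h => hHW (h ▸ dvd_zero _)
  refine (mul_card_le_of_points hH.ne_zero hW0 (hH.isRelPrime_iff_not_dvd.2 hHW) S 5 5 ?_).trans
    (Nat.mul_le_mul_left _ (totalDegree_det_frobWronskian_le H p))
  intro P hP
  by_cases hsm : IsSmoothZero H P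
  · obtain ⟨M, hM5, _, hM, _⟩ := hsm.exists_order_frobWronskian hF hH hd hdp
    exact hsm.exists_ideal (by omega : 5 ≤ p) fun j hj => hM j (by omega)
  · have hns : ∀ i, aeval P (pderiv i H) = 0 := by
      intro i
      by_contra hne
      exact hsm ⟨hS P hP, i, hne⟩
    exact exists_ideal_of_singular h2 (hS P hP) (hns 0) (hns 1)
      (twoJet_det_frobWronskian (hns 0) (hns 1) _ _)

end PointCount

section AffineArc

variable {F : Type*} [Field F]

/-- Slope of the chord of the graph of `f` through `z` and `w`. -/
def chordSlope (f : F → F) (z w : F) : F := (f z - f w) / (z - w)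

theorem chordSlope_comm (f : F → F) (z w : F) : chordSlope f z w = chordSlope f w z := by
  rw [chordSlope, chordSlope, ← neg_sub (f w), ← neg_sub w, neg_div_neg_eq]

theorem chordSlope_mul (f : F → F) {z w : F} (h : z ≠ w) :
    chordSlope f z w * (z - w) = f z - f w := div_mul_cancel₀ _ (sub_ne_zero.2 h)

/-- The graph of `f` over `D` has no three collinear points. -/
def IsGraphArc (D : Finset F) (f : F → F) : Prop :=
  ∀ z ∈ D, ∀ w ∈ D, ∀ w' ∈ D, w ≠ z → w' ≠ z → chordSlope f z w = chordSlope f z w' → w = w'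

variable [DecidableEq F]

theorem IsGraphArc.injOn {D : Finset F} {f : F → F} (h : IsGraphArc D f) {z : F} (hz : z ∈ D) :
    Set.InjOn (chordSlope f z) (D.erase z : Set F) := by
  intro w hw w' hw' he
  simp only [Finset.coe_erase, Set.mem_sdiff, Finset.mem_coe, Set.mem_singleton_iff] at hw hw'
  exact h z hz w hw.1 w' hw'.1 hw.2 hw'.2 he

variable [Fintype F]

/-- Slopes of the nonvertical tangents (unisecants) at the point over `z`. -/
def tangentSlopes (D : Finset F) (f : F → F) (z : F) : Finset F :=
  Finset.univ \ (D.erase z).image (chordSlope f z)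

theorem mem_tangentSlopes {D : Finset F} {f : F → F} {z s : F} :
    s ∈ tangentSlopes D f z ↔ ∀ w ∈ D, w ≠ z → chordSlope f z w ≠ s := by
  simp only [tangentSlopes, Finset.mem_sdiff, Finset.mem_univ, true_and, Finset.mem_image,
    Finset.mem_erase, not_exists, not_and, and_imp]
  exact ⟨fun h w h1 h2 => h w h2 h1, fun h w h1 h2 => h w h2 h1⟩

theorem IsGraphArc.card_tangentSlopes {D : Finset F} {f : F → F} (h : IsGraphArc D f) {z : F}
    (hz : z ∈ D) {t : ℕ} (ht : D.card + t = Fintype.card F + 1) :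
    (tangentSlopes D f z).card = t := by
  have hpos := Finset.card_pos.2 ⟨z, hz⟩
  have hle := D.card_le_univ
  rw [tangentSlopes, Finset.card_sdiff_of_subset (Finset.subset_univ _),
    Finset.card_image_of_injOn (h.injOn hz), Finset.card_erase_of_mem hz, Finset.card_univ]
  omega

open Polynomial in
/-- The monic polynomial whose roots are the tangent slopes. -/
noncomputable def tangentPoly (D : Finset F) (f : F → F) (z : F) : F[X] :=
  ∏ s ∈ tangentSlopes D f z, (X - C s)

theorem prod_univ_erase_sub (a : F) : ∏ x ∈ Finset.univ.erase a, (a - x) = -1 := by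
  have h := congrArg (Units.val) (FiniteField.prod_univ_units_id_eq_neg_one (K := F))
  rw [Units.coe_prod, Units.val_neg, Units.val_one] at h
  rw [← h]
  symm
  refine Finset.prod_bij (fun u _ => a - u) (fun u _ => ?_) (fun u _ v _ h => ?_) (fun x hx => ?_)
    (fun u _ => by ring)
  · rw [Finset.mem_erase]
    exact ⟨fun h => u.ne_zero (by linear_combination -h), Finset.mem_univ _⟩
  · exact Units.ext (by linear_combination -h)
  · rw [Finset.mem_erase] at hx
    exact ⟨Units.mk0 (a - x) (sub_ne_zero.2 (Ne.symm hx.1)), Finset.mem_univ _, by simp⟩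

/-- The normalising factor: the product of `z - a` over `a ∉ D`. -/
def complProd (D : Finset F) (z : F) : F := ∏ a ∈ Finset.univ \ D, (z - a)

theorem complProd_ne_zero {D : Finset F} {z : F} (hz : z ∈ D) : complProd D z ≠ 0 := by
  refine Finset.prod_ne_zero_iff.2 fun a ha => sub_ne_zero.2 ?_
  rintro rfl
  exact (Finset.mem_sdiff.1 ha).2 hz

theorem complProd_mul {D : Finset F} {z w : F} (hz : z ∈ D) (hw : w ∈ D) (hzw : z ≠ w) :
    complProd D z * ((z - w) * ∏ x ∈ (D.erase z).erase w, (z - x)) = -1 := by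
  rw [Finset.mul_prod_erase (D.erase z) (fun x => z - x) (Finset.mem_erase.2 ⟨hzw.symm, hw⟩),
    ← prod_univ_erase_sub z, complProd, ← Finset.prod_union]
  · congr 1
    ext x
    simp only [Finset.mem_union, Finset.mem_sdiff, Finset.mem_univ, true_and, Finset.mem_erase]
    constructor
    · rintro (h | h)
      · exact ⟨by rintro rfl; exact h hz, trivial⟩
      · exact ⟨h.1, trivial⟩
    · rintro ⟨h, _⟩
      by_cases hx : x ∈ D
      · exact Or.inr ⟨h, hx⟩
      · exact Or.inl hx
  · exact Finset.disjoint_of_subset_right (Finset.erase_subset _ _) Finset.sdiff_disjoint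

theorem IsGraphArc.eval_tangentPoly_mul {D : Finset F} {f : F → F} (h : IsGraphArc D f) {z w : F}
    (hz : z ∈ D) (hw : w ∈ D) (hzw : z ≠ w) :
    (tangentPoly D f z).eval (chordSlope f z w) *
      ∏ x ∈ (D.erase z).erase w, (chordSlope f z w - chordSlope f z x) = -1 := by
  have hw' : w ∈ D.erase z := Finset.mem_erase.2 ⟨hzw.symm, hw⟩
  have hinj := h.injOn hz
  rw [tangentPoly, Polynomial.eval_prod]
  simp only [Polynomial.eval_sub, Polynomial.eval_X, Polynomial.eval_C]
  rw [← prod_univ_erase_sub (chordSlope f z w),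
    ← Finset.prod_image (s := (D.erase z).erase w) (g := chordSlope f z)
      (f := fun s => chordSlope f z w - s)
      (fun a ha b hb => hinj (Finset.mem_of_mem_erase ha) (Finset.mem_of_mem_erase hb)),
    ← Finset.prod_union]
  · congr 1
    ext s
    simp only [Finset.mem_union, Finset.mem_erase, Finset.mem_univ, and_true]
    constructor
    · rintro (hs | hs)
      · rintro rfl
        exact mem_tangentSlopes.1 hs w hw hzw.symm rfl
      · obtain ⟨x, hx, rfl⟩ := Finset.mem_image.1 hs
        rw [Finset.mem_erase] at hx
        exact fun he => hx.1 (hinj hx.2 hw' he)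
    · intro hs
      by_cases hs' : s ∈ tangentSlopes D f z
      · exact Or.inl hs'
      · right
        rw [mem_tangentSlopes] at hs'
        push Not at hs'
        obtain ⟨x, hx, hxz, rfl⟩ := hs'
        refine Finset.mem_image_of_mem _ ?_
        rw [Finset.mem_erase, Finset.mem_erase]
        exact ⟨by rintro rfl; exact hs rfl, hxz, hx⟩
  · rw [Finset.disjoint_left]
    intro s hs hs'
    obtain ⟨x, hx, rfl⟩ := Finset.mem_image.1 hs'
    rw [Finset.mem_erase, Finset.mem_erase] at hx
    exact mem_tangentSlopes.1 hs x hx.2.2 hx.2.1 rfl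

/-- Segre's lemma of tangents for the graph of a function. -/
theorem IsGraphArc.segre {D : Finset F} {f : F → F} (h : IsGraphArc D f) {z w : F}
    (hz : z ∈ D) (hw : w ∈ D) (hzw : z ≠ w) :
    complProd D z * (tangentPoly D f z).eval (chordSlope f z w) =
      -(complProd D w * (tangentPoly D f w).eval (chordSlope f z w)) := by
  have h1 := h.eval_tangentPoly_mul hz hw hzw
  have h2 := h.eval_tangentPoly_mul hw hz hzw.symm
  have h3 := complProd_mul hz hw hzw
  have h4 := complProd_mul hw hz hzw.symm
  rw [chordSlope_comm f w z, Finset.erase_right_comm] at h2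
  rw [Finset.erase_right_comm (a := w)] at h4
  set s := chordSlope f z w with hs
  set T := (D.erase z).erase w with hT
  have h5 : (∏ x ∈ T, (s - chordSlope f z x)) * ∏ x ∈ T, (z - x) =
      (∏ x ∈ T, (s - chordSlope f w x)) * ∏ x ∈ T, (w - x) := by
    rw [← Finset.prod_mul_distrib, ← Finset.prod_mul_distrib]
    refine Finset.prod_congr rfl fun x hx => ?_
    rw [hT, Finset.mem_erase, Finset.mem_erase] at hx
    have e1 := chordSlope_mul f (Ne.symm hx.2.1)
    have e2 := chordSlope_mul f (Ne.symm hx.1)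
    have e3 := chordSlope_mul f hzw
    rw [← hs] at e3
    linear_combination e3 - e1 + e2
  set a := complProd D z
  set b := complProd D w
  set τ := (tangentPoly D f z).eval s
  set σ := (tangentPoly D f w).eval s
  set A := ∏ x ∈ T, (s - chordSlope f z x)
  set B := ∏ x ∈ T, (s - chordSlope f w x)
  set U := ∏ x ∈ T, (z - x)
  set V := ∏ x ∈ T, (w - x)
  have hzw' := sub_ne_zero.2 hzw
  -- `a τ (z - w) U A = 1 = b σ (w - z) V B` with `U A = V B ≠ 0`
  have hA : A ≠ 0 := by rintro h; simp [h] at h1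
  have hU : U ≠ 0 := by rintro h; simp [h] at h3
  apply mul_right_cancel₀ (mul_ne_zero hzw' (mul_ne_zero hA hU))
  have e1 : a * τ * ((z - w) * (A * U)) = 1 := by
    linear_combination h1 * (a * ((z - w) * U)) - h3
  have e2 : b * σ * ((z - w) * (B * V)) = -1 := by
    linear_combination -h2 * (b * ((w - z) * V)) + h4
  rw [e1, h5]
  linear_combination e2

end AffineArc

section DualLine

variable {F : Type*} [Field F]

open MvPolynomial in
/-- Restriction of a polynomial in line coordinates `(u, v)` to the pencil of lines through
`(z, y)`, i.e. to the lines `v = y - z u`, parametrised by the slope. -/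
noncomputable def dualLine (z y : F) : MvPolynomial (Fin 2) F →ₐ[F] Polynomial F :=
  aeval ![Polynomial.X, Polynomial.C y - Polynomial.C z * Polynomial.X]

theorem eval_dualLine (z y s : F) (A : MvPolynomial (Fin 2) F) :
    (dualLine z y A).eval s = MvPolynomial.eval ![s, y - z * s] A := by
  have h : ((Polynomial.aeval s).comp (dualLine z y)) = MvPolynomial.aeval ![s, y - z * s] := by
    refine MvPolynomial.algHom_ext fun i => ?_
    fin_cases i <;> simp [dualLine]
  simpa [MvPolynomial.aeval_eq_eval, Polynomial.coe_aeval_eq_eval] using DFunLike.congr_fun h A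

theorem natDegree_dualLine_le (z y : F) (A : MvPolynomial (Fin 2) F) :
    (dualLine z y A).natDegree ≤ A.totalDegree := by
  have := MvPolynomial.aeval_natDegree_le (n := 1) A le_rfl
    ![Polynomial.X, Polynomial.C y - Polynomial.C z * Polynomial.X] (fun i => by
      fin_cases i
      · simp
      · simp only [Fin.mk_one, Matrix.cons_val_one, Matrix.cons_val_zero]
        compute_degree)
  simpa [dualLine] using this

theorem totalDegree_aeval_X_le (r : Polynomial F) :
    (Polynomial.aeval (MvPolynomial.X 0 : MvPolynomial (Fin 2) F) r).totalDegree
      ≤ r.natDegree := by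
  rw [Polynomial.aeval_eq_sum_range]
  refine MvPolynomial.totalDegree_finsetSum_le fun i hi => ?_
  refine (MvPolynomial.totalDegree_smul_le _ _).trans ?_
  rw [MvPolynomial.totalDegree_X_pow]
  exact Nat.lt_succ_iff.1 (Finset.mem_range.1 hi)

theorem dualLine_aeval_X (z y : F) (r : Polynomial F) :
    dualLine z y (Polynomial.aeval (MvPolynomial.X 0) r) = r := by
  rw [← Polynomial.aeval_algHom_apply]
  simp [dualLine]

/-- The linear form whose zeros are the lines through `(z, y)`. -/
noncomputable def pencilForm (z y : F) : MvPolynomial (Fin 2) F :=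
  MvPolynomial.X 1 - MvPolynomial.C y + MvPolynomial.C z * MvPolynomial.X 0

theorem dualLine_pencilForm (w z y y' : F) :
    dualLine w y' (pencilForm z y) =
      Polynomial.C (y' - y) - Polynomial.C (w - z) * Polynomial.X := by
  simp only [dualLine, pencilForm, map_add, map_sub, map_mul, MvPolynomial.aeval_X,
    MvPolynomial.algHom_C, Polynomial.algebraMap_eq, Matrix.cons_val_zero, Matrix.cons_val_one]
  ring

theorem totalDegree_pencilForm_le (z y : F) : (pencilForm z y).totalDegree ≤ 1 := by
  unfold pencilForm
  refine (MvPolynomial.totalDegree_add _ _).trans (max_le ?_ ?_)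
  · exact (MvPolynomial.totalDegree_sub _ _).trans (by simp)
  · exact (MvPolynomial.totalDegree_mul _ _).trans (by simp)

variable [DecidableEq F]

open MvPolynomial in
theorem exists_dualLine_eq {D : Finset F} {f : F → F} (h : IsGraphArc D f) (N : ℕ)
    (E : F → Polynomial F) (hN : ∀ z ∈ D, (E z).natDegree ≤ N)
    (hE : ∀ z ∈ D, ∀ w ∈ D, z ≠ w →
      (E z).eval (chordSlope f z w) = (E w).eval (chordSlope f z w)) :
    ∃ G : MvPolynomial (Fin 2) F, G.totalDegree ≤ N ∧ ∀ z ∈ D, dualLine z (f z) G = E z := by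
  suffices H : ∀ S : Finset F, S ⊆ D → ∃ G : MvPolynomial (Fin 2) F, G.totalDegree ≤ N ∧
      ∀ z ∈ S, dualLine z (f z) G = E z from H D subset_rfl
  intro S
  induction S using Finset.induction_on with
  | empty => exact fun _ => ⟨0, by simp, by simp⟩
  | insert w S hwS ih =>
    intro hS
    obtain ⟨G, hG, hGS⟩ := ih ((Finset.subset_insert _ _).trans hS)
    have hw : w ∈ D := hS (Finset.mem_insert_self _ _)
    have hSD : ∀ z ∈ S, z ∈ D := fun z hz => hS (Finset.mem_insert_of_mem hz)
    have hne : ∀ z ∈ S, w ≠ z := by rintro z hz rfl; exact hwS hz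
    have hdvd : ∏ z ∈ S, (Polynomial.X - Polynomial.C (chordSlope f w z)) ∣
        E w - dualLine w (f w) G := by
      refine Finset.prod_dvd_of_coprime (fun z hz z' hz' hzz => ?_) fun z hz => ?_
      · refine Polynomial.isCoprime_X_sub_C_of_isUnit_sub (sub_ne_zero.2 fun he => hzz ?_).isUnit
        exact h w hw z (hSD z hz) z' (hSD z' hz') (hne z hz).symm (hne z' hz').symm he
      · rw [Polynomial.dvd_iff_isRoot, Polynomial.IsRoot, Polynomial.eval_sub,
          hE w hw z (hSD z hz) (hne z hz), ← hGS z hz, eval_dualLine, eval_dualLine, sub_eq_zero]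
        congr 2
        have := chordSlope_mul f (hne z hz)
        congr 2
        linear_combination this
    obtain ⟨r, hr⟩ := hdvd
    have hdeg : r ≠ 0 → r.natDegree + S.card ≤ N := by
      intro hr0
      have h1 : (E w - dualLine w (f w) G).natDegree ≤ N :=
        (Polynomial.natDegree_sub_le _ _).trans
          (max_le (hN w hw) ((natDegree_dualLine_le _ _ _).trans hG))
      have hm : (∏ z ∈ S, (Polynomial.X - Polynomial.C (chordSlope f w z))).Monic :=
        Polynomial.monic_prod_of_monic _ _ fun z _ => Polynomial.monic_X_sub_C _
      rw [hr, hm.natDegree_mul' hr0, Polynomial.natDegree_prod_of_monic _ _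
        fun z _ => Polynomial.monic_X_sub_C _] at h1
      simp only [Polynomial.natDegree_X_sub_C, Finset.sum_const, smul_eq_mul, mul_one] at h1
      omega
    set c : F := ∏ z ∈ S, -(w - z) with hc
    have hc0 : c ≠ 0 := Finset.prod_ne_zero_iff.2 fun z hz =>
      neg_ne_zero.2 (sub_ne_zero.2 (hne z hz))
    have hprod : dualLine w (f w) (∏ z ∈ S, pencilForm z (f z)) =
        Polynomial.C c * ∏ z ∈ S, (Polynomial.X - Polynomial.C (chordSlope f w z)) := by
      rw [map_prod, hc, map_prod, ← Finset.prod_mul_distrib]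
      refine Finset.prod_congr rfl fun z hz => ?_
      rw [dualLine_pencilForm, ← chordSlope_mul f (hne z hz)]
      simp only [Polynomial.C_mul, Polynomial.C_neg]
      ring
    refine ⟨G + C c⁻¹ * Polynomial.aeval (X 0) r * ∏ z ∈ S, pencilForm z (f z), ?_, ?_⟩
    · refine (totalDegree_add _ _).trans (max_le hG ?_)
      by_cases hr0 : r = 0
      · simp [hr0]
      have h1 := totalDegree_mul (C c⁻¹ * Polynomial.aeval (X 0) r)
        (∏ z ∈ S, pencilForm z (f z))
      have h2 := totalDegree_mul (C c⁻¹) (Polynomial.aeval (X 0 : MvPolynomial (Fin 2) F) r)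
      have h3 := totalDegree_aeval_X_le r
      have h4 := totalDegree_finsetProd S fun z => pencilForm z (f z)
      have h5 : ∑ z ∈ S, (pencilForm z (f z)).totalDegree ≤ S.card := by
        simpa using Finset.sum_le_sum fun z (_ : z ∈ S) => totalDegree_pencilForm_le z (f z)
      rw [totalDegree_C] at h2
      have h6 := hdeg hr0
      omega
    · intro z hz
      rw [map_add, map_mul, map_mul, dualLine_aeval_X]
      rcases Finset.mem_insert.1 hz with rfl | hz
      · rw [hprod, MvPolynomial.algHom_C, Polynomial.algebraMap_eq]
        have : Polynomial.C c⁻¹ * Polynomial.C c = 1 := by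
          rw [← Polynomial.C_mul, inv_mul_cancel₀ hc0, Polynomial.C_1]
        linear_combination r * (∏ x ∈ S, (Polynomial.X - Polynomial.C (chordSlope f z x))) * this
          - hr
      · rw [map_prod, Finset.prod_eq_zero hz, mul_zero, add_zero, hGS z hz]
        rw [dualLine_pencilForm]
        simp

end DualLine

section PlaneConic

variable {F : Type*} [Field F]

open MvPolynomial

theorem exists_irreducible_dvd_of_le {σ : Type*} (ν : MvPolynomial σ F → ℕ)
    (hmul : ∀ A B, ν (A * B) ≤ ν A + ν B) (hunit : ∀ A, IsUnit A → ν A = 0) (m : ℕ)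
    {G : MvPolynomial σ F} (hG : G ≠ 0) (hd : G.totalDegree ≠ 0)
    (hm : m * G.totalDegree ≤ 2 * ν G) :
    ∃ H, Irreducible H ∧ H ∣ G ∧ m * H.totalDegree ≤ 2 * ν H := by
  by_contra! hcon
  have key : ∀ A : MvPolynomial σ F, A ≠ 0 → A ∣ G →
      2 * ν A ≤ m * A.totalDegree ∧ (A.totalDegree ≠ 0 → 2 * ν A < m * A.totalDegree) := by
    intro A
    induction A using WfDvdMonoid.induction_on_irreducible with
    | zero => exact fun h => absurd rfl h
    | unit u hu =>
      intro _ _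
      have := (MvPolynomial.isUnit_iff_totalDegree_of_isReduced.1 hu).2
      simp [hunit u hu, this]
    | mul a i ha hi ih =>
      intro hia hdvd
      have h1 := ih ha ((dvd_mul_left _ _).trans hdvd)
      have h2 := hcon i hi ((dvd_mul_right _ _).trans hdvd)
      rw [totalDegree_mul_of_isDomain hi.ne_zero ha, mul_add]
      have h3 := hmul i a
      omega
  have := (key G hG dvd_rfl).2 hd
  omega

theorem mem_span_X_pow_mul_X_pow {H : MvPolynomial (Fin 2) F} {d : ℕ} (hH : H.totalDegree ≤ d) :
    H ∈ Submodule.span F {M | ∃ i j : ℕ, i + j ≤ d ∧ M = (X 0 ^ i * X 1 ^ j)} := by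
  rw [H.as_sum]
  refine Submodule.sum_mem _ fun s hs => ?_
  have h1 : s 0 + s 1 ≤ d := by
    have := (le_totalDegree hs).trans hH
    rwa [Finsupp.sum_fintype _ _ (fun _ => rfl), Fin.sum_univ_two] at this
  have h2 : monomial s (coeff s H) = (coeff s H) • (X 0 ^ s 0 * X 1 ^ s 1) := by
    rw [monomial_eq, Finsupp.prod_fintype _ _ (fun _ => pow_zero _), Fin.prod_univ_two,
      smul_eq_C_mul]
  rw [h2]
  exact Submodule.smul_mem _ _ (Submodule.subset_span ⟨_, _, h1, rfl⟩)

theorem exists_eq_linear {H : MvPolynomial (Fin 2) F} (hH : H.totalDegree ≤ 1) :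
    ∃ a b c : F, H = C a + C b * X 0 + C c * X 1 := by
  have h := mem_span_X_pow_mul_X_pow hH
  clear hH
  induction h using Submodule.span_induction with
  | mem x hx =>
    obtain ⟨i, j, hij, rfl⟩ := hx
    have hi : i ≤ 1 := by omega
    have hj : j ≤ 1 := by omega
    interval_cases i <;> interval_cases j
    · exact ⟨1, 0, 0, by simp⟩
    · exact ⟨0, 0, 1, by simp⟩
    · exact ⟨0, 1, 0, by simp⟩
    · omega
  | zero => exact ⟨0, 0, 0, by simp⟩
  | add x y _ _ hx hy =>
    obtain ⟨a, b, c, rfl⟩ := hx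
    obtain ⟨a', b', c', rfl⟩ := hy
    exact ⟨a + a', b + b', c + c', by simp only [C_add]; ring⟩
  | smul r x _ hx =>
    obtain ⟨a, b, c, rfl⟩ := hx
    exact ⟨r * a, r * b, r * c, by simp only [C_mul, smul_eq_C_mul]; ring⟩

theorem exists_eq_quadratic {H : MvPolynomial (Fin 2) F} (hH : H.totalDegree ≤ 2) :
    ∃ a b c d e k : F, H = C a + C b * X 0 + C c * X 1 + C d * X 0 ^ 2 + C e * (X 0 * X 1)
      + C k * X 1 ^ 2 := by
  have h := mem_span_X_pow_mul_X_pow hH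
  clear hH
  induction h using Submodule.span_induction with
  | mem x hx =>
    obtain ⟨i, j, hij, rfl⟩ := hx
    have hi : i ≤ 2 := by omega
    have hj : j ≤ 2 := by omega
    interval_cases i <;> interval_cases j
    · exact ⟨1, 0, 0, 0, 0, 0, by simp⟩
    · exact ⟨0, 0, 1, 0, 0, 0, by simp⟩
    · exact ⟨0, 0, 0, 0, 0, 1, by simp⟩
    · exact ⟨0, 1, 0, 0, 0, 0, by simp⟩
    · exact ⟨0, 0, 0, 0, 1, 0, by simp⟩
    · omega
    · exact ⟨0, 0, 0, 1, 0, 0, by simp⟩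
    · omega
    · omega
  | zero => exact ⟨0, 0, 0, 0, 0, 0, by simp⟩
  | add x y _ _ hx hy =>
    obtain ⟨a, b, c, d, e, k, rfl⟩ := hx
    obtain ⟨a', b', c', d', e', k', rfl⟩ := hy
    exact ⟨a + a', b + b', c + c', d + d', e + e', k + k', by simp only [C_add]; ring⟩
  | smul r x _ hx =>
    obtain ⟨a, b, c, d, e, k, rfl⟩ := hx
    exact ⟨r * a, r * b, r * c, r * d, r * e, r * k, by simp only [C_mul, smul_eq_C_mul]; ring⟩

theorem not_irreducible_C_mul_sq (c : F) (L : MvPolynomial (Fin 2) F) :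
    ¬ Irreducible (C c * L ^ 2) := by
  intro h
  have hc : c ≠ 0 := by rintro rfl; simp at h
  have h1 : C c * L ^ 2 = (C c * L) * L := by ring
  have hL : IsUnit L := by
    rcases h.isUnit_or_isUnit h1 with h2 | h2
    · exact isUnit_of_mul_isUnit_right h2
    · exact h2
  exact h.not_isUnit (((isUnit_iff_ne_zero.2 hc).map C).mul (hL.pow 2))

/-- The dual conic of a nondegenerate conic is nonzero. -/
theorem dualConic_ne_zero (h2 : (2 : F) ≠ 0) {a b c d e k : F}
    (hH : Irreducible (C a + C b * X 0 + C c * X 1 + C d * X 0 ^ 2 + C e * (X 0 * X 1)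
      + C k * X 1 ^ 2 : MvPolynomial (Fin 2) F)) :
    ![b ^ 2 - 4 * d * a, -2 * b * c + 4 * e * a, 2 * b * e - 4 * d * c, c ^ 2 - 4 * k * a,
      2 * c * e - 4 * b * k, e ^ 2 - 4 * d * k] ≠ 0 := by
  intro h
  have e0 : b ^ 2 - 4 * d * a = 0 := congrFun h 0
  have e1 : -2 * b * c + 4 * e * a = 0 := congrFun h 1
  have e2 : 2 * b * e - 4 * d * c = 0 := congrFun h 2
  have e3 : c ^ 2 - 4 * k * a = 0 := congrFun h 3
  have e4 : 2 * c * e - 4 * b * k = 0 := congrFun h 4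
  have e5 : e ^ 2 - 4 * d * k = 0 := congrFun h 5
  have h4 : (4 : F) ≠ 0 := by
    have : (4 : F) = 2 * 2 := by norm_num
    rw [this]
    exact mul_ne_zero h2 h2
  have hC {x y : F} (hxy : x = y) : (C x : MvPolynomial (Fin 2) F) = C y := congrArg C hxy
  by_cases hd : d = 0
  · by_cases hk : k = 0
    · subst hd hk
      have hb : b = 0 := by simpa using e0
      have hc : c = 0 := by simpa using e3
      have he : e = 0 := by simpa using e5
      subst hb hc he
      simp only [map_zero, zero_mul, add_zero] at hH
      by_cases ha : a = 0
      · simp [ha] at hH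
      · exact hH.not_isUnit ((isUnit_iff_ne_zero.2 ha).map C)
    · refine not_irreducible_C_mul_sq (4 * k)⁻¹ (C c + C e * X 0 + C (2 * k) * X 1) ?_
      convert hH using 1
      have hi := hC (inv_mul_cancel₀ (mul_ne_zero h4 hk))
      have e3 := hC e3
      have e4 := hC e4
      have e5 := hC e5
      simp only [map_mul, map_sub, map_pow, map_ofNat, map_one, map_zero] at hi e3 e4 e5 ⊢
      linear_combination C ((4 * k)⁻¹) * (e3 + e4 * X 0 + e5 * X 0 ^ 2) + (C a + C b * X 0 +
        C c * X 1 + C d * X 0 ^ 2 + C e * (X 0 * X 1) + C k * X 1 ^ 2) * hi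
  · refine not_irreducible_C_mul_sq (4 * d)⁻¹ (C b + C (2 * d) * X 0 + C e * X 1) ?_
    convert hH using 1
    have hi := hC (inv_mul_cancel₀ (mul_ne_zero h4 hd))
    have e0 := hC e0
    have e2 := hC e2
    have e5 := hC e5
    simp only [map_mul, map_sub, map_pow, map_ofNat, map_one, map_zero] at hi e0 e2 e5 ⊢
    linear_combination C ((4 * d)⁻¹) * (e0 + e2 * X 1 + e5 * X 1 ^ 2) + (C a + C b * X 0 +
      C c * X 1 + C d * X 0 ^ 2 + C e * (X 0 * X 1) + C k * X 1 ^ 2) * hi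

theorem card_zeros_conic_le [Fintype F] {H : MvPolynomial (Fin 2) F}
    (hH : Irreducible H) (hd : H.totalDegree = 2) (Z : Finset (Fin 2 → F))
    (hZ : ∀ P ∈ Z, eval P H = 0) : Z.card ≤ Fintype.card F + 2 := by
  classical
  rcases Z.eq_empty_or_nonempty with rfl | ⟨P, hP⟩
  · simp
  have hinj : Set.InjOn (fun Q : Fin 2 → F =>
      if Q 0 = P 0 then none else some ((Q 1 - P 1) / (Q 0 - P 0))) (Z.erase P : Set (Fin 2 → F)) := by
    intro Q hQ Q' hQ' he
    simp only [Finset.coe_erase, Set.mem_sdiff, Finset.mem_coe, Set.mem_singleton_iff] at hQ hQ'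
    have hcol : (Q 1 - P 1) * (Q' 0 - P 0) - (Q 0 - P 0) * (Q' 1 - P 1) = 0 := by
      dsimp only at he
      split_ifs at he with h1 h2 h2
      · rw [h1, h2]; ring
      · rw [Option.some_inj, div_eq_div_iff (sub_ne_zero.2 h1) (sub_ne_zero.2 h2)] at he
        linear_combination he
    by_contra hne
    set L : MvPolynomial (Fin 2) F :=
      C (Q 1 - P 1) * (X 0 - C (P 0)) - C (Q 0 - P 0) * (X 1 - C (P 1)) with hL
    have hL0 : L ≠ 0 := by
      intro h
      refine hQ.2 (funext fun i => ?_)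
      have h1 := congrArg (eval ![P 0 + 1, P 1]) h
      have h2 := congrArg (eval ![P 0, P 1 + 1]) h
      simp only [hL, map_sub, map_mul, eval_C, eval_X, Matrix.cons_val_zero, Matrix.cons_val_one,
        map_zero] at h1 h2
      fin_cases i
      · exact (sub_eq_zero.1 (by simpa using h2)).symm
      · exact sub_eq_zero.1 (by simpa using h1)
    have hX : ∀ (i : Fin 2) (a b : F),
        (C a * (X i - C b) : MvPolynomial (Fin 2) F).totalDegree ≤ 1 := by
      intro i a b
      refine (totalDegree_mul _ _).trans ?_
      rw [totalDegree_C, zero_add]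
      exact (totalDegree_sub_C_le _ _).trans (totalDegree_X _).le
    have hL1 : L.totalDegree ≤ 1 :=
      (totalDegree_sub _ _).trans (max_le (hX _ _ _) (hX _ _ _))
    have h3 := card_common_zeros_le hH.ne_zero hL0
      (isRelPrime_of_totalDegree_lt hH hL0 (by omega)) {P, Q, Q'} (by
        simp only [Finset.mem_insert, Finset.mem_singleton]
        rintro R (rfl | rfl | rfl)
        · exact ⟨hZ _ hP, by simp [hL]⟩
        · exact ⟨hZ _ hQ.1, by simp [hL]; ring⟩
        · exact ⟨hZ _ hQ'.1, by simpa [hL] using hcol⟩)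
    rw [Finset.card_eq_three.2 ⟨P, Q, Q', Ne.symm hQ.2, Ne.symm hQ'.2, hne, rfl⟩, hd] at h3
    omega
  have h := Finset.card_le_card_of_injOn _ (t := Finset.univ) (fun _ _ => Finset.mem_coe.2 (Finset.mem_univ _)) hinj
  rw [Finset.card_univ, Fintype.card_option, Finset.card_erase_of_mem hP] at h
  omega

end PlaneConic

section Envelope

variable {F : Type*} [Field F] [Fintype F] [DecidableEq F]

open Polynomial in
/-- The squared tangent polynomial, normalised so that it takes the same value at a chord slope
for both ends of the chord. -/
noncomputable def tangentSq (D : Finset F) (f : F → F) (z : F) : F[X] :=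
  C (complProd D z ^ 2) * tangentPoly D f z ^ 2

theorem monic_tangentPoly (D : Finset F) (f : F → F) (z : F) : (tangentPoly D f z).Monic :=
  Polynomial.monic_prod_of_monic _ _ fun _ _ => Polynomial.monic_X_sub_C _

theorem natDegree_tangentPoly (D : Finset F) (f : F → F) (z : F) :
    (tangentPoly D f z).natDegree = (tangentSlopes D f z).card := by
  rw [tangentPoly, Polynomial.natDegree_prod_of_monic _ _ fun _ _ => Polynomial.monic_X_sub_C _]
  simp

theorem eval_tangentPoly_eq_zero {D : Finset F} {f : F → F} {z s : F} :
    (tangentPoly D f z).eval s = 0 ↔ s ∈ tangentSlopes D f z := by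
  simp only [tangentPoly, Polynomial.eval_prod, Finset.prod_eq_zero_iff, Polynomial.eval_sub,
    Polynomial.eval_X, Polynomial.eval_C, sub_eq_zero]
  exact ⟨fun ⟨_, h, e⟩ => e ▸ h, fun h => ⟨s, h, rfl⟩⟩

theorem eval_tangentSq_eq_zero {D : Finset F} {f : F → F} {z s : F} (hz : z ∈ D) :
    (tangentSq D f z).eval s = 0 ↔ s ∈ tangentSlopes D f z := by
  rw [← eval_tangentPoly_eq_zero]
  simp [tangentSq, complProd_ne_zero hz]

theorem tangentSq_ne_zero {D : Finset F} (f : F → F) {z : F} (hz : z ∈ D) :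
    tangentSq D f z ≠ 0 :=
  mul_ne_zero (Polynomial.C_ne_zero.2 (pow_ne_zero _ (complProd_ne_zero hz)))
    (pow_ne_zero _ (monic_tangentPoly D f z).ne_zero)

theorem natDegree_tangentSq {D : Finset F} (f : F → F) {z : F} (hz : z ∈ D) :
    (tangentSq D f z).natDegree = 2 * (tangentSlopes D f z).card := by
  rw [tangentSq, Polynomial.natDegree_C_mul (pow_ne_zero _ (complProd_ne_zero hz)),
    Polynomial.natDegree_pow, natDegree_tangentPoly]

theorem splits_tangentSq (D : Finset F) (f : F → F) (z : F) : (tangentSq D f z).Splits :=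
  (Polynomial.Splits.C _).mul ((Polynomial.Splits.prod fun _ _ => Polynomial.Splits.X_sub_C _).pow _)

/-- `G` is an envelope of the tangents: an algebraic curve in line coordinates through the
tangents to the graph of `f` over `D`, each counted twice. -/
def IsEnvelope (D : Finset F) (f : F → F) (G : MvPolynomial (Fin 2) F) : Prop :=
  ∀ z ∈ D, dualLine z (f z) G = tangentSq D f z

theorem IsGraphArc.exists_isEnvelope {D : Finset F} {f : F → F} (h : IsGraphArc D f) {t : ℕ}
    (ht : D.card + t = Fintype.card F + 1) :
    ∃ G : MvPolynomial (Fin 2) F, G.totalDegree ≤ 2 * t ∧ IsEnvelope D f G := by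
  refine exists_dualLine_eq h (2 * t) (tangentSq D f)
    (fun z hz => by rw [natDegree_tangentSq f hz, h.card_tangentSlopes hz ht])
    fun z hz w hw hzw => ?_
  have := h.segre hz hw hzw
  simp only [tangentSq, Polynomial.eval_mul, Polynomial.eval_C, Polynomial.eval_pow]
  rw [← mul_pow, ← mul_pow, this, neg_sq]

namespace IsEnvelope

variable {D : Finset F} {f : F → F} {G H : MvPolynomial (Fin 2) F}

theorem ne_zero (hG : IsEnvelope D f G) {z : F} (hz : z ∈ D) : G ≠ 0 := by
  rintro rfl
  exact tangentSq_ne_zero f hz (by rw [← hG z hz, map_zero])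

theorem dvd_tangentSq (hG : IsEnvelope D f G) (hH : H ∣ G) {z : F} (hz : z ∈ D) :
    dualLine z (f z) H ∣ tangentSq D f z := by
  rw [← hG z hz]
  exact map_dvd _ hH

theorem mem_tangentSlopes (hG : IsEnvelope D f G) (hH : H ∣ G) {z s : F} (hz : z ∈ D)
    (hs : (dualLine z (f z) H).eval s = 0) : s ∈ tangentSlopes D f z := by
  rw [← eval_tangentSq_eq_zero hz]
  exact Polynomial.eval_eq_zero_of_dvd_of_eval_eq_zero (hG.dvd_tangentSq hH hz) hs

theorem natDegree_dualLine (h : IsGraphArc D f) {t : ℕ} (ht : D.card + t = Fintype.card F + 1)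
    (hG : IsEnvelope D f G) (hd : G.totalDegree ≤ 2 * t) (hH : H ∣ G) {z : F} (hz : z ∈ D) :
    (dualLine z (f z) H).natDegree = H.totalDegree := by
  obtain ⟨J, rfl⟩ := hH
  have h0 := hG.ne_zero hz
  have h1 := hG z hz
  have h2 := natDegree_tangentSq f hz
  rw [h.card_tangentSlopes hz ht, ← h1, map_mul, Polynomial.natDegree_mul] at h2
  · rw [MvPolynomial.totalDegree_mul_of_isDomain (left_ne_zero_of_mul h0)
      (right_ne_zero_of_mul h0)] at hd
    have h3 := natDegree_dualLine_le z (f z) H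
    have h4 := natDegree_dualLine_le z (f z) J
    omega
  · exact left_ne_zero_of_mul (b := dualLine z (f z) J)
      (by rw [← map_mul, h1]; exact tangentSq_ne_zero f hz)
  · exact right_ne_zero_of_mul (a := dualLine z (f z) H)
      (by rw [← map_mul, h1]; exact tangentSq_ne_zero f hz)

end IsEnvelope

/-- The slopes of the tangents at the point over `z` that lie on the curve `A`. -/
noncomputable def tangentsOn (D : Finset F) (f : F → F) (A : MvPolynomial (Fin 2) F) (z : F) :
    Finset F :=
  (tangentSlopes D f z).filter fun s => (dualLine z (f z) A).eval s = 0

theorem card_tangentsOn_mul_le (D : Finset F) (f : F → F) (A B : MvPolynomial (Fin 2) F) (z : F) :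
    (tangentsOn D f (A * B) z).card ≤ (tangentsOn D f A z).card + (tangentsOn D f B z).card := by
  refine (Finset.card_le_card fun s hs => ?_).trans (Finset.card_union_le _ _)
  simp only [tangentsOn, Finset.mem_filter, Finset.mem_union, map_mul, Polynomial.eval_mul,
    mul_eq_zero] at hs ⊢
  tauto

theorem tangentsOn_of_isUnit (D : Finset F) (f : F → F) {A : MvPolynomial (Fin 2) F}
    (hA : IsUnit A) (z : F) : tangentsOn D f A z = ∅ := by
  refine Finset.filter_eq_empty_iff.2 fun s _ h => ?_
  have := (hA.map (dualLine z (f z))).map (Polynomial.evalRingHom s)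
  rw [Polynomial.coe_evalRingHom, h] at this
  exact not_isUnit_zero this

theorem exists_finset_zeros (D : Finset F) (f : F → F) (A : MvPolynomial (Fin 2) F) :
    ∃ S : Finset (Fin 2 → F), S.card = ∑ z ∈ D, (tangentsOn D f A z).card ∧
      ∀ P ∈ S, MvPolynomial.eval P A = 0 := by
  refine ⟨(D.sigma (tangentsOn D f A)).image fun x => ![x.2, f x.1 - x.1 * x.2], ?_, ?_⟩
  · rw [Finset.card_image_of_injOn, Finset.card_sigma]
    rintro ⟨z, s⟩ hx ⟨w, s'⟩ hy he
    simp only [Finset.coe_sigma, Set.mem_sigma_iff, Finset.mem_coe, tangentsOn,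
      Finset.mem_filter] at hx hy
    have e0 : s = s' := congrFun he 0
    have e1 : f z - z * s = f w - w * s' := congrFun he 1
    subst e0
    by_cases hzw : z = w
    · rw [hzw]
    · refine absurd ?_ (mem_tangentSlopes.1 hx.2.1 w hy.1 (Ne.symm hzw))
      rw [chordSlope, div_eq_iff (sub_ne_zero.2 hzw)]
      linear_combination e1
  · intro P hP
    obtain ⟨⟨z, s⟩, hx, rfl⟩ := Finset.mem_image.1 hP
    simp only [Finset.mem_sigma, tangentsOn, Finset.mem_filter] at hx
    rw [← eval_dualLine]
    exact hx.2.2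

theorem IsEnvelope.exists_irreducible_dvd {D : Finset F} {f : F → F} (h : IsGraphArc D f) {t : ℕ}
    (ht : D.card + t = Fintype.card F + 1) (ht0 : t ≠ 0) {G : MvPolynomial (Fin 2) F}
    (hG : IsEnvelope D f G) (hd : G.totalDegree ≤ 2 * t) (hD : D.Nonempty) :
    ∃ H, Irreducible H ∧ H ∣ G ∧
      D.card * H.totalDegree ≤ 2 * ∑ z ∈ D, (tangentsOn D f H z).card := by
  obtain ⟨z₀, hz₀⟩ := hD
  have hdeg : G.totalDegree = 2 * t := by
    rw [← hG.natDegree_dualLine h ht hd dvd_rfl hz₀, hG z₀ hz₀, natDegree_tangentSq f hz₀,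
      h.card_tangentSlopes hz₀ ht]
  refine exists_irreducible_dvd_of_le (fun A => ∑ z ∈ D, (tangentsOn D f A z).card)
    (fun A B => ?_) (fun A hA => ?_) D.card (hG.ne_zero hz₀) (by omega) ?_
  · rw [← Finset.sum_add_distrib]
    exact Finset.sum_le_sum fun z _ => card_tangentsOn_mul_le D f A B z
  · simp [tangentsOn_of_isUnit D f hA]
  · rw [hdeg, Finset.sum_congr rfl (g := fun _ => t), Finset.sum_const, smul_eq_mul]
    · exact le_of_eq (by ring)
    · intro z hz
      rw [tangentsOn, Finset.filter_true_of_mem, h.card_tangentSlopes hz ht]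
      intro s hs
      rw [hG z hz, eval_tangentSq_eq_zero hz]
      exact hs

end Envelope

section Cases

variable {F : Type*} [Field F]

theorem dualLine_quadratic (z y a b c d e k : F) :
    dualLine z y (MvPolynomial.C a + MvPolynomial.C b * MvPolynomial.X 0
      + MvPolynomial.C c * MvPolynomial.X 1 + MvPolynomial.C d * MvPolynomial.X 0 ^ 2
      + MvPolynomial.C e * (MvPolynomial.X 0 * MvPolynomial.X 1)
      + MvPolynomial.C k * MvPolynomial.X 1 ^ 2) =
    Polynomial.C (d - e * z + k * z ^ 2) * Polynomial.X ^ 2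
      + Polynomial.C (b - c * z + e * y - 2 * k * z * y) * Polynomial.X
      + Polynomial.C (a + c * y + k * y ^ 2) := by
  simp only [dualLine, map_add, map_sub, map_mul, map_pow, MvPolynomial.aeval_X,
    MvPolynomial.algHom_C, Polynomial.algebraMap_eq, Matrix.cons_val_zero, Matrix.cons_val_one,
    map_ofNat]
  ring

/-- A split quadratic polynomial has two roots unless its discriminant vanishes. -/
theorem exists_pair_of_splits {a b c : F}
    (hs : (Polynomial.C a * Polynomial.X ^ 2 + Polynomial.C b * Polynomial.X
      + Polynomial.C c).Splits)
    (ha : a ≠ 0) : ∃ r s, (Polynomial.C a * Polynomial.X ^ 2 + Polynomial.C b * Polynomial.X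
      + Polynomial.C c).eval r = 0 ∧ (Polynomial.C a * Polynomial.X ^ 2
      + Polynomial.C b * Polynomial.X + Polynomial.C c).eval s = 0 ∧
      (b ^ 2 - 4 * a * c ≠ 0 → r ≠ s) := by
  have hd := Polynomial.degree_quadratic (b := b) (c := c) ha
  obtain ⟨r, hr⟩ := hs.exists_eval_eq_zero (by rw [hd]; decide)
  have hr' : a * r ^ 2 + b * r + c = 0 := by simpa using hr
  refine ⟨r, -b / a - r, hr, ?_, fun hne he => hne ?_⟩
  · have h1 : a * (-b / a - r) = -b - a * r := by field_simp
    simp only [Polynomial.eval_add, Polynomial.eval_mul, Polynomial.eval_C, Polynomial.eval_pow,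
      Polynomial.eval_X]
    linear_combination (-b / a - r) * h1 + hr' - r * h1
  · have h1 : a * (2 * r) = -b := by
      have : 2 * r = -b / a := by linear_combination he
      rw [this]; field_simp
    linear_combination (b + a * (2 * r)) * h1 - 4 * a * hr'

variable [Fintype F] [DecidableEq F]

/-- The point `(x₀, y₀)`, on no vertical chord, extends the arc. -/
def ExtendsByPoint (D : Finset F) (f : F → F) : Prop :=
  ∃ x₀ ∉ D, ∃ y₀, ∀ z ∈ D, (y₀ - f z) / (x₀ - z) ∈ tangentSlopes D f z

/-- A point at infinity extends the arc. -/
def ExtendsAtInfinity (D : Finset F) (f : F → F) : Prop :=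
  ∃ γ, ∀ z ∈ D, γ ∈ tangentSlopes D f z

/-- A conic contains all but a few points of the arc. -/
def NearConic (D : Finset F) (f : F → F) : Prop :=
  ∃ v : Fin 6 → F, v ≠ 0 ∧
    (D.filter fun z => v 0 + v 1 * z + v 2 * f z + v 3 * z ^ 2 + v 4 * (z * f z)
      + v 5 * f z ^ 2 ≠ 0).card + D.card ≤ Fintype.card F + 2

namespace IsEnvelope

variable {D : Finset F} {f : F → F} {G H : MvPolynomial (Fin 2) F} {t : ℕ}

theorem extends_of_linear (h : IsGraphArc D f) (ht : D.card + t = Fintype.card F + 1)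
    (hG : IsEnvelope D f G) (hd : G.totalDegree ≤ 2 * t) (hH : H ∣ G) (h1 : H.totalDegree = 1) :
    ExtendsByPoint D f ∨ ExtendsAtInfinity D f := by
  obtain ⟨a, b, c, rfl⟩ := exists_eq_linear h1.le
  have hline : ∀ z ∈ D, b - c * z ≠ 0 ∧ -(a + c * f z) / (b - c * z) ∈ tangentSlopes D f z := by
    intro z hz
    have hdl : dualLine z (f z) (MvPolynomial.C a + MvPolynomial.C b * MvPolynomial.X 0
        + MvPolynomial.C c * MvPolynomial.X 1) =
        Polynomial.C (b - c * z) * Polynomial.X + Polynomial.C (a + c * f z) := by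
      simp only [dualLine, map_add, map_sub, map_mul, MvPolynomial.aeval_X,
        MvPolynomial.algHom_C, Polynomial.algebraMap_eq, Matrix.cons_val_zero,
        Matrix.cons_val_one]
      ring
    have hne : b - c * z ≠ 0 := by
      intro h0
      have h2 := hG.natDegree_dualLine h ht hd hH hz
      rw [hdl, h0, h1] at h2
      simp only [Polynomial.C_0, zero_mul, zero_add, Polynomial.natDegree_C] at h2
      omega
    refine ⟨hne, hG.mem_tangentSlopes hH hz ?_⟩
    rw [hdl]
    simp only [Polynomial.eval_add, Polynomial.eval_mul, Polynomial.eval_C, Polynomial.eval_X]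
    field_simp
    ring
  by_cases hc : c = 0
  · subst hc
    exact Or.inr ⟨-a / b, fun z hz => by simpa using (hline z hz).2⟩
  · refine Or.inl ⟨b / c, fun hmem => (hline _ hmem).1 (by field_simp; ring), -a / c, fun z hz => ?_⟩
    convert (hline z hz).2 using 1
    have e1 : -(a + c * f z) = c * (-a / c - f z) := by field_simp; ring
    have e2 : b - c * z = c * (b / c - z) := by field_simp
    rw [e1, e2, mul_div_mul_left _ _ hc]

theorem nearConic_of_quadratic (h2 : (2 : F) ≠ 0) (h : IsGraphArc D f)
    (ht : D.card + t = Fintype.card F + 1)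
    (hG : IsEnvelope D f G) (hd : G.totalDegree ≤ 2 * t) (hH : H ∣ G) (hirr : Irreducible H)
    (hdeg : H.totalDegree = 2) : NearConic D f := by
  obtain ⟨S, hS, hSz⟩ := exists_finset_zeros D f H
  have hSle := card_zeros_conic_le hirr hdeg S hSz
  obtain ⟨a, b, c, d, e, k, rfl⟩ := exists_eq_quadratic hdeg.le
  refine ⟨_, dualConic_ne_zero h2 hirr, le_trans ?_ hSle⟩
  rw [hS, Finset.card_filter, Finset.card_eq_sum_ones, ← Finset.sum_add_distrib]
  refine Finset.sum_le_sum fun z hz => ?_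
  have hnd := hG.natDegree_dualLine h ht hd hH hz
  have hspl := (splits_tangentSq D f z).of_dvd (tangentSq_ne_zero f hz)
    (hG.dvd_tangentSq hH hz)
  have hmem := fun s hs => hG.mem_tangentSlopes (s := s) hH hz hs
  rw [hdeg] at hnd
  unfold tangentsOn
  rw [dualLine_quadratic] at hnd hspl hmem ⊢
  have hA : d - e * z + k * z ^ 2 ≠ 0 := by
    intro h0
    rw [h0, Polynomial.C_0, zero_mul, zero_add] at hnd
    have := Polynomial.natDegree_linear_le
      (a := b - c * z + e * f z - 2 * k * z * f z) (b := a + c * f z + k * f z ^ 2)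
    omega
  obtain ⟨r, s, hr, hs, hrs⟩ := exists_pair_of_splits hspl hA
  split_ifs with hψ
  · refine Finset.one_lt_card.2 ⟨r, Finset.mem_filter.2 ⟨hmem r hr, hr⟩, s,
      Finset.mem_filter.2 ⟨hmem s hs, hs⟩, hrs ?_⟩
    convert hψ using 1
    simp only [Matrix.cons_val]
    ring
  · exact Finset.card_pos.2 ⟨r, Finset.mem_filter.2 ⟨hmem r hr, hr⟩⟩

end IsEnvelope

theorem IsGraphArc.two_le_of_extendsAtInfinity {D : Finset F} {f : F → F} (h2 : (2 : F) ≠ 0)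
    (h : IsGraphArc D f) {t : ℕ} (ht : D.card + t = Fintype.card F + 1) (hD : 1 < D.card)
    (he : ExtendsAtInfinity D f) : 2 ≤ t := by
  obtain ⟨γ, hγ⟩ := he
  obtain ⟨z, hz, w, hw, hzw⟩ := Finset.one_lt_card.1 hD
  have hle := D.card_le_univ
  by_contra hlt
  obtain rfl : t = 1 := by omega
  have hDuniv : Finset.univ \ D = ∅ := by
    rw [← Finset.card_eq_zero, Finset.card_sdiff_of_subset (Finset.subset_univ _),
      Finset.card_univ]
    omega
  have hone : ∀ x, complProd D x = 1 := fun x => by rw [complProd, hDuniv, Finset.prod_empty]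
  have hpoly : ∀ x ∈ D, tangentPoly D f x = Polynomial.X - Polynomial.C γ := by
    intro x hx
    obtain ⟨s, hs⟩ := Finset.card_eq_one.1 (h.card_tangentSlopes hx ht)
    have := hγ x hx
    rw [hs, Finset.mem_singleton] at this
    rw [tangentPoly, hs, Finset.prod_singleton, this]
  have hseg := h.segre hz hw hzw
  rw [hone, hone, hpoly z hz, hpoly w hw] at hseg
  simp only [Polynomial.eval_sub, Polynomial.eval_X, Polynomial.eval_C, one_mul] at hseg
  have h0 : 2 * (chordSlope f z w - γ) = 0 := by linear_combination hseg
  exact mem_tangentSlopes.1 (hγ z hz) w hw hzw.symm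
    (sub_eq_zero.1 ((mul_eq_zero.1 h0).resolve_left h2))

/-- A graph arc which is large enough lies in a larger arc or is nearly contained in a conic. -/
theorem IsGraphArc.extends_or_nearConic {p : ℕ} [Fact p.Prime] [CharP F p]
    (hF : Fintype.card F = p) {D : Finset F} {f : F → F} (h : IsGraphArc D f) {t : ℕ}
    (ht : D.card + t = p + 1) (ht0 : t ≠ 0) (htp : 45 * t + 41 ≤ p) :
    ExtendsByPoint D f ∨ ExtendsAtInfinity D f ∨ NearConic D f := by
  have h2 : (2 : F) ≠ 0 := by
    have := natCast_ne_zero_of_lt_char (F := F) (p := p) (n := 2) (by norm_num) (by omega)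
    simpa using this
  have ht' : D.card + t = Fintype.card F + 1 := hF ▸ ht
  obtain ⟨G, hd, hG⟩ := h.exists_isEnvelope ht'
  have hD : D.Nonempty := Finset.card_pos.1 (by omega)
  obtain ⟨H, hirr, hdvd, hcount⟩ := hG.exists_irreducible_dvd h ht' ht0 hd hD
  have hH2t : H.totalDegree ≤ 2 * t := by
    obtain ⟨z, hz⟩ := hD
    obtain ⟨J, rfl⟩ := hdvd
    have h0 := hG.ne_zero hz
    rw [MvPolynomial.totalDegree_mul_of_isDomain (left_ne_zero_of_mul h0)
      (right_ne_zero_of_mul h0)] at hd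
    omega
  have hH0 : H.totalDegree ≠ 0 := by
    intro h0
    refine hirr.not_isUnit (MvPolynomial.isUnit_iff_totalDegree_of_isReduced.2 ⟨?_, h0⟩)
    rw [MvPolynomial.totalDegree_eq_zero_iff_eq_C] at h0
    refine isUnit_iff_ne_zero.2 fun h1 => hirr.ne_zero ?_
    rw [h0, h1, MvPolynomial.C_0]
  rcases (by omega : H.totalDegree = 1 ∨ H.totalDegree = 2 ∨ 3 ≤ H.totalDegree) with h1 | h1 | h3
  · rcases hG.extends_of_linear h ht' hd hdvd h1 with h4 | h4
    · exact Or.inl h4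
    · exact Or.inr (Or.inl h4)
  · exact Or.inr (Or.inr (hG.nearConic_of_quadratic h2 h ht' hd hdvd hirr h1))
  · exfalso
    obtain ⟨S, hS, hSz⟩ := exists_finset_zeros D f H
    rw [← hS] at hcount
    have h4 := five_mul_card_zeros_le hF hirr h3 (by omega) S hSz (by nlinarith)
    have h5 : 5 * D.card ≤ 2 * (2 * p + 10 + 10 * H.totalDegree) := by
      have : H.totalDegree * (5 * D.card) ≤
          H.totalDegree * (2 * (2 * p + 10 + 10 * H.totalDegree)) := by nlinarith
      exact Nat.le_of_mul_le_mul_left this (by omega)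
    omega

/-- If all but a few points have a tangent of slope `γ`, then all points do. -/
theorem IsGraphArc.mem_tangentSlopes_of_forall {D B : Finset F} {f : F → F} (h : IsGraphArc D f)
    {t : ℕ} (ht : D.card + t = Fintype.card F + 1) (hcard : B.card + 2 * t < D.card) {γ : F}
    (hγ : ∀ z ∈ D, z ∉ B → γ ∈ tangentSlopes D f z) {z : F} (hz : z ∈ D) :
    γ ∈ tangentSlopes D f z := by
  obtain ⟨G, hd, hG⟩ := h.exists_isEnvelope ht
  set P : Polynomial F := MvPolynomial.aeval ![Polynomial.C γ, Polynomial.X] G with hP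
  have heval : ∀ y, P.eval y = MvPolynomial.eval ![γ, y] G := by
    intro y
    have h1 : (Polynomial.aeval y).comp (MvPolynomial.aeval ![Polynomial.C γ, Polynomial.X]) =
        MvPolynomial.aeval ![γ, y] := by
      refine MvPolynomial.algHom_ext fun i => ?_
      fin_cases i <;> simp
    simpa [MvPolynomial.aeval_eq_eval, Polynomial.coe_aeval_eq_eval] using DFunLike.congr_fun h1 G
  have hPz : ∀ z ∈ D, P.eval (f z - z * γ) = (tangentSq D f z).eval γ := by
    intro z hz
    rw [heval, ← hG z hz, eval_dualLine]
  have hPdeg : P.natDegree ≤ 2 * t := by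
    have := MvPolynomial.aeval_natDegree_le (n := 1) G hd ![Polynomial.C γ, Polynomial.X]
      (fun i => by fin_cases i <;> simp)
    simpa using this
  have hP0 : P = 0 := by
    by_contra hne
    have hroots : ((D \ B).image fun z => f z - z * γ) ⊆ P.roots.toFinset := by
      intro y hy
      obtain ⟨w, hw, rfl⟩ := Finset.mem_image.1 hy
      rw [Finset.mem_sdiff] at hw
      rw [Multiset.mem_toFinset, Polynomial.mem_roots hne, Polynomial.IsRoot, hPz w hw.1,
        eval_tangentSq_eq_zero hw.1]
      exact hγ w hw.1 hw.2
    have h1 := (Finset.card_le_card hroots).trans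
      ((Multiset.toFinset_card_le _).trans (Polynomial.card_roots' P))
    rw [Finset.card_image_of_injOn] at h1
    · have := Finset.le_card_sdiff B D
      omega
    · intro w hw w' hw' he
      rw [Finset.mem_coe, Finset.mem_sdiff] at hw hw'
      by_contra hne'
      refine mem_tangentSlopes.1 (hγ w hw.1 hw.2) w' hw'.1 (Ne.symm hne') ?_
      rw [chordSlope, div_eq_iff (sub_ne_zero.2 hne')]
      linear_combination he
  rw [← eval_tangentSq_eq_zero hz, ← hPz z hz, hP0, Polynomial.eval_zero]

end Cases

section Plane

variable {F : Type*} [Field F]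

/-- The determinant of three vectors. -/
def det3 (u v w : Fin 3 → F) : F :=
  u 0 * (v 1 * w 2 - v 2 * w 1) - u 1 * (v 0 * w 2 - v 2 * w 0) + u 2 * (v 0 * w 1 - v 1 * w 0)

theorem det3_swap₁₂ (u v w : Fin 3 → F) : det3 v u w = -det3 u v w := by unfold det3; ring

theorem det3_swap₂₃ (u v w : Fin 3 → F) : det3 u w v = -det3 u v w := by unfold det3; ring

theorem det3_rotate (u v w : Fin 3 → F) : det3 v w u = det3 u v w := by unfold det3; ring

theorem det3_self₁₂ (u w : Fin 3 → F) : det3 u u w = 0 := by unfold det3; ring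

theorem det3_self₁₃ (u w : Fin 3 → F) : det3 u w u = 0 := by unfold det3; ring

theorem det3_smul (a b c : F) (u v w : Fin 3 → F) :
    det3 (a • u) (b • v) (c • w) = a * b * c * det3 u v w := by
  simp only [det3, Pi.smul_apply, smul_eq_mul]; ring

theorem linearIndependent_iff_det3_ne_zero {u v w : Fin 3 → F} :
    LinearIndependent F ![u, v, w] ↔ det3 u v w ≠ 0 := by
  have h := Matrix.linearIndependent_rows_iff_isUnit (A := Matrix.of ![u, v, w])
  rw [Matrix.isUnit_iff_isUnit_det, isUnit_iff_ne_zero, Matrix.det_fin_three] at h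
  have e : (Matrix.of ![u, v, w]).row = ![u, v, w] := rfl
  rw [e] at h
  rw [h, det3]
  simp only [Matrix.of_apply, Matrix.cons_val]
  exact not_congr (Eq.congr_left (by ring))

theorem det3_map_ne_zero (T : (Fin 3 → F) ≃ₗ[F] (Fin 3 → F)) {u v w : Fin 3 → F} :
    det3 (T u) (T v) (T w) ≠ 0 ↔ det3 u v w ≠ 0 := by
  have h := LinearMap.linearIndependent_iff_of_injOn (v := ![u, v, w])
    (T : (Fin 3 → F) →ₗ[F] (Fin 3 → F)) T.injective.injOn
  have e : (⇑(T : (Fin 3 → F) →ₗ[F] (Fin 3 → F)) ∘ ![u, v, w]) = ![T u, T v, T w] := by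
    ext i j
    fin_cases i <;> rfl
  rw [e, linearIndependent_iff_det3_ne_zero, linearIndependent_iff_det3_ne_zero] at h
  exact h

theorem exists_det3_ne_zero {P Q : P2 F} (h : P ≠ Q) : ∃ w, det3 w P.rep Q.rep ≠ 0 := by
  have h1 := Projectivization.linearIndependent_pair_iff_ne.2 h
  obtain ⟨w, hw⟩ := exists_linearIndependent_cons_of_lt_finrank h1 (by simp)
  exact ⟨w, linearIndependent_iff_det3_ne_zero.1 hw⟩

theorem exists_linearEquiv {u v w : Fin 3 → F} (h : det3 u v w ≠ 0) :
    ∃ T : (Fin 3 → F) ≃ₗ[F] (Fin 3 → F), T u = ![1, 0, 0] ∧ T v = ![0, 1, 0] ∧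
      T w = ![0, 0, 1] := by
  set b := basisOfLinearIndependentOfCardEqFinrank (linearIndependent_iff_det3_ne_zero.2 h)
    (by simp) with hb
  have hbi : ∀ i, b i = ![u, v, w] i := fun i => by
    rw [hb, coe_basisOfLinearIndependentOfCardEqFinrank]
  refine ⟨b.equivFun, ?_, ?_, ?_⟩
  · rw [show u = b 0 from (hbi 0).symm]
    ext i; rw [Module.Basis.equivFun_self]; fin_cases i <;> simp
  · rw [show v = b 1 from (hbi 1).symm]
    ext i; rw [Module.Basis.equivFun_self]; fin_cases i <;> simp
  · rw [show w = b 2 from (hbi 2).symm]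
    ext i; rw [Module.Basis.equivFun_self]; fin_cases i <;> simp

/-- Any three distinct points of `A` are noncollinear. -/
def NoThreeCollinear (A : Finset (P2 F)) : Prop :=
  ∀ P ∈ A, ∀ Q ∈ A, ∀ R ∈ A, P ≠ Q → P ≠ R → Q ≠ R → det3 P.rep Q.rep R.rep ≠ 0

theorem NoThreeCollinear.mono {A B : Finset (P2 F)} (hB : NoThreeCollinear B) (h : A ⊆ B) :
    NoThreeCollinear A :=
  fun P hP Q hQ R hR => hB P (h hP) Q (h hQ) R (h hR)

theorem NoThreeCollinear.insert_point [DecidableEq (P2 F)] {A : Finset (P2 F)} (hA : NoThreeCollinear A)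
    {N : P2 F} (hN : ∀ P ∈ A, ∀ Q ∈ A, P ≠ Q → det3 N.rep P.rep Q.rep ≠ 0) :
    NoThreeCollinear (insert N A) := by
  intro P hP Q hQ R hR hPQ hPR hQR
  rcases Finset.mem_insert.1 hP with rfl | hP'
  · exact hN Q (Finset.mem_of_mem_insert_of_ne hQ hPQ.symm) R
      (Finset.mem_of_mem_insert_of_ne hR hPR.symm) hQR
  rcases Finset.mem_insert.1 hQ with rfl | hQ'
  · rw [det3_swap₁₂]
    exact neg_ne_zero.2 (hN P hP' R (Finset.mem_of_mem_insert_of_ne hR hQR.symm) hPR)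
  rcases Finset.mem_insert.1 hR with rfl | hR'
  · rw [det3_rotate]
    exact hN P hP' Q hQ' hPQ
  exact hA P hP' Q hQ' R hR' hPQ hPR hQR

open MvPolynomial in
/-- The linear form with given coefficients. -/
noncomputable def linForm (a : Fin 3 → F) : MvPolynomial (Fin 3) F := ∑ i, C (a i) * X i

theorem eval_linForm (a x : Fin 3 → F) :
    MvPolynomial.eval x (linForm a) = a 0 * x 0 + a 1 * x 1 + a 2 * x 2 := by
  simp [linForm, Fin.sum_univ_three]

theorem isHomogeneous_linForm (a : Fin 3 → F) : (linForm a).IsHomogeneous 1 :=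
  MvPolynomial.IsHomogeneous.sum _ _ _ fun i _ => MvPolynomial.isHomogeneous_C_mul_X (a i) i

theorem exists_linForm_eq_det3 (u v : Fin 3 → F) :
    ∃ a, ∀ x, MvPolynomial.eval x (linForm a) = det3 x u v :=
  ⟨![u 1 * v 2 - u 2 * v 1, -(u 0 * v 2 - u 2 * v 0), u 0 * v 1 - u 1 * v 0], fun x => by
    rw [eval_linForm, det3]
    simp only [Matrix.cons_val]
    ring⟩

theorem exists_linForm_eq_apply (T : (Fin 3 → F) →ₗ[F] (Fin 3 → F)) (i : Fin 3) :
    ∃ a, ∀ x, MvPolynomial.eval x (linForm a) = T x i :=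
  ⟨fun j => T (Pi.single j 1) i, fun x => by
    rw [LinearMap.pi_apply_eq_sum_univ T x, eval_linForm]
    simp only [Fin.sum_univ_three, Pi.add_apply, Pi.smul_apply, smul_eq_mul]
    have : ∀ j : Fin 3, (fun i => if j = i then (1 : F) else 0) = Pi.single j 1 := by
      intro j; ext i; simp [Pi.single_apply, eq_comm]
    simp only [this]
    ring⟩

theorem IsGenArc.card_le [Finite F] {K : Set (P2 F)} (hK : IsGenArc K)
    {Q : MvPolynomial (Fin 3) F} (h0 : Q ≠ 0) (h2 : Q.IsHomogeneous 2) (S : Finset (P2 F))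
    (hSK : ∀ P ∈ S, P ∈ K) (hS : ∀ P ∈ S, MvPolynomial.eval P.rep Q = 0) : S.card ≤ 5 := by
  refine le_trans ?_ (hK _ ⟨Q, h0, h2, rfl⟩)
  rw [← Set.ncard_coe_finset]
  exact Set.ncard_le_ncard (fun P hP => ⟨hSK P hP, hS P hP⟩) (Set.toFinite _)

theorem IsGenArc.card_le_of_lines [Finite F] {K : Set (P2 F)} (hK : IsGenArc K)
    {P Q P' Q' : P2 F} (h : P ≠ Q) (h' : P' ≠ Q') (S : Finset (P2 F))
    (hSK : ∀ R ∈ S, R ∈ K)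
    (hS : ∀ R ∈ S, det3 R.rep P.rep Q.rep = 0 ∨ det3 R.rep P'.rep Q'.rep = 0) : S.card ≤ 5 := by
  obtain ⟨a, ha⟩ := exists_linForm_eq_det3 P.rep Q.rep
  obtain ⟨b, hb⟩ := exists_linForm_eq_det3 P'.rep Q'.rep
  refine hK.card_le (Q := linForm a * linForm b) (mul_ne_zero ?_ ?_)
    ((isHomogeneous_linForm a).mul (isHomogeneous_linForm b)) S hSK fun R hR => ?_
  · obtain ⟨w, hw⟩ := exists_det3_ne_zero h
    rw [← ha] at hw
    rintro h0
    exact hw (by rw [h0, map_zero])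
  · obtain ⟨w, hw⟩ := exists_det3_ne_zero h'
    rw [← hb] at hw
    rintro h0
    exact hw (by rw [h0, map_zero])
  · rw [map_mul, ha, hb, mul_eq_zero]
    exact hS R hR

/-- A nonzero quadratic form in linear coordinates is a nonzero quadratic form. -/
theorem exists_quadraticForm (T : (Fin 3 → F) ≃ₗ[F] (Fin 3 → F)) {v : Fin 6 → F} (hv : v ≠ 0) :
    ∃ Q : MvPolynomial (Fin 3) F, Q ≠ 0 ∧ Q.IsHomogeneous 2 ∧ ∀ x, MvPolynomial.eval x Q =
      v 0 * T x 0 ^ 2 + v 1 * (T x 0 * T x 1) + v 2 * (T x 0 * T x 2) + v 3 * T x 1 ^ 2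
        + v 4 * (T x 1 * T x 2) + v 5 * T x 2 ^ 2 := by
  choose a ha using exists_linForm_eq_apply (T : (Fin 3 → F) →ₗ[F] (Fin 3 → F))
  have hh := fun i => isHomogeneous_linForm (a i)
  set Q : MvPolynomial (Fin 3) F :=
    MvPolynomial.C (v 0) * (linForm (a 0) * linForm (a 0))
      + MvPolynomial.C (v 1) * (linForm (a 0) * linForm (a 1))
      + MvPolynomial.C (v 2) * (linForm (a 0) * linForm (a 2))
      + MvPolynomial.C (v 3) * (linForm (a 1) * linForm (a 1))
      + MvPolynomial.C (v 4) * (linForm (a 1) * linForm (a 2))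
      + MvPolynomial.C (v 5) * (linForm (a 2) * linForm (a 2)) with hQ
  have heval : ∀ x, MvPolynomial.eval x Q =
      v 0 * T x 0 ^ 2 + v 1 * (T x 0 * T x 1) + v 2 * (T x 0 * T x 2) + v 3 * T x 1 ^ 2
        + v 4 * (T x 1 * T x 2) + v 5 * T x 2 ^ 2 := by
    intro x
    simp only [hQ, map_add, map_mul, MvPolynomial.eval_C, ha, LinearEquiv.coe_coe]
    ring
  refine ⟨Q, fun h0 => hv ?_, ?_, heval⟩
  · have hz : ∀ y : Fin 3 → F, v 0 * y 0 ^ 2 + v 1 * (y 0 * y 1) + v 2 * (y 0 * y 2)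
        + v 3 * y 1 ^ 2 + v 4 * (y 1 * y 2) + v 5 * y 2 ^ 2 = 0 := by
      intro y
      have := heval (T.symm y)
      rw [h0, map_zero, LinearEquiv.apply_symm_apply] at this
      exact this.symm
    have e0 := hz ![1, 0, 0]
    have e3 := hz ![0, 1, 0]
    have e5 := hz ![0, 0, 1]
    have e1 := hz ![1, 1, 0]
    have e2 := hz ![1, 0, 1]
    have e4 := hz ![0, 1, 1]
    simp only [Matrix.cons_val] at e0 e1 e2 e3 e4 e5
    have h1 : v 1 = 0 := by linear_combination e1 - e0 - e3
    have h2 : v 2 = 0 := by linear_combination e2 - e0 - e5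
    have h4 : v 4 = 0 := by linear_combination e4 - e3 - e5
    ext i
    fin_cases i
    · simpa using e0
    · exact h1
    · exact h2
    · simpa using e3
    · exact h4
    · simpa using e5
  · exact (((((((hh 0).mul (hh 0)).C_mul _).add (((hh 0).mul (hh 1)).C_mul _)).add
      (((hh 0).mul (hh 2)).C_mul _)).add (((hh 1).mul (hh 1)).C_mul _)).add
      (((hh 1).mul (hh 2)).C_mul _)).add (((hh 2).mul (hh 2)).C_mul _)

end Plane

section Coordinates

variable {F : Type*} [Field F]

theorem apply_ne_zero_of_ne {T : (Fin 3 → F) ≃ₗ[F] (Fin 3 → F)} {O P : P2 F}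
    (hO : T O.rep = ![0, 0, 1]) (hP : P ≠ O) (h0 : T P.rep 0 = 0) : T P.rep 1 ≠ 0 := by
  intro h1
  obtain ⟨w, hw⟩ := exists_det3_ne_zero hP
  rw [← det3_map_ne_zero T, hO] at hw
  exact hw (by simp [det3, h0, h1])

/-- A small set has a tangent line at each of its points. -/
theorem exists_tangent [Fintype F] {A : Finset (P2 F)} (hA : A.card ≤ Fintype.card F + 1)
    {O : P2 F} (hO : O ∈ A) (h1 : 1 < A.card) :
    ∃ w c, det3 w c O.rep ≠ 0 ∧ ∀ P ∈ A, P ≠ O → det3 P.rep c O.rep ≠ 0 := by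
  classical
  obtain ⟨P₀, -, hP₀⟩ := Finset.exists_mem_ne h1 O
  obtain ⟨w₀, hw₀⟩ := exists_det3_ne_zero hP₀
  obtain ⟨T, -, -, hT⟩ := exists_linearEquiv hw₀
  set g : P2 F → Option F := fun P =>
    if T P.rep 0 = 0 then none else some (T P.rep 1 / T P.rep 0) with hg
  obtain ⟨o, ho⟩ : ∃ o, o ∉ (A.erase O).image g := by
    by_contra! hall
    have h2 := Finset.card_le_card (fun o (_ : o ∈ (Finset.univ : Finset (Option F))) => hall o)
    have h3 := Finset.card_image_le (s := A.erase O) (f := g)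
    rw [Finset.card_erase_of_mem hO] at h3
    rw [Finset.card_univ, Fintype.card_option] at h2
    omega
  have ho' : ∀ P ∈ A, P ≠ O → g P ≠ o := fun P hP hPO he =>
    ho (he ▸ Finset.mem_image_of_mem g (Finset.mem_erase.2 ⟨hPO, hP⟩))
  rcases o with _ | s
  · refine ⟨T.symm ![1, 0, 0], T.symm ![0, 1, 0], ?_, fun P hP hPO => ?_⟩
    · rw [← det3_map_ne_zero T, hT]
      simp [det3]
    · rw [← det3_map_ne_zero T, hT]
      have h2 : T P.rep 0 ≠ 0 := fun h0 => ho' P hP hPO (by simp [hg, h0])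
      simpa [det3] using h2
  · refine ⟨T.symm ![0, 1, 0], T.symm ![1, s, 0], ?_, fun P hP hPO => ?_⟩
    · rw [← det3_map_ne_zero T, hT]
      simp [det3]
    · rw [← det3_map_ne_zero T, hT]
      intro h
      simp only [det3, LinearEquiv.apply_symm_apply, Matrix.cons_val] at h
      have h3 : T P.rep 0 * s = T P.rep 1 := by linear_combination h
      by_cases h0 : T P.rep 0 = 0
      · exact apply_ne_zero_of_ne hT hPO h0 (by rw [← h3, h0, zero_mul])
      · refine ho' P hP hPO ?_
        simp only [hg, if_neg h0]
        rw [← h3, mul_div_cancel_left₀ _ h0]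

theorem det3_affine (z w w' a b c : F) :
    det3 ![1, z, a] ![1, w, b] ![1, w', c] = (z - w) * (a - c) - (z - w') * (a - b) := by
  simp [det3]; ring

/-- An arc with a tangent `x₀ = 0` at the point `(0 : 0 : 1)` is that point together with the graph
of a function. -/
theorem NoThreeCollinear.exists_isGraphArc {A : Finset (P2 F)} (hA : NoThreeCollinear A) {O : P2 F}
    (hO : O ∈ A) {T : (Fin 3 → F) ≃ₗ[F] (Fin 3 → F)} (hT : T O.rep = ![0, 0, 1])
    (h0 : ∀ P ∈ A, P ≠ O → T P.rep 0 ≠ 0) :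
    ∃ (D : Finset F) (f : F → F) (x : P2 F → F), IsGraphArc D f ∧ D.card + 1 = A.card ∧
      (∀ P ∈ A, P ≠ O → x P ∈ D ∧ T P.rep = T P.rep 0 • ![1, x P, f (x P)]) ∧
      (∀ P ∈ A, P ≠ O → ∀ Q ∈ A, Q ≠ O → P ≠ Q → x P ≠ x Q) ∧
      ∀ z ∈ D, ∃ P ∈ A, P ≠ O ∧ x P = z := by
  classical
  set x : P2 F → F := fun P => T P.rep 1 / T P.rep 0 with hx
  set y : P2 F → F := fun P => T P.rep 2 / T P.rep 0 with hy
  have hinj : Set.InjOn x (A.erase O : Set (P2 F)) := by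
    intro P hP Q hQ he
    simp only [Finset.mem_coe, Finset.mem_erase] at hP hQ
    by_contra hPQ
    refine (det3_map_ne_zero T).2 (hA P hP.2 Q hQ.2 O hO hPQ hP.1 hQ.1) ?_
    have h1 := h0 P hP.2 hP.1
    have h2 := h0 Q hQ.2 hQ.1
    simp only [hx] at he
    rw [div_eq_div_iff h1 h2] at he
    simp only [det3, hT, Matrix.cons_val]
    linear_combination -he
  set f : F → F := fun z => y (Function.invFunOn x (A.erase O) z) with hf
  have hfx : ∀ P ∈ A, P ≠ O → f (x P) = y P := fun P hP hPO => by
    simp only [hf]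
    rw [hinj.leftInvOn_invFunOn (Finset.mem_coe.2 (Finset.mem_erase.2 ⟨hPO, hP⟩))]
  have hrep : ∀ P ∈ A, P ≠ O → T P.rep = T P.rep 0 • ![1, x P, f (x P)] := by
    intro P hP hPO
    rw [hfx P hP hPO]
    have h1 := h0 P hP hPO
    ext i
    fin_cases i <;> simp [hx, hy, mul_div_cancel₀, h1]
  have hmem : ∀ z ∈ (A.erase O).image x, ∃ P ∈ A, P ≠ O ∧ x P = z := by
    intro z hz
    obtain ⟨P, hP, rfl⟩ := Finset.mem_image.1 hz
    rw [Finset.mem_erase] at hP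
    exact ⟨P, hP.2, hP.1, rfl⟩
  refine ⟨(A.erase O).image x, f, x, ?_, ?_, fun P hP hPO =>
    ⟨Finset.mem_image_of_mem x (Finset.mem_erase.2 ⟨hPO, hP⟩), hrep P hP hPO⟩,
    fun P hP hPO Q hQ hQO hPQ he => hPQ (hinj (Finset.mem_coe.2 (Finset.mem_erase.2 ⟨hPO, hP⟩))
      (Finset.mem_coe.2 (Finset.mem_erase.2 ⟨hQO, hQ⟩)) he), hmem⟩
  · intro z hz w hw w' hw' hwz hwz' he
    obtain ⟨P, hP, hPO, rfl⟩ := hmem z hz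
    obtain ⟨Q, hQ, hQO, rfl⟩ := hmem w hw
    obtain ⟨R, hR, hRO, rfl⟩ := hmem w' hw'
    by_contra hne
    refine (det3_map_ne_zero T).2 (hA P hP Q hQ R hR (fun h => hwz (h ▸ rfl))
      (fun h => hwz' (h ▸ rfl)) (fun h => hne (h ▸ rfl))) ?_
    rw [hrep P hP hPO, hrep Q hQ hQO, hrep R hR hRO, det3_smul, det3_affine,
      ← chordSlope_mul f (Ne.symm hwz), ← chordSlope_mul f (Ne.symm hwz'), he]
    ring
  · rw [Finset.card_image_of_injOn hinj, Finset.card_erase_add_one hO]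

section Extension

variable {A : Finset (P2 F)} {O : P2 F}
  {T : (Fin 3 → F) ≃ₗ[F] (Fin 3 → F)} {D : Finset F} {f : F → F} {x : P2 F → F}

/-- A vector on no chord of a graph and on no vertical line over its domain is on no chord of the
corresponding arc. -/
theorem det3_ne_zero_of_coords (hT : T O.rep = ![0, 0, 1])
    (hx : ∀ P ∈ A, P ≠ O → T P.rep 0 ≠ 0 ∧ x P ∈ D ∧ T P.rep = T P.rep 0 • ![1, x P, f (x P)])
    (hinj : ∀ P ∈ A, P ≠ O → ∀ Q ∈ A, Q ≠ O → P ≠ Q → x P ≠ x Q) (n : Fin 3 → F)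
    (h1 : ∀ z ∈ D, ∀ w ∈ D, z ≠ w → det3 n ![1, z, f z] ![1, w, f w] ≠ 0)
    (h2 : ∀ z ∈ D, det3 n ![1, z, f z] ![0, 0, 1] ≠ 0) :
    ∀ P ∈ A, ∀ Q ∈ A, P ≠ Q → det3 (T.symm n) P.rep Q.rep ≠ 0 := by
  have h3 : ∀ P ∈ A, P ≠ O → det3 n (T P.rep) (T O.rep) ≠ 0 := by
    intro P hP hPO
    obtain ⟨h0, hD, he⟩ := hx P hP hPO
    rw [he, hT]
    have := det3_smul 1 (T P.rep 0) 1 n ![1, x P, f (x P)] ![0, 0, 1]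
    rw [one_smul, one_smul] at this
    rw [this]
    exact mul_ne_zero (by simpa using h0) (h2 _ hD)
  intro P hP Q hQ hPQ
  rw [← det3_map_ne_zero T, LinearEquiv.apply_symm_apply]
  by_cases hPO : P = O
  · subst hPO
    rw [det3_swap₂₃]
    exact neg_ne_zero.2 (h3 Q hQ hPQ.symm)
  by_cases hQO : Q = O
  · subst hQO
    exact h3 P hP hPO
  obtain ⟨h0, hD, he⟩ := hx P hP hPO
  obtain ⟨h0', hD', he'⟩ := hx Q hQ hQO
  rw [he, he']
  have := det3_smul 1 (T P.rep 0) (T Q.rep 0) n ![1, x P, f (x P)] ![1, x Q, f (x Q)]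
  rw [one_smul] at this
  rw [this]
  exact mul_ne_zero (by simpa using ⟨h0, h0'⟩) (h1 _ hD _ hD' (hinj P hP hPO Q hQ hQO hPQ))

end Extension

end Coordinates

section Extending

variable {F : Type*} [Field F] {A : Finset (P2 F)}

/-- A vector on no chord of an arc spans a point extending the arc. -/
theorem NoThreeCollinear.exists_insert [DecidableEq (P2 F)] (hA : NoThreeCollinear A)
    (h1 : 1 < A.card) {n : Fin 3 → F}
    (hn : ∀ P ∈ A, ∀ Q ∈ A, P ≠ Q → det3 n P.rep Q.rep ≠ 0) :
    ∃ N ∉ A, NoThreeCollinear (insert N A) := by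
  obtain ⟨P, hP, Q, hQ, hPQ⟩ := Finset.one_lt_card.1 h1
  have hn0 : n ≠ 0 := by
    rintro rfl
    exact hn P hP Q hQ hPQ (by simp [det3])
  obtain ⟨a, ha⟩ := Projectivization.exists_smul_eq_mk_rep F n hn0
  set N : P2 F := Projectivization.mk F n hn0
  have hN : ∀ P ∈ A, ∀ Q ∈ A, P ≠ Q → det3 N.rep P.rep Q.rep ≠ 0 := by
    intro P hP Q hQ hPQ
    have := det3_smul (a : F) 1 1 n P.rep Q.rep
    rw [one_smul, one_smul] at this
    rw [← ha, Units.smul_def, this]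
    exact mul_ne_zero (by simp) (hn P hP Q hQ hPQ)
  refine ⟨N, fun hNA => ?_, hA.insert_point hN⟩
  obtain ⟨R, hR, hRN⟩ := Finset.exists_mem_ne h1 N
  exact hN N hNA R hR hRN.symm (det3_self₁₂ _ _)

/-- The points of an arc off a conic are controlled by the points of its graph off the conic. -/
theorem exists_conic_of_nearConic [Fintype F] [DecidableEq F] {O : P2 F}
    {T : (Fin 3 → F) ≃ₗ[F] (Fin 3 → F)} {D : Finset F} {f : F → F} {x : P2 F → F}
    (hDA : D.card + 1 = A.card)
    (hx : ∀ P ∈ A, P ≠ O → T P.rep 0 ≠ 0 ∧ x P ∈ D ∧ T P.rep = T P.rep 0 • ![1, x P, f (x P)])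
    (hinj : ∀ P ∈ A, P ≠ O → ∀ Q ∈ A, Q ≠ O → P ≠ Q → x P ≠ x Q) (h : NearConic D f) :
    ∃ Q : MvPolynomial (Fin 3) F, Q ≠ 0 ∧ Q.IsHomogeneous 2 ∧ ∃ S ⊆ A,
      (∀ P ∈ S, MvPolynomial.eval P.rep Q = 0) ∧ 2 * A.card ≤ S.card + Fintype.card F + 4 := by
  classical
  obtain ⟨v, hv, hc⟩ := h
  obtain ⟨Q, hQ0, hQ2, hQ⟩ := exists_quadraticForm T hv
  refine ⟨Q, hQ0, hQ2, A.filter fun P => MvPolynomial.eval P.rep Q = 0, Finset.filter_subset _ _,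
    fun P hP => (Finset.mem_filter.1 hP).2, ?_⟩
  set E := D.filter fun z =>
    v 0 + v 1 * z + v 2 * f z + v 3 * z ^ 2 + v 4 * (z * f z) + v 5 * f z ^ 2 ≠ 0 with hE
  have h1 : ((A.filter fun P => MvPolynomial.eval P.rep Q ≠ 0).erase O).card ≤ E.card := by
    refine Finset.card_le_card_of_injOn x ?_ ?_
    · intro P hP
      simp only [Finset.coe_erase, Finset.coe_filter, Set.mem_sdiff, Set.mem_ofPred_eq,
        Set.mem_singleton_iff] at hP
      obtain ⟨⟨hPA, hPQ⟩, hPO⟩ := hP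
      obtain ⟨-, hD, he⟩ := hx P hPA hPO
      have e1 : T P.rep 1 = T P.rep 0 * x P := by
        have := congrFun he 1
        simpa using this
      have e2 : T P.rep 2 = T P.rep 0 * f (x P) := by
        have := congrFun he 2
        simpa using this
      refine Finset.mem_coe.2 (Finset.mem_filter.2 ⟨hD, fun h0 => hPQ ?_⟩)
      rw [hQ, e1, e2]
      linear_combination T P.rep 0 ^ 2 * h0
    · intro P hP R hR he
      simp only [Finset.coe_erase, Finset.coe_filter, Set.mem_sdiff, Set.mem_ofPred_eq,
        Set.mem_singleton_iff] at hP hR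
      by_contra hPR
      exact hinj P hP.1.1 hP.2 R hR.1.1 hR.2 hPR he
  have h2 := Finset.pred_card_le_card_erase
    (s := A.filter fun P => MvPolynomial.eval P.rep Q ≠ 0) (a := O)
  have h3 := A.card_filter_add_card_filter_not fun P => MvPolynomial.eval P.rep Q = 0
  simp only [← ne_eq] at h3
  omega

/-- A large arc can be extended or lies mostly on a conic. -/
theorem NoThreeCollinear.exists_larger_or_conic [Fintype F] [DecidableEq (P2 F)]
    (hA : NoThreeCollinear A) {p : ℕ} [Fact p.Prime] [CharP F p] (hF : Fintype.card F = p) {t : ℕ}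
    (ht : A.card + t = p + 2) (ht0 : t ≠ 0) (htp : 45 * t + 41 ≤ p) :
    (2 ≤ t ∧ ∃ N ∉ A, NoThreeCollinear (insert N A)) ∨
    ∃ Q : MvPolynomial (Fin 3) F, Q ≠ 0 ∧ Q.IsHomogeneous 2 ∧ ∃ S ⊆ A,
      (∀ P ∈ S, MvPolynomial.eval P.rep Q = 0) ∧ 2 * A.card ≤ S.card + p + 4 := by
  classical
  have h1 : 1 < A.card := by omega
  obtain ⟨O, hO⟩ := Finset.card_pos.1 (zero_lt_one.trans h1)
  obtain ⟨w, c, hwc, htan⟩ := exists_tangent (by omega) hO h1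
  obtain ⟨T, -, hTc, hTO⟩ := exists_linearEquiv hwc
  have h0 : ∀ P ∈ A, P ≠ O → T P.rep 0 ≠ 0 := by
    intro P hP hPO
    have := (det3_map_ne_zero T).2 (htan P hP hPO)
    rw [hTc, hTO] at this
    simpa [det3] using this
  obtain ⟨D, f, x, hD, hDA, hx, hinj, -⟩ := hA.exists_isGraphArc hO hTO h0
  have hx' : ∀ P ∈ A, P ≠ O →
      T P.rep 0 ≠ 0 ∧ x P ∈ D ∧ T P.rep = T P.rep 0 • ![1, x P, f (x P)] :=
    fun P hP hPO => ⟨h0 P hP hPO, hx P hP hPO⟩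
  rcases hD.extends_or_nearConic hF (t := t) (by omega) ht0 htp with he | he | he
  · obtain ⟨x₀, hx₀, y₀, hy₀⟩ := he
    refine Or.inl ⟨?_, hA.exists_insert h1 (det3_ne_zero_of_coords hTO hx' hinj ![1, x₀, y₀] ?_ ?_)⟩
    · have := Finset.card_lt_univ_of_notMem hx₀
      omega
    · intro z hz w hw hzw
      rw [det3_affine]
      have hxz : x₀ - z ≠ 0 := sub_ne_zero.2 fun h => hx₀ (h ▸ hz)
      have hxw : x₀ - w ≠ 0 := sub_ne_zero.2 fun h => hx₀ (h ▸ hw)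
      have h2 := mem_tangentSlopes.1 (hy₀ z hz) w hw hzw.symm
      intro h3
      refine h2 ?_
      have h4 := chordSlope_mul f hzw
      rw [eq_div_iff hxz]
      refine mul_right_cancel₀ (sub_ne_zero.2 hzw) ?_
      linear_combination (x₀ - z) * h4 + h3
    · intro z hz
      have hxz : x₀ - z ≠ 0 := sub_ne_zero.2 fun h => hx₀ (h ▸ hz)
      intro h
      refine hxz ?_
      simp only [det3, Matrix.cons_val] at h
      linear_combination -h
  · have h2 : (2 : F) ≠ 0 := by
      have := natCast_ne_zero_of_lt_char (F := F) (p := p) (n := 2) (by norm_num) (by omega)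
      exact_mod_cast this
    have ht2 := hD.two_le_of_extendsAtInfinity h2 (t := t) (by omega) (by omega) he
    obtain ⟨γ, hγ⟩ := he
    refine Or.inl ⟨ht2, hA.exists_insert h1 (det3_ne_zero_of_coords hTO hx' hinj ![0, 1, γ] ?_ ?_)⟩
    · intro z hz w hw hzw h3
      refine mem_tangentSlopes.1 (hγ z hz) w hw hzw.symm ?_
      have h4 := chordSlope_mul f hzw
      refine mul_right_cancel₀ (sub_ne_zero.2 hzw) ?_
      simp only [det3, Matrix.cons_val] at h3
      linear_combination h4 + h3
    · intro z _
      simp [det3]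
  · exact Or.inr (hF ▸ exists_conic_of_nearConic hDA hx' hinj he)

/-- A point that lies on no chord through all but a few points of a large arc extends the arc. -/
theorem NoThreeCollinear.insert_of_few [Fintype F] [DecidableEq (P2 F)] (hA : NoThreeCollinear A)
    {t : ℕ} (ht : A.card + t = Fintype.card F + 2) {c : P2 F} (hc : c ∉ A) {B : Finset (P2 F)}
    (hBA : B.card + 2 * t + 1 < A.card)
    (hB : ∀ P ∈ A, P ∉ B → ∀ Q ∈ A, Q ≠ P → det3 c.rep P.rep Q.rep ≠ 0) :
    NoThreeCollinear (insert c A) := by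
  classical
  obtain ⟨O, hO, hOB⟩ := Finset.exists_mem_notMem_of_card_lt_card (s := B) (t := A) (by omega)
  obtain ⟨w, hw⟩ := exists_det3_ne_zero (P := c) (Q := O) fun h => hc (h ▸ hO)
  obtain ⟨T, -, hTc, hTO⟩ := exists_linearEquiv hw
  have h0 : ∀ P ∈ A, P ≠ O → T P.rep 0 ≠ 0 := by
    intro P hP hPO
    have := (det3_map_ne_zero T).2 (hB O hO hOB P hP hPO)
    rw [hTc, hTO] at this
    simpa [det3] using this
  obtain ⟨D, f, x, hD, hDA, hx, hinj, hsurj⟩ := hA.exists_isGraphArc hO hTO h0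
  have hx' : ∀ P ∈ A, P ≠ O →
      T P.rep 0 ≠ 0 ∧ x P ∈ D ∧ T P.rep = T P.rep 0 • ![1, x P, f (x P)] :=
    fun P hP hPO => ⟨h0 P hP hPO, hx P hP hPO⟩
  have hdet : ∀ z w : F, det3 ![0, 1, 0] ![1, z, f z] ![1, w, f w] = f z - f w := by
    intro z w
    simp only [det3, Matrix.cons_val]
    ring
  have hslope : ∀ z ∈ D, z ∉ B.image x → (0 : F) ∈ tangentSlopes D f z := by
    intro z hz hzB
    rw [mem_tangentSlopes]
    intro w hw hwz hs
    obtain ⟨P, hP, hPO, rfl⟩ := hsurj z hz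
    obtain ⟨Q, hQ, hQO, rfl⟩ := hsurj w hw
    have h2 := (det3_map_ne_zero T).2 (hB P hP
      (fun h => hzB (Finset.mem_image_of_mem x h)) Q hQ (fun h => hwz (h ▸ rfl)))
    have h3 := chordSlope_mul f hwz.symm
    have h4 := det3_smul 1 (T P.rep 0) (T Q.rep 0) ![0, 1, 0] ![1, x P, f (x P)]
      ![1, x Q, f (x Q)]
    rw [one_smul, ← (hx P hP hPO).2, ← (hx Q hQ hQO).2, hdet, ← h3, hs] at h4
    rw [hTc, h4] at h2
    simp at h2
  have hall : ∀ z ∈ D, (0 : F) ∈ tangentSlopes D f z := fun z hz =>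
    hD.mem_tangentSlopes_of_forall (t := t) (by omega)
      (by have := Finset.card_image_le (s := B) (f := x); omega) hslope hz
  have hn := det3_ne_zero_of_coords hTO hx' hinj ![0, 1, 0] (fun z hz w hw hzw h => by
    refine mem_tangentSlopes.1 (hall z hz) w hw hzw.symm ?_
    rw [hdet] at h
    rw [chordSlope, h, zero_div]) (fun z _ => by simp [det3])
  rw [← hTc, LinearEquiv.symm_apply_apply] at hn
  exact hA.insert_point hn

end Extending

section GenArc

variable {F : Type*} [Field F] {K : Finset (P2 F)}

theorem IsGenArc.mono [Finite F] {K K' : Set (P2 F)} (hK : IsGenArc K) (h : K' ⊆ K) :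
    IsGenArc K' :=
  fun C hC => (Set.ncard_le_ncard (Set.inter_subset_inter_left C h) (Set.toFinite _)).trans (hK C hC)

/-- A line contains at most three points of a generalized arc. -/
theorem IsGenArc.card_collinear_le [Finite F] [DecidableEq F] (hK : IsGenArc (K : Set (P2 F)))
    (h6 : 6 ≤ K.card) {P Q : P2 F} (h : P ≠ Q) :
    (K.filter fun R => det3 R.rep P.rep Q.rep = 0).card ≤ 3 := by
  classical
  set M := K.filter fun R => det3 R.rep P.rep Q.rep = 0 with hM
  have hMK : M ⊆ K := Finset.filter_subset _ _
  have hM5 : M.card ≤ 5 := hK.card_le_of_lines h h M (fun R hR => hMK hR)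
    (fun R hR => Or.inl (Finset.mem_filter.1 hR).2)
  by_contra! h4
  obtain ⟨S, hMS, hSK, hS⟩ := Finset.exists_subsuperset_card_eq hMK (by omega : M.card ≤ 6) h6
  have h2 := Finset.card_sdiff_add_card_eq_card hMS
  obtain ⟨U, hU, -, hU2⟩ := Finset.exists_subsuperset_card_eq (n := 2)
    (Finset.sdiff_subset.trans hSK : S \ M ⊆ K) (by omega) (by omega)
  obtain ⟨P', Q', hPQ', rfl⟩ := Finset.card_eq_two.1 hU2
  have := hK.card_le_of_lines h hPQ' S (fun R hR => hSK hR) fun R hR => by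
    by_cases hRM : R ∈ M
    · exact Or.inl (Finset.mem_filter.1 hRM).2
    · right
      have := hU (Finset.mem_sdiff.2 ⟨hR, hRM⟩)
      rw [Finset.mem_insert, Finset.mem_singleton] at this
      rcases this with e | e <;> rw [e]
      exacts [det3_self₁₂ _ _, det3_self₁₃ _ _]
  omega

/-- A generalized arc contains no two disjoint collinear triples. -/
theorem IsGenArc.not_disjoint [Finite F] [DecidableEq (P2 F)] {K : Set (P2 F)} (hK : IsGenArc K)
    {P Q R X Y Z : P2 F} (h : ∀ A ∈ ({P, Q, R} : Finset (P2 F)), A ∈ K)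
    (h' : ∀ A ∈ ({X, Y, Z} : Finset (P2 F)), A ∈ K) (hPQ : P ≠ Q) (hPR : P ≠ R) (hQR : Q ≠ R)
    (hXY : X ≠ Y) (hXZ : X ≠ Z) (hYZ : Y ≠ Z) (hd : det3 P.rep Q.rep R.rep = 0)
    (hd' : det3 X.rep Y.rep Z.rep = 0) :
    ¬ Disjoint ({P, Q, R} : Finset (P2 F)) {X, Y, Z} := by
  intro hdis
  have hc := Finset.card_union_of_disjoint hdis
  rw [Finset.card_eq_three.2 ⟨P, Q, R, hPQ, hPR, hQR, rfl⟩,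
    Finset.card_eq_three.2 ⟨X, Y, Z, hXY, hXZ, hYZ, rfl⟩] at hc
  have := hK.card_le_of_lines hQR hYZ ({P, Q, R} ∪ {X, Y, Z})
    (fun A hA => (Finset.mem_union.1 hA).elim (h A) (h' A)) fun A hA => by
      simp only [Finset.mem_union, Finset.mem_insert, Finset.mem_singleton] at hA
      rcases hA with (e | e | e) | (e | e | e) <;> rw [e] <;>
        simp [hd, hd', det3_self₁₂, det3_self₁₃]
  omega

/-- An arc contained in a generalized arc is small. -/
theorem IsGenArc.card_lt_of_noThreeCollinear [Fintype F] {K : Set (P2 F)} (hK : IsGenArc K)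
    {A₀ : Finset (P2 F)} (hA₀K : ∀ P ∈ A₀, P ∈ K) (hA₀ : NoThreeCollinear A₀) {p : ℕ}
    [Fact p.Prime] [CharP F p] (hF : Fintype.card F = p) (hcard : A₀.card ≤ p + 1) :
    45 * A₀.card < 44 * p + 131 := by
  classical
  by_contra! h
  let _ : Fintype (P2 F) := Fintype.ofFinite _
  obtain ⟨A, hA, hmax⟩ := Finset.exists_max_image (Finset.univ.filter fun A : Finset (P2 F) =>
    A₀ ⊆ A ∧ NoThreeCollinear A ∧ A.card ≤ p + 1) Finset.card ⟨A₀, by simpa using ⟨hA₀, hcard⟩⟩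
  simp only [Finset.mem_filter, Finset.mem_univ, true_and] at hA hmax
  obtain ⟨hsub, hA, hAc⟩ := hA
  have hle := Finset.card_le_card hsub
  obtain ⟨t, ht⟩ := Nat.exists_eq_add_of_le (show A.card ≤ p + 2 by omega)
  rcases hA.exists_larger_or_conic hF (t := t) ht.symm (by omega) (by omega) with
    ⟨ht2, N, hNA, hN⟩ | ⟨Q, hQ0, hQ2, S, hSA, hS, hcS⟩
  · have hc := Finset.card_insert_of_notMem hNA
    have := hmax (insert N A) ⟨hsub.trans (Finset.subset_insert _ _), hN, by omega⟩
    omega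
  · have h1 := hK.card_le hQ0 hQ2 (S ∩ A₀) (fun P hP => hA₀K P (Finset.mem_inter.1 hP).2)
      (fun P hP => hS P (Finset.mem_inter.1 hP).1)
    have h2 := Finset.card_union_add_card_inter S A₀
    have h3 := Finset.card_le_card (Finset.union_subset hSA hsub)
    omega

/-- A large generalized arc contains a point whose removal leaves an arc. -/
theorem IsGenArc.exists_noThreeCollinear_erase [Fintype F] [DecidableEq (P2 F)]
    (hK : IsGenArc (K : Set (P2 F))) (h6 : 6 ≤ K.card)
    (hle : K.card ≤ Fintype.card F + 2) (hlt : 2 * Fintype.card F + 20 < 3 * K.card) :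
    ∃ c ∈ K, NoThreeCollinear (K.erase c) := by
  classical
  by_contra! hno
  have hKno : ¬ NoThreeCollinear K := fun h => by
    obtain ⟨c, hc⟩ := Finset.card_pos.1 (by omega : 0 < K.card)
    exact hno c hc (h.mono (Finset.erase_subset _ _))
  have hbad := hKno
  unfold NoThreeCollinear at hbad
  push Not at hbad
  obtain ⟨P, hP, Q, hQ, R, hR, hPQ, hPR, hQR, hd⟩ := hbad
  set A₀ := K.filter fun X => ¬ det3 X.rep P.rep Q.rep = 0
  have hA₀c : K.card ≤ A₀.card + 3 := by
    have h1 := hK.card_collinear_le h6 hPQ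
    have h2 : _ + A₀.card = _ :=
      K.card_filter_add_card_filter_not fun X => det3 X.rep P.rep Q.rep = 0
    omega
  have hA₀ : NoThreeCollinear A₀ := by
    intro X hX Y hY Z hZ hXY hXZ hYZ hXYZ
    refine hK.not_disjoint (by simp [hP, hQ, hR]) ?_ hPQ hPR hQR hXY hXZ hYZ hd hXYZ ?_
    · intro W hW
      simp only [Finset.mem_insert, Finset.mem_singleton] at hW
      rcases hW with e | e | e <;> rw [e]
      exacts [(Finset.mem_filter.1 hX).1, (Finset.mem_filter.1 hY).1, (Finset.mem_filter.1 hZ).1]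
    · have hmem : ∀ W ∈ A₀, W ≠ P ∧ W ≠ Q ∧ W ≠ R := by
        intro W hW
        have hWd := (Finset.mem_filter.1 hW).2
        refine ⟨?_, ?_, ?_⟩ <;> rintro rfl <;> apply hWd
        exacts [det3_self₁₂ _ _, det3_self₁₃ _ _, by rw [← hd, det3_rotate, det3_rotate]]
      have hX' := hmem X hX
      have hY' := hmem Y hY
      have hZ' := hmem Z hZ
      simp only [Finset.disjoint_left, Finset.mem_insert, Finset.mem_singleton]
      rintro W (e | e | e) (e' | e' | e') <;> rw [e] at e' <;> grind
  obtain ⟨A, hA, hmax⟩ := Finset.exists_max_image (K.powerset.filter fun A =>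
    A₀ ⊆ A ∧ NoThreeCollinear A) Finset.card
    ⟨A₀, by simp [hA₀, A₀]⟩
  simp only [Finset.mem_filter, Finset.mem_powerset] at hA hmax
  obtain ⟨hAK, hsub, hA⟩ := hA
  obtain ⟨c, hcK, hcA⟩ : ∃ c ∈ K, c ∉ A := by
    by_contra! hall
    exact hKno (hA.mono hall)
  have hbad := hno c hcK
  unfold NoThreeCollinear at hbad
  push Not at hbad
  obtain ⟨X, hX, Y, hY, Z, hZ, hXY, hXZ, hYZ, hd'⟩ := hbad
  rw [Finset.mem_erase] at hX hY hZ
  set B := A.filter fun P => ∃ Q ∈ A, Q ≠ P ∧ det3 c.rep P.rep Q.rep = 0 with hB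
  set W : P2 F → Finset (P2 F) := fun a =>
    ((K.filter fun V => det3 V.rep c.rep a.rep = 0).erase c).erase a with hW
  have hWc : ∀ a ∈ K, a ≠ c → (W a).card ≤ 1 := by
    intro a ha hac
    have h1 := hK.card_collinear_le h6 hac.symm
    have h2 : c ∈ K.filter fun V => det3 V.rep c.rep a.rep = 0 :=
      Finset.mem_filter.2 ⟨hcK, det3_self₁₂ _ _⟩
    have h3 : a ∈ (K.filter fun V => det3 V.rep c.rep a.rep = 0).erase c :=
      Finset.mem_erase.2 ⟨hac, Finset.mem_filter.2 ⟨ha, det3_self₁₃ _ _⟩⟩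
    rw [hW, Finset.card_erase_of_mem h3, Finset.card_erase_of_mem h2]
    omega
  have hWmem : ∀ V ∈ A, ∀ a, a ≠ V → det3 c.rep V.rep a.rep = 0 → V ∈ W a := by
    intro V hV a ha hdet
    refine Finset.mem_erase.2 ⟨ha.symm, Finset.mem_erase.2 ⟨fun h => hcA (h ▸ hV),
      Finset.mem_filter.2 ⟨hAK hV, ?_⟩⟩⟩
    rw [det3_swap₁₂, hdet, neg_zero]
  have hBsub : B ⊆ {X, Y, Z} ∪ (W X ∪ (W Y ∪ W Z)) := by
    intro V hV
    obtain ⟨hVA, U, hU, hUV, hdet⟩ := Finset.mem_filter.1 hV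
    have hVW := hWmem V hVA U hUV hdet
    have hcU : c ≠ U := fun h => hcA (h ▸ hU)
    have hcV : c ≠ V := fun h => hcA (h ▸ hVA)
    have hnd := hK.not_disjoint (P := X) (Q := Y) (R := Z) (X := c) (Y := V) (Z := U)
      (by simp [hX.2, hY.2, hZ.2]) (by simp [hcK, hAK hVA, hAK hU])
      hXY hXZ hYZ hcV hcU hUV.symm hd' hdet
    obtain ⟨S, hS, hS'⟩ := Finset.not_disjoint_iff.1 hnd
    simp only [Finset.mem_insert, Finset.mem_singleton] at hS hS'
    simp only [Finset.mem_union, Finset.mem_insert, Finset.mem_singleton]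
    grind
  have hBc : B.card ≤ 6 := by
    have h1 := Finset.card_le_card hBsub
    have h2 := Finset.card_union_le {X, Y, Z} (W X ∪ (W Y ∪ W Z))
    have h3 := Finset.card_union_le (W X) (W Y ∪ W Z)
    have h4 := Finset.card_union_le (W Y) (W Z)
    have h5 := Finset.card_le_three (a := X) (b := Y) (c := Z)
    have h6 := hWc X hX.2 hX.1
    have h7 := hWc Y hY.2 hY.1
    have h8 := hWc Z hZ.2 hZ.1
    omega
  have h1 := Finset.card_le_card hsub
  have h2 := Finset.card_le_card hAK
  obtain ⟨t, ht⟩ := Nat.exists_eq_add_of_le (h2.trans hle)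
  have hins := hA.insert_of_few ht.symm hcA (B := B) (by omega) fun V hV hVB U hU hUV hdet =>
    hVB (Finset.mem_filter.2 ⟨hV, U, hU, hUV, hdet⟩)
  have h3 := hmax (insert c A)
    ⟨Finset.insert_subset hcK hAK, hsub.trans (Finset.subset_insert _ _), hins⟩
  rw [Finset.card_insert_of_notMem hcA] at h3
  omega

theorem IsGenArc.card_lt [Fintype F] (hK : IsGenArc (K : Set (P2 F))) {p : ℕ} [Fact p.Prime]
    [CharP F p] (hF : Fintype.card F = p) (hle : K.card ≤ p + 2) :
    45 * K.card < 44 * p + 176 := by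
  classical
  by_contra! h
  obtain ⟨c, hc, hcK⟩ := hK.exists_noThreeCollinear_erase (by omega) (by omega) (by omega)
  have h1 := Finset.card_erase_add_one hc
  have := hK.card_lt_of_noThreeCollinear (fun P hP => Finset.mem_coe.2 (Finset.mem_of_mem_erase hP))
    hcK hF (by omega)
  omega

end GenArc

/-- for `q ≥ 89` prime, every generalized `k`-arc in `P²(F)` satisfies
`k ≤ ⌊44q/45 + 8/9⌋ + 3`. -/
theorem stmt12 {F : Type*} [Field F] [Fintype F] (q : ℕ) (hq : Fintype.card F = q)
    (hprime : Nat.Prime q) (h89 : 89 ≤ q) (k : ℕ) (K : Set (P2 F))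
    (hcard : K.ncard = k) (hgen : IsGenArc K) :
    (k : ℤ) ≤ ⌊44 * (q : ℚ) / 45 + 8 / 9⌋ + 3 := by
  classical
  have : Fact q.Prime := ⟨hprime⟩
  have : CharP F q := charP_of_card_eq_prime hq
  set m : ℤ := ⌊44 * (q : ℚ) / 45 + 8 / 9⌋ with hm
  have h1 : 45 * m ≤ 44 * q + 40 := by
    have : (m : ℚ) ≤ _ := Int.floor_le (44 * (q : ℚ) / 45 + 8 / 9)
    have : (45 * m : ℚ) ≤ 44 * q + 40 := by linarith
    exact_mod_cast this
  have h2 : 44 * q + 40 < 45 * m + 45 := by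
    have : _ < (m : ℚ) + 1 := Int.lt_floor_add_one (44 * (q : ℚ) / 45 + 8 / 9)
    have : (44 * q + 40 : ℚ) < 45 * m + 45 := by linarith
    exact_mod_cast this
  by_contra! hk
  have hfin : K.Finite := Set.toFinite K
  rw [Set.ncard_eq_toFinset_card K hfin] at hcard
  obtain ⟨S, hS, hSc⟩ := Finset.exists_subset_card_eq
    (show (m + 4).toNat ≤ hfin.toFinset.card by omega)
  have := (hgen.mono fun P hP => hfin.mem_toFinset.1 (hS hP) : IsGenArc (S : Set (P2 F))).card_lt
    hq (by omega)
  omega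
end

section
/- Let F be a finite field with q elements, q ≥ 2, and let K be a complete k-arc in P²(F). Then k ≥ √(2q + 1/4) + 3/2; equivalently, t(2,q) ≥ ⌈√(2q + 1/4) + 3/2⌉. -/
/-- A line of `P²(F)` is the set of points orthogonal to some point of `P²(F)`. -/
theorem isLine_iff_exists_orthogonal {F : Type*} [Field F] {L : Set (P2 F)} :
    IsLine L ↔ ∃ l : P2 F, L = {p | p.orthogonal l} := by
  have eval_eq (c v : Fin 3 → F) :
      MvPolynomial.eval v (∑ i, c i • (MvPolynomial.X i : MvPolynomial (Fin 3) F)) = v ⬝ᵥ c := by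
    simp [dotProduct, MvPolynomial.smul_eval, mul_comm]
  constructor
  · rintro ⟨φ, hφ, hom, rfl⟩
    rw [← MvPolynomial.mem_homogeneousSubmodule, MvPolynomial.homogeneousSubmodule_one_eq_span_X,
      Submodule.mem_span_range_iff_exists_fun] at hom
    obtain ⟨c, rfl⟩ := hom
    have hc : c ≠ 0 := by
      rintro rfl
      simp at hφ
    refine ⟨Projectivization.mk F c hc, Set.ext fun p => ?_⟩
    rw [Set.mem_ofPred_eq, Set.mem_ofPred_eq, eval_eq,
      ← Projectivization.orthogonal_mk p.rep_nonzero hc, p.mk_rep]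
  · rintro ⟨l, rfl⟩
    refine ⟨∑ i, l.rep i • MvPolynomial.X i, fun h => ?_, ?_, Set.ext fun p => ?_⟩
    · refine l.rep_nonzero (dotProduct_eq_zero_iff.mp fun v => ?_)
      rw [dotProduct_comm, ← eval_eq, h, map_zero]
    · rw [← MvPolynomial.mem_homogeneousSubmodule, MvPolynomial.homogeneousSubmodule_one_eq_span_X,
        Submodule.mem_span_range_iff_exists_fun]
      exact ⟨_, rfl⟩
    · rw [Set.mem_ofPred_eq, Set.mem_ofPred_eq, eval_eq,
        ← Projectivization.orthogonal_mk p.rep_nonzero l.rep_nonzero, p.mk_rep, l.mk_rep]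

theorem isArc_iff_forall_orthogonal {F : Type*} [Field F] {K : Set (P2 F)} :
    IsArc K ↔ ∀ l : P2 F, (K ∩ {p | p.orthogonal l}).ncard ≤ 2 := by
  simp only [IsArc, isLine_iff_exists_orthogonal]
  exact ⟨fun h l => h _ ⟨l, rfl⟩, by rintro h _ ⟨l, rfl⟩; exact h l⟩

namespace Configuration.ProjectivePlane

open Nondegenerate HasLines

/-- The order of the projective plane over a finite field is the cardinality of the field. -/
theorem order_P2 (F : Type*) [Field F] [Fintype F] [DecidableEq F] :
    order (P2 F) (P2 F) = Fintype.card F := by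
  have := Fintype.ofFinite (P2 F)
  have h := card_points (P := P2 F) (L := P2 F)
  rw [← Nat.card_eq_fintype_card,
    Projectivization.card_of_finrank F (Fin 3 → F) (n := 3) (by simp)] at h
  simp only [Finset.sum_range_succ, Finset.sum_range_zero, Nat.card_eq_fintype_card] at h
  nlinarith

variable {P L : Type*} [Membership P L] [ProjectivePlane P L] [Finite P] [Finite L]

/-- If no line meets `K` in the point `p` only, then `K` has at least `order P L + 2` points. -/
theorem order_add_two_le_ncard {K : Set P} {p : P} (hp : p ∈ K)
    (h : ∀ l : L, p ∈ l → ∃ x ∈ K, x ≠ p ∧ x ∈ l) : order P L + 2 ≤ K.ncard := by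
  choose f hfK hfp hfl using h
  have hle : Nat.card {l : L // p ∈ l} ≤ (K \ {p}).ncard := by
    rw [← Nat.card_coe_set_eq]
    refine Nat.card_le_card_of_injective
      (fun l => (⟨f l.1 l.2, hfK _ _, hfp _ _⟩ : (K \ {p} : Set P))) fun l m hlm => ?_
    have heq : f l.1 l.2 = f m.1 m.2 := congrArg Subtype.val hlm
    have hm : f l.1 l.2 ∈ m.1 := heq ▸ hfl m.1 m.2
    exact Subtype.ext ((eq_or_eq (hfl l.1 l.2) l.2 hm m.2).resolve_left (hfp _ _))
  have hline := lineCount_eq L p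
  rw [lineCount] at hline
  have := Set.ncard_sdiff_singleton_add_one hp
  omega

/-- If `l` meets `K` in the point `p` only and every point of `l` other than `p` lies on a line
meeting `K` in exactly two points, then there are at least `order P L` pairs of points of
`K` other than `p`. -/
theorem order_le_choose {K : Set P} {p : P} {l : L} (hp : p ∈ K) (hpl : p ∈ l)
    (htan : ∀ x ∈ K, x ∈ l → x = p)
    (hsec : ∀ x ∉ K, ∃ m : L, x ∈ m ∧ (K ∩ {y | y ∈ m}).ncard = 2) :
    order P L ≤ (K.ncard - 1).choose 2 := by
  have hxK (x : ({x | x ∈ l} \ {p} : Set P)) : x.1 ∉ K := fun h => x.2.2 (htan _ h x.2.1)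
  choose m hxm hm using fun x : ({x | x ∈ l} \ {p} : Set P) => hsec x.1 (hxK x)
  have hxl (x : ({x | x ∈ l} \ {p} : Set P)) : x.1 ∈ l := x.2.1
  have hml (x) : m x ≠ l := by
    intro h
    have hsub : K ∩ {y | y ∈ m x} ⊆ {p} := fun y hy => htan y hy.1 (h ▸ hy.2)
    have := Set.ncard_le_ncard hsub
    rw [hm, Set.ncard_singleton] at this
    omega
  have hpm (x) : p ∉ m x := fun h =>
    (eq_or_eq (hxm x) h (hxl x) hpl).elim x.2.2 (hml x)
  have hmem (x) : K ∩ {y | y ∈ m x} ∈ {t ⊆ K \ {p} | t.ncard = 2} :=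
    ⟨fun y hy => ⟨hy.1, fun hyp => hpm x (hyp ▸ hy.2)⟩, hm x⟩
  have hinj : Function.Injective fun x =>
      (⟨K ∩ {y | y ∈ m x}, hmem x⟩ : ↥{t ⊆ K \ {p} | t.ncard = 2}) := by
    intro x y hxy
    have heq : K ∩ {z | z ∈ m x} = K ∩ {z | z ∈ m y} := congrArg Subtype.val hxy
    obtain ⟨a, b, hab, hK⟩ := Set.ncard_eq_two.mp (hm x)
    have hax : a ∈ K ∩ {z | z ∈ m x} := by simp [hK]
    have hbx : b ∈ K ∩ {z | z ∈ m x} := by simp [hK]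
    have hmxy : m x = m y :=
      (eq_or_eq (show a ∈ m x from hax.2) (show b ∈ m x from hbx.2)
        (heq ▸ hax).2 (heq ▸ hbx).2).resolve_left hab
    exact Subtype.ext
      ((eq_or_eq (hxm x) (hmxy ▸ hxm y) (hxl x) (hxl y)).resolve_right (hml x))
  have hcard := Nat.card_le_card_of_injective _ hinj
  rw [Nat.card_coe_set_eq, Nat.card_coe_set_eq, Set.ncard_powerset_ncard (Set.toFinite _),
    Set.ncard_sdiff_singleton_of_mem hp,
    Set.ncard_sdiff_singleton_of_mem (show p ∈ {x | x ∈ l} from hpl)] at hcard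
  have hpoint := pointCount_eq P l
  rw [pointCount] at hpoint
  change Nat.card {x | x ∈ l} - 1 ≤ _ at hcard
  change Nat.card {x | x ∈ l} = _ at hpoint
  omega

/-- A complete arc with `k` points in a projective plane of order `n` satisfies
`2 * n ≤ (k - 1) * (k - 2)`. -/
theorem two_mul_order_le {K : Set P} (harc : ∀ l : L, (K ∩ {x | x ∈ l}).ncard ≤ 2)
    (hcomp : ∀ x ∉ K, ∃ l : L, 2 < (insert x K ∩ {y | y ∈ l}).ncard) :
    2 * order P L ≤ (K.ncard - 1) * (K.ncard - 2) := by
  obtain ⟨p, hp⟩ : K.Nonempty := by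
    by_contra! hK
    obtain ⟨x, -⟩ := exists_config (P := P) (L := L)
    obtain ⟨l, hl⟩ := hcomp x (by simp [hK])
    have hsub : insert x K ∩ {y | y ∈ l} ⊆ {x} := by simp [hK]
    have := Set.ncard_le_ncard hsub
    rw [Set.ncard_singleton] at this
    omega
  by_cases h : ∀ l : L, p ∈ l → ∃ x ∈ K, x ≠ p ∧ x ∈ l
  · have hle := order_add_two_le_ncard hp h
    have := one_lt_order P L
    exact Nat.mul_le_mul (by omega) (by omega)
  · push Not at h
    obtain ⟨l, hpl, hl⟩ := h
    have hchoose := order_le_choose hp hpl (fun x hx hxl => by_contra fun hne => hl x hx hne hxl)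
      fun x hx => ?_
    · rw [Nat.choose_two_right, Nat.sub_sub] at hchoose
      exact (Nat.mul_le_mul_left 2 hchoose).trans (Nat.mul_div_le _ _)
    · obtain ⟨m, hm⟩ := hcomp x hx
      have hxm : x ∈ m := by
        by_contra hxm
        rw [Set.insert_inter_of_notMem (show x ∉ {y | y ∈ m} from hxm)] at hm
        exact (harc m).not_gt hm
      refine ⟨m, hxm, (harc m).antisymm ?_⟩
      rw [Set.insert_inter_of_mem (show x ∈ {y | y ∈ m} from hxm)] at hm
      have := Set.ncard_insert_le x (K ∩ {y | y ∈ m})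
      omega

end Configuration.ProjectivePlane

/-- The bound `2q ≤ (k - 1)(k - 2)` for complete `k`-arcs, solved for `k`. -/
theorem sqrt_add_le_of_complete_arc {F : Type*} [Field F] [Fintype F] {K : Set (P2 F)}
    (harc : IsArc K) (hcomp : ∀ p ∉ K, ¬ IsArc (insert p K)) :
    Real.sqrt (2 * (Fintype.card F : ℝ) + 1 / 4) + 3 / 2 ≤ (K.ncard : ℝ) := by
  classical
  simp only [isArc_iff_forall_orthogonal, not_forall, not_le] at harc hcomp
  have h := Configuration.ProjectivePlane.two_mul_order_le harc hcomp
  rw [Configuration.ProjectivePlane.order_P2] at h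
  have hpos : 0 < Fintype.card F := Fintype.card_pos
  obtain ⟨j, hj⟩ : ∃ j, K.ncard = j + 2 := by
    refine ⟨K.ncard - 2, (Nat.sub_add_cancel ?_).symm⟩
    by_contra! hlt
    rw [Nat.sub_eq_zero_of_le hlt.le, mul_zero] at h
    omega
  rw [hj] at h ⊢
  have hreal : 2 * (Fintype.card F : ℝ) ≤ (j + 1) * j := by exact_mod_cast h
  have hsqrt : Real.sqrt (2 * (Fintype.card F : ℝ) + 1 / 4) ≤ j + 1 / 2 :=
    Real.sqrt_le_iff.mpr ⟨by positivity, by linarith⟩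
  push_cast
  linarith

/-- every complete `k`-arc in `P²(F)` (`q ≥ 2`) satisfies
`k ≥ √(2q + 1/4) + 3/2`; equivalently `t(2,q) ≥ ⌈√(2q + 1/4) + 3/2⌉`. -/
theorem stmt13 {F : Type*} [Field F] [Fintype F] (q : ℕ) (hq : Fintype.card F = q)
    (h2 : 2 ≤ q) (k : ℕ) (K : Set (P2 F)) (harc : IsArc K) (hcard : K.ncard = k)
    (hcomp : ∀ p ∉ K, ¬ IsArc (insert p K)) :
    Real.sqrt (2 * (q : ℝ) + 1 / 4) + 3 / 2 ≤ (k : ℝ) ∧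
    ⌈Real.sqrt (2 * (q : ℝ) + 1 / 4) + 3 / 2⌉₊ ≤
      sInf {n : ℕ | ∃ K' : Set (P2 F), IsArc K' ∧ K'.ncard = n ∧
        ∀ p ∉ K', ¬ IsArc (insert p K')} := by
  subst hq hcard
  refine ⟨sqrt_add_le_of_complete_arc harc hcomp, ?_⟩
  refine le_csInf ⟨_, K, harc, rfl, hcomp⟩ ?_
  rintro _ ⟨K', harc', rfl, hcomp'⟩
  exact Nat.ceil_le.mpr (sqrt_add_le_of_complete_arc harc' hcomp')
end

section
/- For every integer h ≥ 4 and every integer q with (h−2)(h−1)/2 < q < (h−1)²/2, one has ⌈√(2q + 1/4) + 3/2⌉ = ⌊√(2q) + 2⌋ + 1. -/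
/-- for every integer `h ≥ 4` and every integer `q` with
`(h−2)(h−1)/2 < q < (h−1)²/2`, one has `⌈√(2q + 1/4) + 3/2⌉ = ⌊√(2q) + 2⌋ + 1`. -/
theorem stmt14 (h : ℤ) (hh : 4 ≤ h) (q : ℤ)
    (h1 : ((h : ℝ) - 2) * ((h : ℝ) - 1) / 2 < (q : ℝ))
    (h2 : (q : ℝ) < ((h : ℝ) - 1) ^ 2 / 2) :
    ⌈Real.sqrt (2 * (q : ℝ) + 1 / 4) + 3 / 2⌉ = ⌊Real.sqrt (2 * (q : ℝ)) + 2⌋ + 1 := by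
  have hr : (4 : ℝ) ≤ h := by exact_mod_cast hh
  have hceil : ⌈Real.sqrt (2 * (q : ℝ) + 1 / 4) + 3 / 2⌉ = h + 1 := by
    have hlower : (h : ℝ) - 3 / 2 < Real.sqrt (2 * (q : ℝ) + 1 / 4) :=
      Real.lt_sqrt_of_sq_lt (by nlinarith)
    have hupper : Real.sqrt (2 * (q : ℝ) + 1 / 4) ≤ (h : ℝ) - 1 / 2 :=
      Real.sqrt_le_iff.mpr ⟨by linarith, by nlinarith⟩
    rw [Int.ceil_eq_iff]
    push_cast
    constructor <;> linarith
  have hfloor : ⌊Real.sqrt (2 * (q : ℝ)) + 2⌋ = h := by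
    have hlower : (h : ℝ) - 2 ≤ Real.sqrt (2 * (q : ℝ)) :=
      Real.le_sqrt_of_sq_le (by nlinarith)
    have hupper : Real.sqrt (2 * (q : ℝ)) < (h : ℝ) - 1 :=
      (Real.sqrt_lt' (by linarith)).mpr (by linarith)
    rw [Int.floor_eq_iff]
    constructor <;> linarith
  rw [hceil, hfloor]
end

section
/- Let F be a finite field with q elements, q ≥ 5, and let K be a complete Veronesian k-arc in P²(F). Then C(k,5)·(q−4) + C(k,2)·(q−1) + k ≥ q² + q + 1, where C(n,r) denotes the binomial coefficient. In particular, t_v(2,q) ≥ ⌈t₀⌉ where t₀ is the smallest positive real solution of this inequality. -/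
/-- A Veronesian arc: an arc no 6 of whose points lie on a conic. -/
def IsVerArc {F : Type*} [Field F] (K : Set (P2 F)) : Prop :=
  IsArc K ∧ IsGenArc K

open MvPolynomial Finset

section Forms

variable {F : Type*} [Field F]

lemma eval_linearForm {φ : MvPolynomial (Fin 3) F} (hφ : φ.IsHomogeneous 1)
    (u v w : Fin 3 → F) (a b c : F) :
    eval (a • u + b • v + c • w) φ = a * eval u φ + b * eval v φ + c * eval w φ := by
  simp only [eval_eq, Finset.mul_sum, ← Finset.sum_add_distrib]
  refine Finset.sum_congr rfl fun d hd => ?_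
  have hd1 := hφ.degree_eq_sum_deg_support hd
  simp only [← Finsupp.degree_apply, Finsupp.degree_eq_sum, Fin.sum_univ_three] at hd1
  have h : (d 0 = 1 ∧ d 1 = 0 ∧ d 2 = 0) ∨ (d 0 = 0 ∧ d 1 = 1 ∧ d 2 = 0) ∨
      (d 0 = 0 ∧ d 1 = 0 ∧ d 2 = 1) := by omega
  rw [Finset.prod_subset (Finset.subset_univ d.support) (by simp +contextual),
    Finset.prod_subset (Finset.subset_univ d.support) (by simp +contextual),
    Finset.prod_subset (Finset.subset_univ d.support) (by simp +contextual),
    Finset.prod_subset (Finset.subset_univ d.support) (by simp +contextual)]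
  rcases h with ⟨h0, h1, h2⟩ | ⟨h0, h1, h2⟩ | ⟨h0, h1, h2⟩ <;>
    simp [Fin.prod_univ_three, h0, h1, h2] <;> ring

/-- The expansion of a quadratic form along three vectors at which it vanishes. -/
lemma exists_eval_quadraticForm {Q : MvPolynomial (Fin 3) F} (hQ : Q.IsHomogeneous 2)
    {u v w : Fin 3 → F} (hu : eval u Q = 0) (hv : eval v Q = 0) (hw : eval w Q = 0) :
    ∃ l m n : F, ∀ a b c : F,
      eval (a • u + b • v + c • w) Q = l * (b * c) + m * (a * c) + n * (a * b) := by
  have key : ∀ a b c : F, eval (a • u + b • v + c • w) Q =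
      a ^ 2 * eval u Q + b ^ 2 * eval v Q + c ^ 2 * eval w Q
      + b * c * (eval (v + w) Q - eval v Q - eval w Q)
      + a * c * (eval (u + w) Q - eval u Q - eval w Q)
      + a * b * (eval (u + v) Q - eval u Q - eval v Q) := by
    intro a b c
    simp only [eval_eq, Finset.mul_sum, ← Finset.sum_add_distrib, ← Finset.sum_sub_distrib]
    refine Finset.sum_congr rfl fun d hd => ?_
    have hd1 := hQ.degree_eq_sum_deg_support hd
    simp only [← Finsupp.degree_apply, Finsupp.degree_eq_sum, Fin.sum_univ_three] at hd1
    have h : (d 0 = 2 ∧ d 1 = 0 ∧ d 2 = 0) ∨ (d 0 = 0 ∧ d 1 = 2 ∧ d 2 = 0) ∨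
        (d 0 = 0 ∧ d 1 = 0 ∧ d 2 = 2) ∨ (d 0 = 1 ∧ d 1 = 1 ∧ d 2 = 0) ∨
        (d 0 = 1 ∧ d 1 = 0 ∧ d 2 = 1) ∨ (d 0 = 0 ∧ d 1 = 1 ∧ d 2 = 1) := by omega
    have hp : ∀ x : Fin 3 → F, ∏ i ∈ d.support, x i ^ d i = ∏ i, x i ^ d i := fun x =>
      Finset.prod_subset (Finset.subset_univ d.support) (by simp +contextual)
    simp only [hp]
    rcases h with ⟨h0, h1, h2⟩ | ⟨h0, h1, h2⟩ | ⟨h0, h1, h2⟩ | ⟨h0, h1, h2⟩ |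
      ⟨h0, h1, h2⟩ | ⟨h0, h1, h2⟩ <;>
      simp [Fin.prod_univ_three, h0, h1, h2] <;> ring
  refine ⟨eval (v + w) Q - eval v Q - eval w Q, eval (u + w) Q - eval u Q - eval w Q,
    eval (u + v) Q - eval u Q - eval v Q, fun a b c => ?_⟩
  rw [key, hu, hv, hw]
  ring

lemma exists_eq_comb {u v w : Fin 3 → F} (h : LinearIndependent F ![u, v, w]) (x : Fin 3 → F) :
    ∃ a b c : F, x = a • u + b • v + c • w := by
  have hx : x ∈ Submodule.span F (Set.range ![u, v, w]) := by
    rw [h.span_eq_top_of_card_eq_finrank' (by simp)]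
    trivial
  obtain ⟨c, hc⟩ := (Submodule.mem_span_range_iff_exists_fun F).1 hx
  refine ⟨c 0, c 1, c 2, ?_⟩
  rw [← hc, Fin.sum_univ_three]
  rfl

lemma linearIndependent_triple_iff {u v w : Fin 3 → F} :
    LinearIndependent F ![u, v, w] ↔
      ∀ a b c : F, a • u + b • v + c • w = 0 → a = 0 ∧ b = 0 ∧ c = 0 := by
  rw [Fintype.linearIndependent_iff]
  constructor
  · intro h a b c habc
    have := h ![a, b, c] (by simpa [Fin.sum_univ_three] using habc)
    exact ⟨this 0, this 1, this 2⟩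
  · intro h g hg
    obtain ⟨h0, h1, h2⟩ := h (g 0) (g 1) (g 2) (by simpa [Fin.sum_univ_three] using hg)
    intro i
    fin_cases i <;> assumption

/-- Three linearly dependent vectors are zeros of a common nonzero linear form. -/
lemma exists_linearForm {u v w : Fin 3 → F} (h : ¬ LinearIndependent F ![u, v, w]) :
    ∃ φ : MvPolynomial (Fin 3) F, φ ≠ 0 ∧ φ.IsHomogeneous 1 ∧
      eval u φ = 0 ∧ eval v φ = 0 ∧ eval w φ = 0 := by
  have hdet : (Matrix.of ![u, v, w]).det = 0 := by
    by_contra hne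
    exact h (Matrix.linearIndependent_rows_iff_isUnit.2
      ((Matrix.isUnit_iff_isUnit_det _).2 (isUnit_iff_ne_zero.2 hne)))
  obtain ⟨z, hz, hmz⟩ := Matrix.exists_mulVec_eq_zero_iff.2 hdet
  have hev : ∀ x : Fin 3 → F, eval x (∑ i, C (z i) * X i) = ∑ i, x i * z i := fun x => by
    simp [mul_comm]
  refine ⟨∑ i, C (z i) * X i, ?_, IsHomogeneous.sum _ _ _ fun i _ => ?_, ?_, ?_, ?_⟩
  · intro h0
    apply hz
    ext j
    have := hev (Pi.single j 1)
    simpa [h0, Pi.single_apply] using this.symm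
  · simpa using (isHomogeneous_C (Fin 3) (z i)).mul (isHomogeneous_X F i)
  · rw [hev]; exact congrFun hmz 0
  · rw [hev]; exact congrFun hmz 1
  · rw [hev]; exact congrFun hmz 2

/-- The points of the line through `u` and `v`, other than these two, are parametrized by the
nonzero scalars. -/
lemma exists_param_line [Fintype F] {u v x : Fin 3 → F} (hv : v ≠ 0)
    (huv : ∀ r : F, u ≠ r • v) (hxu : ∀ r : F, x ≠ r • u) (hxv : ∀ r : F, x ≠ r • v)
    {φ : MvPolynomial (Fin 3) F} (h0 : φ ≠ 0) (hφ : φ.IsHomogeneous 1)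
    (hu' : eval u φ = 0) (hv' : eval v φ = 0) (hx' : eval x φ = 0) :
    ∃ t : F, t ≠ 0 ∧ ∃ r : F, x = r • (t • u + v) := by
  have hdep : ¬ LinearIndependent F ![u, v, x] := by
    intro hli
    refine h0 (hφ.eq_zero_of_forall_eval_eq_zero_of_le_card (fun y => ?_) ?_)
    · obtain ⟨a, b, c, rfl⟩ := exists_eq_comb hli y
      rw [eval_linearForm hφ, hu', hv', hx']
      ring
    · exact Cardinal.one_le_iff_ne_zero.2 (Cardinal.mk_ne_zero F)
  rw [linearIndependent_triple_iff] at hdep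
  push Not at hdep
  obtain ⟨a, b, c, habc, hne⟩ := hdep
  have hc : c ≠ 0 := by
    rintro rfl
    by_cases ha : a = 0
    · subst ha
      simp only [zero_smul, zero_add, add_zero, smul_eq_zero, hv, or_false] at habc
      exact hne rfl habc rfl
    · refine huv (-(b / a)) ?_
      rw [← sub_eq_zero, ← smul_right_injective _ ha |>.eq_iff, smul_zero, ← habc]
      ext i
      simp
      field_simp
  have hx : x = (-(a / c)) • u + (-(b / c)) • v := by
    rw [← sub_eq_zero, ← smul_right_injective _ hc |>.eq_iff, smul_zero, ← habc]
    ext i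
    simp
    field_simp
    ring
  have ha : a ≠ 0 := by
    rintro rfl
    exact hxv (-(b / c)) (by simpa using hx)
  have hb : b ≠ 0 := by
    rintro rfl
    exact hxu (-(a / c)) (by simpa using hx)
  refine ⟨a / b, div_ne_zero ha hb, -(b / c), ?_⟩
  rw [hx]
  ext i
  simp
  field_simp
  ring

/-- The points of the conic through five vectors in general position, other than the first three
of them, are parametrized by the scalars outside a set `{0, s}` of size two. -/
lemma exists_param_conic [Fintype F] (h2 : 2 ≤ Fintype.card F) {v₁ v₂ v₃ v₄ v₅ : Fin 3 → F}
    (h123 : LinearIndependent F ![v₁, v₂, v₃]) (h124 : LinearIndependent F ![v₁, v₂, v₄])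
    (h134 : LinearIndependent F ![v₁, v₃, v₄]) (h234 : LinearIndependent F ![v₂, v₃, v₄])
    (h125 : LinearIndependent F ![v₁, v₂, v₅]) (h135 : LinearIndependent F ![v₁, v₃, v₅])
    (h235 : LinearIndependent F ![v₂, v₃, v₅]) (h145 : LinearIndependent F ![v₁, v₄, v₅])
    (h245 : LinearIndependent F ![v₂, v₄, v₅]) (h345 : LinearIndependent F ![v₃, v₄, v₅]) :
    ∃ (s : F) (g : F → Fin 3 → F), s ≠ 0 ∧
      ∀ Q : MvPolynomial (Fin 3) F, Q ≠ 0 → Q.IsHomogeneous 2 →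
        eval v₁ Q = 0 → eval v₂ Q = 0 → eval v₃ Q = 0 → eval v₄ Q = 0 → eval v₅ Q = 0 →
        ∀ x : Fin 3 → F, eval x Q = 0 → (∀ r : F, x ≠ r • v₁) → (∀ r : F, x ≠ r • v₂) →
          (∀ r : F, x ≠ r • v₃) → ∃ t : F, (t ≠ 0 ∧ t ≠ s) ∧ ∃ r : F, x = r • g t := by
  obtain ⟨x₄, y₄, z₄, e₄⟩ := exists_eq_comb h123 v₄
  obtain ⟨x₅, y₅, z₅, e₅⟩ := exists_eq_comb h123 v₅
  rw [linearIndependent_triple_iff] at h124 h134 h234 h125 h135 h235 h145 h245 h345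
  have hx₄ : x₄ ≠ 0 := by
    rintro rfl
    exact neg_ne_zero.2 one_ne_zero (h234 y₄ z₄ (-1) (by rw [e₄]; module)).2.2
  have hy₄ : y₄ ≠ 0 := by
    rintro rfl
    exact neg_ne_zero.2 one_ne_zero (h134 x₄ z₄ (-1) (by rw [e₄]; module)).2.2
  have hz₄ : z₄ ≠ 0 := by
    rintro rfl
    exact neg_ne_zero.2 one_ne_zero (h124 x₄ y₄ (-1) (by rw [e₄]; module)).2.2
  have hx₅ : x₅ ≠ 0 := by
    rintro rfl
    exact neg_ne_zero.2 one_ne_zero (h235 y₅ z₅ (-1) (by rw [e₅]; module)).2.2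
  have hy₅ : y₅ ≠ 0 := by
    rintro rfl
    exact neg_ne_zero.2 one_ne_zero (h135 x₅ z₅ (-1) (by rw [e₅]; module)).2.2
  have hz₅ : z₅ ≠ 0 := by
    rintro rfl
    exact neg_ne_zero.2 one_ne_zero (h125 x₅ y₅ (-1) (by rw [e₅]; module)).2.2
  have hyz : z₄ * y₅ - y₄ * z₅ ≠ 0 := by
    intro h
    refine hy₅ (h145 (-(y₅ * x₄ - y₄ * x₅)) y₅ (-y₄) ?_).2.1
    have h' : (y₅ * z₄ - y₄ * z₅) • v₃ = 0 := by rw [mul_comm y₅, h, zero_smul]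
    rw [e₄, e₅, ← h']
    module
  have hxz : z₅ * x₄ - x₅ * z₄ ≠ 0 := by
    intro h
    refine hx₅ (h245 (-(x₅ * y₄ - x₄ * y₅)) x₅ (-x₄) ?_).2.1
    have h' : (-(z₅ * x₄ - x₅ * z₄)) • v₃ = 0 := by rw [h, neg_zero, zero_smul]
    rw [e₄, e₅, ← h']
    module
  have hxy : y₄ * x₅ - x₄ * y₅ ≠ 0 := by
    intro h
    refine hx₅ (h345 (-(x₅ * z₄ - x₄ * z₅)) x₅ (-x₄) ?_).2.1
    have h' : (y₄ * x₅ - x₄ * y₅) • v₂ = 0 := by rw [h, zero_smul]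
    rw [e₄, e₅, ← h']
    module
  obtain ⟨A, hA⟩ : ∃ A, A = x₄ * x₅ * (z₄ * y₅ - y₄ * z₅) := ⟨_, rfl⟩
  obtain ⟨B, hB⟩ : ∃ B, B = y₄ * y₅ * (z₅ * x₄ - x₅ * z₄) := ⟨_, rfl⟩
  obtain ⟨D, hD⟩ : ∃ D, D = z₄ * z₅ * (y₄ * x₅ - x₄ * y₅) := ⟨_, rfl⟩
  have hA0 : A ≠ 0 := hA ▸ mul_ne_zero (mul_ne_zero hx₄ hx₅) hyz
  have hB0 : B ≠ 0 := hB ▸ mul_ne_zero (mul_ne_zero hy₄ hy₅) hxz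
  have hD0 : D ≠ 0 := hD ▸ mul_ne_zero (mul_ne_zero hz₄ hz₅) hxy
  refine ⟨-(D / A), fun t => t⁻¹ • v₁ + (-((A * t + D) / B))⁻¹ • v₂ + v₃,
    neg_ne_zero.2 (div_ne_zero hD0 hA0), ?_⟩
  intro Q hQ0 hQ q₁ q₂ q₃ q₄ q₅ x qx hn₁ hn₂ hn₃
  obtain ⟨l, m, n, hlmn⟩ := exists_eval_quadraticForm hQ q₁ q₂ q₃
  rw [e₄, hlmn] at q₄
  rw [e₅, hlmn] at q₅
  -- `(l, m, n)` is orthogonal to two vectors with cross product `(A, B, D)`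
  have hm : m = l / A * B := by
    field_simp
    rw [hA, hB]
    linear_combination (x₅ * y₅) * q₄ - (x₄ * y₄) * q₅
  have hn : n = l / A * D := by
    field_simp
    rw [hA, hD]
    linear_combination (x₄ * z₄) * q₅ - (x₅ * z₅) * q₄
  have hl : l ≠ 0 := by
    rintro rfl
    refine hQ0 (hQ.eq_zero_of_forall_eval_eq_zero_of_le_card (fun y => ?_) ?_)
    · obtain ⟨a, b, c, rfl⟩ := exists_eq_comb h123 y
      rw [hlmn, hm, hn]
      ring
    · rw [Cardinal.mk_fintype]
      exact_mod_cast h2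
  obtain ⟨a, b, c, rfl⟩ := exists_eq_comb h123 x
  have hABD : A * (b * c) + B * (a * c) + D * (a * b) = 0 := by
    rw [hlmn, hm, hn] at qx
    have : l / A * (A * (b * c) + B * (a * c) + D * (a * b)) = 0 := by
      rw [← qx]
      field_simp
    exact (mul_eq_zero.1 this).resolve_left (div_ne_zero hl hA0)
  have ha : a ≠ 0 := by
    rintro rfl
    have : b = 0 ∨ c = 0 := by simpa [hA0] using hABD
    rcases this with rfl | rfl
    · exact hn₃ c (by module)
    · exact hn₂ b (by module)
  have hb : b ≠ 0 := by
    rintro rfl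
    have : a = 0 ∨ c = 0 := by simpa [hB0] using hABD
    rcases this with rfl | rfl
    · exact hn₃ c (by module)
    · exact hn₁ a (by module)
  have hc : c ≠ 0 := by
    rintro rfl
    have : a = 0 ∨ b = 0 := by simpa [hD0] using hABD
    rcases this with rfl | rfl
    · exact hn₂ b (by module)
    · exact hn₁ a (by module)
  have hY : -((A * (c / a) + D) / B) = c / b := by
    field_simp
    linear_combination -hABD
  refine ⟨c / a, ⟨div_ne_zero hc ha, fun h => ?_⟩, c, ?_⟩
  · have h0 : A * (c / a) + D = 0 := by
      rw [h]
      field_simp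
      ring
    rw [h0] at hY
    exact div_ne_zero hc hb (by rw [← hY]; simp)
  · beta_reduce
    rw [hY]
    ext i
    simp
    field_simp

end Forms

section Counting

variable {F : Type*} [Field F]

lemma rep_ne_smul_rep {p p' : P2 F} (h : p ≠ p') (r : F) : p.rep ≠ r • p'.rep := by
  intro hr
  apply h
  rw [← p.mk_rep, ← p'.mk_rep, Projectivization.mk_eq_mk_iff']
  exact ⟨r, hr.symm⟩

lemma eq_of_rep_eq_smul {p p' : P2 F} {y : Fin 3 → F} {r s : F} (h : p.rep = r • y)
    (h' : p'.rep = s • y) : p = p' := by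
  by_contra hne
  have hs : s ≠ 0 := by
    rintro rfl
    exact p'.rep_nonzero (by simpa using h')
  refine rep_ne_smul_rep hne (r / s) ?_
  rw [h, h', smul_smul, div_mul_cancel₀ _ hs]

/-- A set of points parametrized, up to scaling, by a set of scalars is no larger than it. -/
lemma card_le_of_param {E : Finset (P2 F)} {T : Finset F} (g : F → Fin 3 → F)
    (h : ∀ p ∈ E, ∃ t ∈ T, ∃ r : F, p.rep = r • g t) : #E ≤ #T := by
  refine Finset.card_le_card_of_forall_subsingleton (fun p t => ∃ r : F, p.rep = r • g t) h ?_
  rintro t - p ⟨-, r, hr⟩ p' ⟨-, r', hr'⟩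
  exact eq_of_rep_eq_smul hr hr'

lemma IsArc.linearIndependent [Finite F] {K : Set (P2 F)} (hK : IsArc K) {p₁ p₂ p₃ : P2 F}
    (h₁ : p₁ ∈ K) (h₂ : p₂ ∈ K) (h₃ : p₃ ∈ K) (h₁₂ : p₁ ≠ p₂) (h₁₃ : p₁ ≠ p₃) (h₂₃ : p₂ ≠ p₃) :
    LinearIndependent F ![p₁.rep, p₂.rep, p₃.rep] := by
  by_contra hdep
  obtain ⟨φ, h0, hφ, e₁, e₂, e₃⟩ := exists_linearForm hdep
  have hle := hK _ ⟨φ, h0, hφ, rfl⟩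
  have hsub : ({p₁, p₂, p₃} : Set (P2 F)) ⊆ K ∩ {p : P2 F | eval p.rep φ = 0} := by
    rintro p (rfl | rfl | rfl)
    exacts [⟨h₁, e₁⟩, ⟨h₂, e₂⟩, ⟨h₃, e₃⟩]
  have h3 : ({p₁, p₂, p₃} : Set (P2 F)).ncard = 3 :=
    Set.ncard_eq_three.2 ⟨_, _, _, h₁₂, h₁₃, h₂₃, rfl⟩
  have := Set.ncard_le_ncard hsub (Set.toFinite _)
  omega

/-- At most `q - 1` further points are collinear with two given points. -/
lemma card_line_le [Fintype F] {S E : Finset (P2 F)} (hS : #S = 2)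
    (hE : ∀ p ∈ E, p ∉ S ∧ ∃ L, IsLine L ∧ p ∈ L ∧ ↑S ⊆ L) : #E ≤ Fintype.card F - 1 := by
  classical
  obtain ⟨u, v, huv, rfl⟩ := Finset.card_eq_two.1 hS
  rw [← Finset.card_univ, ← Finset.card_erase_of_mem (Finset.mem_univ (0 : F))]
  refine card_le_of_param (fun t => t • u.rep + v.rep) fun p hp => ?_
  obtain ⟨hpS, _, ⟨φ, h0, hφ, rfl⟩, hpL, hSL⟩ := hE p hp
  simp only [Finset.mem_insert, Finset.mem_singleton, not_or] at hpS
  obtain ⟨t, ht, r, hr⟩ := exists_param_line v.rep_nonzero (rep_ne_smul_rep huv)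
    (rep_ne_smul_rep hpS.1) (rep_ne_smul_rep hpS.2) h0 hφ (hSL (by simp)) (hSL (by simp)) hpL
  exact ⟨t, by simpa using ht, r, hr⟩

/-- At most `q - 4` further points are on a conic with five given points of an arc. -/
lemma card_conic_le [Fintype F] {K : Set (P2 F)} (hK : IsArc K)
    {S E : Finset (P2 F)} (hS : #S = 5) (hSK : ↑S ⊆ K)
    (hE : ∀ p ∈ E, p ∉ S ∧ ∃ C, IsConic C ∧ p ∈ C ∧ ↑S ⊆ C) : #E ≤ Fintype.card F - 4 := by
  classical
  rcases E.eq_empty_or_nonempty with rfl | ⟨p₀, hp₀⟩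
  · simp
  let e := S.equivFinOfCardEq hS
  obtain ⟨P, hPdef⟩ : ∃ P : Fin 5 → P2 F, P = fun i => (e.symm i).1 := ⟨_, rfl⟩
  have hPS : ∀ i, P i ∈ S := fun i => hPdef ▸ (e.symm i).2
  have hP : ∀ {i j}, i ≠ j → P i ≠ P j := fun {i j} hij h =>
    hij (e.symm.injective (Subtype.ext (by simpa [hPdef] using h)))
  have hli : ∀ i j k : Fin 5, i ≠ j → i ≠ k → j ≠ k →
      LinearIndependent F ![(P i).rep, (P j).rep, (P k).rep] := fun i j k hij hik hjk =>
    hK.linearIndependent (hSK (hPS i)) (hSK (hPS j)) (hSK (hPS k)) (hP hij) (hP hik) (hP hjk)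
  obtain ⟨s, g, hs, hg⟩ := exists_param_conic Fintype.one_lt_card
    (hli 0 1 2 (by decide) (by decide) (by decide)) (hli 0 1 3 (by decide) (by decide) (by decide))
    (hli 0 2 3 (by decide) (by decide) (by decide)) (hli 1 2 3 (by decide) (by decide) (by decide))
    (hli 0 1 4 (by decide) (by decide) (by decide)) (hli 0 2 4 (by decide) (by decide) (by decide))
    (hli 1 2 4 (by decide) (by decide) (by decide)) (hli 0 3 4 (by decide) (by decide) (by decide))
    (hli 1 3 4 (by decide) (by decide) (by decide)) (hli 2 3 4 (by decide) (by decide) (by decide))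
  have hcard : #(insert (P 3) (insert (P 4) E)) = #E + 2 := by
    rw [Finset.card_insert_of_notMem, Finset.card_insert_of_notMem]
    · exact fun h => (hE _ h).1 (hPS 4)
    · rw [Finset.mem_insert, not_or]
      exact ⟨hP (by decide), fun h => (hE _ h).1 (hPS 3)⟩
  have hT : #((Finset.univ.erase (0 : F)).erase s) = Fintype.card F - 2 := by
    rw [Finset.card_erase_of_mem (by simpa using hs), Finset.card_erase_of_mem (Finset.mem_univ _),
      Finset.card_univ, Nat.sub_sub]
  have hle : #(insert (P 3) (insert (P 4) E)) ≤ #((Finset.univ.erase (0 : F)).erase s) := by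
    refine card_le_of_param g fun p hp => ?_
    obtain ⟨C, hC, hpC, hSC⟩ : ∃ C, IsConic C ∧ p ∈ C ∧ ↑S ⊆ C := by
      obtain ⟨-, C, hC, -, hSC⟩ := hE p₀ hp₀
      rcases Finset.mem_insert.1 hp with rfl | hp
      · exact ⟨C, hC, hSC (hPS 3), hSC⟩
      rcases Finset.mem_insert.1 hp with rfl | hp
      · exact ⟨C, hC, hSC (hPS 4), hSC⟩
      · exact (hE p hp).2
    have hne : ∀ i : Fin 5, i ≠ 3 → i ≠ 4 → p ≠ P i := by
      intro i h3 h4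
      rcases Finset.mem_insert.1 hp with rfl | hp
      · exact hP h3.symm
      rcases Finset.mem_insert.1 hp with rfl | hp
      · exact hP h4.symm
      · rintro rfl
        exact (hE _ hp).1 (hPS i)
    obtain ⟨Q, hQ0, hQ, rfl⟩ := hC
    obtain ⟨t, ⟨ht0, hts⟩, r, hr⟩ := hg Q hQ0 hQ (hSC (hPS 0)) (hSC (hPS 1)) (hSC (hPS 2))
      (hSC (hPS 3)) (hSC (hPS 4)) p.rep hpC
      (rep_ne_smul_rep (hne 0 (by decide) (by decide)))
      (rep_ne_smul_rep (hne 1 (by decide) (by decide)))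
      (rep_ne_smul_rep (hne 2 (by decide) (by decide)))
    exact ⟨t, by simp [ht0, hts], r, hr⟩
  omega

/-- If adding `p` to `K` pushes the intersection with `C` above size `n`, then `p ∈ C` and `C`
contains `n` points of `K`. -/
lemma exists_finset_of_lt_ncard_insert_inter {α : Type*} [Finite α] {K C : Set α} {p : α} {n : ℕ}
    (h : (K ∩ C).ncard ≤ n) (h' : n < (insert p K ∩ C).ncard) :
    p ∈ C ∧ ∃ S : Finset α, #S = n ∧ ↑S ⊆ K ∧ ↑S ⊆ C := by
  have hp : p ∈ C := by
    by_contra hp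
    rw [Set.insert_inter_of_notMem hp] at h'
    omega
  refine ⟨hp, ?_⟩
  rw [Set.insert_inter_of_mem hp] at h'
  have hn : n ≤ (K ∩ C).ncard := by
    have := Set.ncard_insert_le p (K ∩ C)
    omega
  obtain ⟨S, hS, hSn⟩ := Set.exists_subset_card_eq hn
  refine ⟨(Set.toFinite S).toFinset, ?_, ?_, ?_⟩
  · rw [← hSn, Set.ncard_eq_toFinset_card]
  · simpa using hS.trans Set.inter_subset_left
  · simpa using hS.trans Set.inter_subset_right

end Counting

/-- every complete Veronesian `k`-arc in `P²(F)` (`q ≥ 5`) satisfies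
`C(k,5)(q−4) + C(k,2)(q−1) + k ≥ q² + q + 1`. -/
theorem stmt15 {F : Type*} [Field F] [Fintype F] (q : ℕ) (hq : Fintype.card F = q)
    (h5 : 5 ≤ q) (k : ℕ) (K : Set (P2 F)) (hver : IsVerArc K) (hcard : K.ncard = k)
    (hcomp : ∀ p ∉ K, ¬ IsVerArc (insert p K)) :
    q ^ 2 + q + 1 ≤ Nat.choose k 5 * (q - 4) + Nat.choose k 2 * (q - 1) + k := by
  classical
  have : Fintype (P2 F) := Fintype.ofFinite _
  have hKf : #K.toFinset = k := by rw [← hcard, Set.ncard_eq_toFinset_card']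
  let L (S : Finset (P2 F)) : Finset (P2 F) :=
    {p | p ∉ S ∧ ∃ L, IsLine L ∧ p ∈ L ∧ ↑S ⊆ L}
  let D (S : Finset (P2 F)) : Finset (P2 F) :=
    {p | p ∉ S ∧ ∃ C, IsConic C ∧ p ∈ C ∧ ↑S ⊆ C}
  have hL : #((K.toFinset.powersetCard 2).biUnion L) ≤ Nat.choose k 2 * (q - 1) := by
    rw [← hKf, ← Finset.card_powersetCard, ← hq]
    refine Finset.card_biUnion_le_card_mul _ _ _ fun S hS => ?_
    exact card_line_le (Finset.mem_powersetCard.1 hS).2 fun p hp => by simpa [L] using hp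
  have hD : #((K.toFinset.powersetCard 5).biUnion D) ≤ Nat.choose k 5 * (q - 4) := by
    rw [← hKf, ← Finset.card_powersetCard, ← hq]
    refine Finset.card_biUnion_le_card_mul _ _ _ fun S hS => ?_
    rw [Finset.mem_powersetCard] at hS
    exact card_conic_le hver.1 hS.2 (by simpa using hS.1) fun p hp => by simpa [D] using hp
  have hcover : (Finset.univ : Finset (P2 F)) ⊆ (K.toFinset.powersetCard 5).biUnion D ∪
      (K.toFinset.powersetCard 2).biUnion L ∪ K.toFinset := by
    intro p _
    by_cases hpK : p ∈ K
    · simp [hpK]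
    have hp := hcomp p hpK
    simp only [IsVerArc, not_and_or, IsArc, IsGenArc, not_forall, not_le] at hp
    rcases hp with ⟨C, hC, h⟩ | ⟨C, hC, h⟩
    · obtain ⟨hpC, S, hS, hSK, hSC⟩ := exists_finset_of_lt_ncard_insert_inter (hver.1 C hC) h
      refine Finset.mem_union_left _ (Finset.mem_union_right _ (Finset.mem_biUnion.2 ⟨S, ?_, ?_⟩))
      · simpa [Finset.mem_powersetCard, hS] using hSK
      · simpa [L] using ⟨fun hpS => hpK (hSK hpS), C, hC, hpC, hSC⟩
    · obtain ⟨hpC, S, hS, hSK, hSC⟩ := exists_finset_of_lt_ncard_insert_inter (hver.2 C hC) h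
      refine Finset.mem_union_left _ (Finset.mem_union_left _ (Finset.mem_biUnion.2 ⟨S, ?_, ?_⟩))
      · simpa [Finset.mem_powersetCard, hS] using hSK
      · simpa [D] using ⟨fun hpS => hpK (hSK hpS), C, hC, hpC, hSC⟩
  have htot : Fintype.card (P2 F) = q ^ 2 + q + 1 := by
    rw [Fintype.card_eq_nat_card, Projectivization.card_of_finrank F (Fin 3 → F) (n := 3) (by simp),
      Nat.card_eq_fintype_card, hq]
    simp [Finset.sum_range_succ]
    ring
  calc q ^ 2 + q + 1 = #(Finset.univ : Finset (P2 F)) := by rw [Finset.card_univ, htot]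
    _ ≤ _ := Finset.card_le_card hcover
    _ ≤ _ := Finset.card_union_le _ _
    _ ≤ _ := Nat.add_le_add (Finset.card_union_le _ _) hKf.le
    _ ≤ _ := Nat.add_le_add_right (Nat.add_le_add hD hL) k
end
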